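/- arXiv:1403.6666 — 3 statements merged into one kernel-verified Lean document; each statement's English description precedes it below -/
import Mathlib

section
/- Let Ω ⊂ ℝ² be a bounded C² domain with outer boundary Γ₀, outer perimeter L₀ := H¹(Γ₀), and inner radius R of the region enclosed by Γ₀. Then for almost every t ∈ [0, R] the isoperimetric-type estimate L(t)² ≤ L₀² − 4π·A(t) holds, where A(t) := |{x ∈ Ω : dist(x, Γ₀) < t}| and L(t) := H¹({x ∈ Ω : dist(x, Γ₀) = t}). Equivalently, the function r(t) := √(L₀² − 4π·A(t)) / (2π) satisfies |r'(t)| ≤ 1 for almost every t ∈ [0, R]. -/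
open MeasureTheory Metric Filter Asymptotics Real RealInnerProductSpace

noncomputable section

abbrev Eu (d : ℕ) := EuclideanSpace ℝ (Fin d)

/-- A `C²` Jordan curve in the plane: a periodic, regular, `C²` curve which is
injective on a period. -/
def IsC2JordanCurve (γ : ℝ → Eu 2) : Prop :=
  ContDiff ℝ 2 γ ∧ Function.Periodic γ 1 ∧
  (∀ s ∈ Set.Ico (0 : ℝ) 1, ∀ t ∈ Set.Ico (0 : ℝ) 1, γ s = γ t → s = t) ∧
  ∀ t, deriv γ t ≠ 0

/-- A bounded planar `C²` domain: a bounded open connected set whose boundary is a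
finite disjoint union of `C²` Jordan curves. -/
def IsC2Domain (Ω : Set (Eu 2)) : Prop :=
  IsOpen Ω ∧ IsConnected Ω ∧ Bornology.IsBounded Ω ∧
  ∃ (N : ℕ) (γ : Fin N → ℝ → Eu 2),
    (∀ i, IsC2JordanCurve (γ i)) ∧
    (∀ i j, i ≠ j → Disjoint (Set.range (γ i)) (Set.range (γ j))) ∧
    frontier Ω = ⋃ i, Set.range (γ i)

/-- The unbounded connected component of the complement of the closure of `Ω`. -/
def unboundedPart (Ω : Set (Eu 2)) : Set (Eu 2) :=
  {x | x ∈ (closure Ω)ᶜ ∧ ¬ Bornology.IsBounded (connectedComponentIn (closure Ω)ᶜ x)}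

/-- The outer boundary `Γ₀` of `Ω`: the boundary of the unbounded component of the
complement of the closure of `Ω`. -/
def outerBoundary (Ω : Set (Eu 2)) : Set (Eu 2) :=
  frontier (unboundedPart Ω)

/-- The open region `Ω₀` enclosed by the outer boundary of `Ω`. -/
def innerRegion (Ω : Set (Eu 2)) : Set (Eu 2) :=
  (closure (unboundedPart Ω))ᶜ

/-- The inner radius `R` of the region enclosed by the outer boundary of `Ω`. -/
def innerRadius (Ω : Set (Eu 2)) : ℝ :=
  sSup ((fun x => infDist x (outerBoundary Ω)) '' innerRegion Ω)

/-- The outer perimeter `L₀ = H¹(Γ₀)`. -/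
def outerPerim (Ω : Set (Eu 2)) : ℝ :=
  (μH[1] (outerBoundary Ω)).toReal

/-- `A(t)`, the area of the part of the `t`-neighbourhood of the outer boundary lying
inside `Ω`. -/
def areaFn (Ω : Set (Eu 2)) (t : ℝ) : ℝ :=
  (volume {x ∈ Ω | infDist x (outerBoundary Ω) < t}).toReal

/-- `L(t)`, the length of the part of the level curve at distance `t` from the outer
boundary that lies inside `Ω`. -/
def lenFn (Ω : Set (Eu 2)) (t : ℝ) : ℝ :=
  (μH[1] {x ∈ Ω | infDist x (outerBoundary Ω) = t}).toReal

section

open scoped Pointwise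

/-! ### Euler characteristic of planar grid complexes -/

/-- Extension by zero of a function on a finite set, as a linear map. -/
def extendZero {α : Type*} [DecidableEq α] (X : Finset α) : (X → ℚ) →ₗ[ℚ] (α → ℚ) where
  toFun c p := if h : p ∈ X then c ⟨p, h⟩ else 0
  map_add' c d := by ext p; by_cases h : p ∈ X <;> simp [h]
  map_smul' r c := by ext p; by_cases h : p ∈ X <;> simp [h]

lemma extendZero_of_notMem {α : Type*} [DecidableEq α] {X : Finset α} (c : X → ℚ) {p : α}
    (h : p ∉ X) : extendZero X c p = 0 := by
  simp [extendZero, h]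

lemma extendZero_coe {α : Type*} [DecidableEq α] {X : Finset α} (c : X → ℚ) (p : X) :
    extendZero X c p = c p := by
  simp [extendZero]

/-- The sum of the values of `c` at the points of `X` to the right of `p` in the row of `p`. -/
def rowSum (X : Finset (ℤ × ℤ)) : (ℤ × ℤ → ℚ) →ₗ[ℚ] (ℤ × ℤ → ℚ) where
  toFun c p := ∑ q ∈ X, if q.2 = p.2 ∧ p.1 ≤ q.1 then c q else 0
  map_add' c d := by
    ext p
    simp only [Pi.add_apply, ← Finset.sum_add_distrib]
    refine Finset.sum_congr rfl fun q _ => ?_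
    split_ifs <;> simp
  map_smul' r c := by
    ext p
    simp only [Pi.smul_apply, Finset.smul_sum, RingHom.id_apply]
    refine Finset.sum_congr rfl fun q _ => ?_
    split_ifs <;> simp

lemma rowSum_apply (X : Finset (ℤ × ℤ)) (c : ℤ × ℤ → ℚ) (p : ℤ × ℤ) :
    rowSum X c p = ∑ q ∈ X, if q.2 = p.2 ∧ p.1 ≤ q.1 then c q else 0 := rfl

lemma rowSum_sub_right (X : Finset (ℤ × ℤ)) (c : ℤ × ℤ → ℚ) (hc : ∀ p ∉ X, c p = 0)
    (p : ℤ × ℤ) : rowSum X c p - rowSum X c (p.1 + 1, p.2) = c p := by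
  rw [rowSum_apply, rowSum_apply, ← Finset.sum_sub_distrib]
  have : ∀ q ∈ X, ((if q.2 = p.2 ∧ p.1 ≤ q.1 then c q else 0) -
      if q.2 = (p.1 + 1, p.2).2 ∧ (p.1 + 1, p.2).1 ≤ q.1 then c q else 0) =
      if q = p then c q else 0 := by
    intro q _
    obtain ⟨a, b⟩ := p
    obtain ⟨a', b'⟩ := q
    simp only [Prod.mk.injEq]
    split_ifs <;> first | omega | simp
  rw [Finset.sum_congr rfl this, Finset.sum_ite_eq']
  split_ifs with h
  · rfl
  · exact (hc p h).symm

lemma eq_zero_of_succ_of_large {u : ℤ → ℚ} (hs : ∀ a, u a = u (a + 1)) {M : ℤ}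
    (hM : ∀ a, M < a → u a = 0) (a : ℤ) : u a = 0 := by
  have key : ∀ n : ℕ, u a = u (a + n) := by
    intro n
    induction n with
    | zero => simp
    | succ n ih => rw [ih, hs]; push_cast; ring_nf
  rw [key (M - a + 1).toNat]
  apply hM
  have := Int.self_le_toNat (M - a + 1)
  omega

lemma grid_cycle_eq_boundary {X Y : Finset (ℤ × ℤ)} {c d : ℤ × ℤ → ℚ}
    (hc : ∀ p ∉ X, c p = 0) (hd : ∀ p ∉ Y, d p = 0)
    (hcyc : ∀ p : ℤ × ℤ, c p - c (p.1 + 1, p.2) + d p - d (p.1, p.2 + 1) = 0) :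
    (∀ p : ℤ × ℤ, c p = rowSum Y d (p.1, p.2 + 1) - rowSum Y d p) ∧
      (Function.support (rowSum Y d)).Finite := by
  obtain ⟨M, hM⟩ : ∃ M : ℤ, ∀ p ∈ X ∪ Y, |p.1| ≤ M ∧ |p.2| ≤ M := by
    refine ⟨∑ q ∈ X ∪ Y, (|q.1| + |q.2|), fun p hp => ?_⟩
    have := Finset.single_le_sum (f := fun q : ℤ × ℤ => |q.1| + |q.2|)
      (fun q _ => add_nonneg (abs_nonneg _) (abs_nonneg _)) hp
    have h1 := abs_nonneg p.1
    have h2 := abs_nonneg p.2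
    constructor <;> linarith
  have hf1 : ∀ a b, M < a → rowSum Y d (a, b) = 0 := by
    intro a b h
    rw [rowSum_apply]
    refine Finset.sum_eq_zero fun q hq => if_neg ?_
    rintro ⟨-, h2⟩
    have := (abs_le.1 (hM q (Finset.mem_union_right _ hq)).1).2
    simp only at h2
    omega
  have hf2 : ∀ a b, M < |b| → rowSum Y d (a, b) = 0 := by
    intro a b h
    rw [rowSum_apply]
    refine Finset.sum_eq_zero fun q hq => if_neg ?_
    rintro ⟨h1, -⟩
    have := (hM q (Finset.mem_union_right _ hq)).2
    simp only at h1
    rw [h1] at this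
    omega
  have hc1 : ∀ a b, M < |a| → c (a, b) = 0 := by
    intro a b h
    refine hc _ fun h' => ?_
    have := (hM _ (Finset.mem_union_left _ h')).1
    simp only at this
    omega
  have hstep := rowSum_sub_right Y d hd
  have hg : ∀ p : ℤ × ℤ, c p = rowSum Y d (p.1, p.2 + 1) - rowSum Y d p := by
    rintro ⟨a, b⟩
    have := eq_zero_of_succ_of_large
      (u := fun a => c (a, b) - (rowSum Y d (a, b + 1) - rowSum Y d (a, b))) (M := M) ?_ ?_ a
    · simp only at this ⊢; linarith
    · intro a
      have h1 := hstep (a, b)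
      have h2 := hstep (a, b + 1)
      have h3 := hcyc (a, b)
      simp only at h1 h2 h3 ⊢
      linarith
    · intro a ha
      rw [hc1 a b (lt_of_lt_of_le ha (le_abs_self _)), hf1 _ _ ha, hf1 _ _ ha]
      simp
  refine ⟨hg, ?_⟩
  have hf3 : ∀ a b, a < -M → rowSum Y d (a, b) = 0 := by
    intro a b h
    refine eq_zero_of_succ_of_large (u := fun b => rowSum Y d (a, b)) (M := M) ?_ ?_ b
    · intro b
      have h1 := hg (a, b)
      rw [hc1 a b (by rw [lt_abs]; right; omega)] at h1
      simp only at h1 ⊢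
      linarith
    · intro b hb
      exact hf2 _ _ (lt_of_lt_of_le hb (le_abs_self _))
  refine ((Set.finite_Icc (-M) M).prod (Set.finite_Icc (-M) M)).subset ?_
  rintro ⟨a, b⟩ hab
  by_contra hcon
  apply hab
  simp only [Set.mem_prod, Set.mem_Icc, not_and_or, not_le] at hcon
  rcases hcon with (h | h) | h | h
  · exact hf3 _ _ h
  · exact hf1 _ _ h
  · exact hf2 _ _ (by rw [lt_abs]; omega)
  · exact hf2 _ _ (by rw [lt_abs]; omega)

/-- A finite grid complex in the plane with vertex set `X₀`, horizontal and vertical edge sets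
`X₁` and `Y₁`, and face set `X₂`, none of whose complementary faces is enclosed, has Euler
characteristic at least one. -/
lemma grid_euler {X₀ X₁ Y₁ X₂ : Finset (ℤ × ℤ)} (hne : X₀.Nonempty)
    (h0 : ∀ p ∉ X₀, p ∉ X₁ ∧ (p.1 + 1, p.2) ∉ X₁ ∧ p ∉ Y₁ ∧ (p.1, p.2 + 1) ∉ Y₁)
    (H : ∀ f : ℤ × ℤ → ℚ, (Function.support f).Finite → (∀ p ∉ X₁, f (p.1, p.2 + 1) = f p) →
      (∀ p ∉ Y₁, f (p.1 + 1, p.2) = f p) → (∀ p ∈ X₂, f p = 0) → f = 0) :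
    X₁.card + Y₁.card + 1 ≤ X₀.card + X₂.card := by
  obtain ⟨v, hv⟩ := hne
  let bd : (ℤ × ℤ → ℚ) × (ℤ × ℤ → ℚ) →ₗ[ℚ] (ℤ × ℤ → ℚ) :=
    { toFun := fun c p => c.1 p - c.1 (p.1 + 1, p.2) + c.2 p - c.2 (p.1, p.2 + 1)
      map_add' := by intro c d; ext p; simp; ring
      map_smul' := by intro r c; ext p; simp; ring }
  let L : (X₁ → ℚ) × (Y₁ → ℚ) →ₗ[ℚ] (X₂ → ℚ) × (↥(X₀.erase v) → ℚ) :=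
    ((LinearMap.funLeft ℚ ℚ (Subtype.val : X₂ → ℤ × ℤ)).comp
      ((rowSum Y₁).comp ((extendZero Y₁).comp (LinearMap.snd ℚ _ _)))).prod
    ((LinearMap.funLeft ℚ ℚ (Subtype.val : ↥(X₀.erase v) → ℤ × ℤ)).comp
      (bd.comp ((extendZero X₁).prodMap (extendZero Y₁))))
  have hL : Function.Injective L := by
    rw [← LinearMap.ker_eq_bot, LinearMap.ker_eq_bot']
    rintro ⟨c', d'⟩ hcd
    set c := extendZero X₁ c' with hcdef
    set d := extendZero Y₁ d' with hddef
    have hc : ∀ p ∉ X₁, c p = 0 := fun p hp => extendZero_of_notMem _ hp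
    have hd : ∀ p ∉ Y₁, d p = 0 := fun p hp => extendZero_of_notMem _ hp
    have e1 : ∀ p ∈ X₂, rowSum Y₁ d p = 0 := fun p hp =>
      congrFun (congrArg Prod.fst hcd) ⟨p, hp⟩
    have e2 : ∀ p ∈ X₀.erase v, c p - c (p.1 + 1, p.2) + d p - d (p.1, p.2 + 1) = 0 :=
      fun p hp => congrFun (congrArg Prod.snd hcd) ⟨p, hp⟩
    have e3 : ∀ p, p ≠ v → c p - c (p.1 + 1, p.2) + d p - d (p.1, p.2 + 1) = 0 := by
      intro p hp
      by_cases hp0 : p ∈ X₀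
      · exact e2 p (Finset.mem_erase.2 ⟨hp, hp0⟩)
      · obtain ⟨h1, h2, h3, h4⟩ := h0 p hp0
        rw [hc _ h1, hc _ h2, hd _ h3, hd _ h4]; simp
    have fc : (Function.support c).Finite :=
      X₁.finite_toSet.subset fun p hp => by by_contra h; exact hp (hc p h)
    have fd : (Function.support d).Finite :=
      Y₁.finite_toSet.subset fun p hp => by by_contra h; exact hp (hd p h)
    let s₁ : ℤ × ℤ ≃ ℤ × ℤ := (Equiv.addRight (1 : ℤ)).prodCongr (Equiv.refl ℤ)
    let s₂ : ℤ × ℤ ≃ ℤ × ℤ := (Equiv.refl ℤ).prodCongr (Equiv.addRight (1 : ℤ))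
    have fc' : (Function.support fun p => c (s₁ p)).Finite := fc.preimage s₁.injective.injOn
    have fd' : (Function.support fun p => d (s₂ p)).Finite := fd.preimage s₂.injective.injOn
    have hsum : ∑ᶠ p, ((c p - c (s₁ p)) + (d p - d (s₂ p))) = 0 := by
      rw [finsum_add_distrib ((fc.union fc').subset (Function.support_sub _ _))
        ((fd.union fd').subset (Function.support_sub _ _)),
        finsum_sub_distrib fc fc', finsum_sub_distrib fd fd', finsum_comp_equiv s₁,
        finsum_comp_equiv s₂]
      simp
    have hcyc : ∀ p : ℤ × ℤ, c p - c (p.1 + 1, p.2) + d p - d (p.1, p.2 + 1) = 0 := by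
      intro p
      by_cases hp : p = v
      · subst hp
        rw [finsum_eq_single _ p] at hsum
        · have : c p - c (p.1 + 1, p.2) + (d p - d (p.1, p.2 + 1)) = 0 := hsum
          linarith
        · intro q hq
          have := e3 q hq
          change c q - c (q.1 + 1, q.2) + (d q - d (q.1, q.2 + 1)) = 0
          linarith
      · exact e3 p hp
    obtain ⟨hb, hfin⟩ := grid_cycle_eq_boundary hc hd hcyc
    have hr := rowSum_sub_right Y₁ d hd
    have hz := H _ hfin (fun p hp => by have := hb p; rw [hc p hp] at this; linarith)
      (fun p hp => by have := hr p; rw [hd p hp] at this; linarith) e1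
    rw [Prod.mk_eq_zero]
    constructor
    · ext p
      rw [← extendZero_coe c' p, ← hcdef, hb, hz]; simp
    · ext p
      rw [← extendZero_coe d' p, ← hddef, ← hr, hz]; simp
  have := LinearMap.finrank_le_finrank_of_injective hL
  rw [Module.finrank_prod, Module.finrank_prod] at this
  simp only [Module.finrank_fintype_fun_eq_card, Fintype.card_coe] at this
  rw [Finset.card_erase_of_mem hv] at this
  have := Finset.card_pos.2 ⟨v, hv⟩
  omega

/-! ### Exterior regions and lattice averaging -/

/-- An open set with bounded complement, every point of which can be joined to infinity inside
the set. -/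
def IsExteriorRegion {E : Type*} [PseudoMetricSpace E] (V : Set E) : Prop :=
  IsOpen V ∧ Bornology.IsBounded Vᶜ ∧
    ∀ v ∈ V, ∃ S ⊆ V, IsPreconnected S ∧ v ∈ S ∧ ¬ Bornology.IsBounded S

/-- A finitely supported function on the unit grid cells which takes equal values on the two
sides of every edge met by `V` vanishes on the cells met by `V`. -/
lemma grid_function_eq_zero {V : Set (ℝ × ℝ)}
    (hV : ∀ v ∈ V, ∃ S ⊆ V, IsPreconnected S ∧ v ∈ S ∧ ¬ Bornology.IsBounded S)
    {f : ℤ × ℤ → ℚ} (hf : (Function.support f).Finite)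
    (hx : ∀ (a b : ℤ) (α : ℝ), (a : ℝ) - 1 ≤ α → α ≤ a → (α, (b : ℝ)) ∈ V →
      f (a, b + 1) = f (a, b))
    (hy : ∀ (a b : ℤ) (β : ℝ), (b : ℝ) - 1 ≤ β → β ≤ b → ((a : ℝ), β) ∈ V →
      f (a + 1, b) = f (a, b))
    {a b : ℤ} {α β : ℝ} (hα : (a : ℝ) - 1 ≤ α) (hα' : α ≤ a) (hβ : (b : ℝ) - 1 ≤ β)
    (hβ' : β ≤ b) (hαβ : (α, β) ∈ V) : f (a, b) = 0 := by
  have key : ∀ (α β : ℝ) (a b : ℤ), (α, β) ∈ V → (a : ℝ) - 1 ≤ α → α ≤ a → (b : ℝ) - 1 ≤ β →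
      β ≤ b → f (a, b) = f (⌈α⌉, ⌈β⌉) := by
    intro α β a b hv h1 h2 h3 h4
    have ceil_or : ∀ (x : ℝ) (n : ℤ), (n : ℝ) - 1 ≤ x → x ≤ n →
        n = ⌈x⌉ ∨ (x = (⌈x⌉ : ℝ) ∧ n = ⌈x⌉ + 1) := by
      intro x n h1 h2
      rcases h1.eq_or_lt with h | h
      · right
        have : x = ((n - 1 : ℤ) : ℝ) := by push_cast; linarith
        rw [this, Int.ceil_intCast]
        exact ⟨rfl, by ring⟩
      · left
        exact (Int.ceil_eq_iff.2 ⟨h, h2⟩).symm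
    have hc1 := Int.ceil_lt_add_one α
    have hc2 := Int.ceil_lt_add_one β
    have hl1 := Int.le_ceil α
    have hl2 := Int.le_ceil β
    rcases ceil_or α a h1 h2 with ha | ⟨ha, ha'⟩ <;> rcases ceil_or β b h3 h4 with hb | ⟨hb, hb'⟩
    · rw [ha, hb]
    · rw [ha, hb']
      exact hx _ _ α (by linarith) hl1 (by rwa [← hb])
    · rw [ha', hb]
      exact hy _ _ β (by linarith) hl2 (by rwa [← ha])
    · rw [ha', hb']
      rw [hx _ _ α (by push_cast; linarith) (by push_cast; linarith) (by rwa [← hb])]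
      exact hy _ _ β (by linarith) hl2 (by rwa [← ha])
  obtain ⟨S, hSV, hS, hvS, hSb⟩ := hV _ hαβ
  obtain ⟨y, hyS, hy0⟩ : ∃ y ∈ S, f (⌈y.1⌉, ⌈y.2⌉) = 0 := by
    by_contra! hcon
    apply hSb
    have hb : Bornology.IsBounded (⋃ p ∈ Function.support f,
        Set.Icc ((p.1 : ℝ) - 1) p.1 ×ˢ Set.Icc ((p.2 : ℝ) - 1) p.2) :=
      (Bornology.isBounded_biUnion hf).2 fun p _ => (isBounded_Icc _ _).prod (isBounded_Icc _ _)
    refine hb.subset fun y hy => ?_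
    simp only [Set.mem_iUnion]
    refine ⟨(⌈y.1⌉, ⌈y.2⌉), hcon y hy, ?_⟩
    have hc1 := Int.ceil_lt_add_one y.1
    have hc2 := Int.ceil_lt_add_one y.2
    exact ⟨⟨by simp only; linarith, Int.le_ceil _⟩, ⟨by simp only; linarith, Int.le_ceil _⟩⟩
  rw [key α β a b hαβ hα hα' hβ hβ', ← hy0]
  let _ : TopologicalSpace ℚ := ⊥
  have _ : DiscreteTopology ℚ := ⟨rfl⟩
  refine hS.constant (f := fun y : ℝ × ℝ => f (⌈y.1⌉, ⌈y.2⌉)) ?_ hvS hyS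
  intro z hz
  refine tendsto_nhds_of_eventually_eq ?_
  apply eventually_nhdsWithin_of_eventually_nhds
  have ev : ∀ x : ℝ, ∀ᶠ x' in nhds x, (⌈x'⌉ : ℝ) - 1 ≤ x ∧ x ≤ ⌈x'⌉ := by
    intro x
    have h1 : x < ⌊x⌋ + 1 := Int.lt_floor_add_one x
    have h2 : (⌈x⌉ : ℝ) - 1 < x := by linarith [Int.ceil_lt_add_one x]
    filter_upwards [Ioo_mem_nhds h2 h1] with x' hx'
    have e1 : ⌈x'⌉ ≤ ⌊x⌋ + 1 := Int.ceil_le.2 (by push_cast; exact hx'.2.le)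
    have e2 : ⌈x⌉ ≤ ⌈x'⌉ := by
      have : ⌈x⌉ - 1 < ⌈x'⌉ := Int.lt_ceil.2 (by push_cast; exact hx'.1)
      omega
    have e1' : (⌈x'⌉ : ℝ) ≤ ⌊x⌋ + 1 := by exact_mod_cast e1
    have e2' : (⌈x⌉ : ℝ) ≤ ⌈x'⌉ := by exact_mod_cast e2
    exact ⟨by linarith [Int.floor_le x], (Int.le_ceil x).trans e2'⟩
  filter_upwards [(continuous_fst.tendsto z).eventually (ev z.1),
    (continuous_snd.tendsto z).eventually (ev z.2)] with y h1 h2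
  exact key z.1 z.2 _ _ (hSV hz) h1.1 h1.2 h2.1 h2.2

lemma finite_grid_of_isBounded {W : Set (ℝ × ℝ)} (hW : Bornology.IsBounded W) :
    {p : ℤ × ℤ | ((p.1 : ℝ), (p.2 : ℝ)) ∈ W}.Finite := by
  obtain ⟨M, hM⟩ := hW.exists_norm_le
  refine ((Set.finite_Icc (-⌈M⌉) ⌈M⌉).prod (Set.finite_Icc (-⌈M⌉) ⌈M⌉)).subset ?_
  rintro ⟨a, b⟩ hab
  have h := hM _ hab
  have h1 : |(a : ℝ)| ≤ ⌈M⌉ := ((norm_fst_le _).trans h).trans (Int.le_ceil M)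
  have h2 : |(b : ℝ)| ≤ ⌈M⌉ := ((norm_snd_le _).trans h).trans (Int.le_ceil M)
  rw [abs_le] at h1 h2
  refine ⟨⟨?_, ?_⟩, ⟨?_, ?_⟩⟩ <;> simp only <;> first
    | exact_mod_cast h1.1
    | exact_mod_cast h1.2
    | exact_mod_cast h2.1
    | exact_mod_cast h2.2

/-- The cells of the unit grid contained in the complement of an exterior region form a complex
of Euler characteristic at least one. -/
lemma grid_count {V : Set (ℝ × ℝ)} (hVb : Bornology.IsBounded Vᶜ)
    (hV : ∀ v ∈ V, ∃ S ⊆ V, IsPreconnected S ∧ v ∈ S ∧ ¬ Bornology.IsBounded S)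
    (hne : ∃ p : ℤ × ℤ, ((p.1 : ℝ), (p.2 : ℝ)) ∉ V) :
    {p : ℤ × ℤ | ∀ s ∈ Set.Icc (0 : ℝ) 1, (p.1 - s, (p.2 : ℝ)) ∉ V}.encard +
      {p : ℤ × ℤ | ∀ t ∈ Set.Icc (0 : ℝ) 1, ((p.1 : ℝ), p.2 - t) ∉ V}.encard + 1 ≤
    {p : ℤ × ℤ | ((p.1 : ℝ), (p.2 : ℝ)) ∉ V}.encard +
      {p : ℤ × ℤ | ∀ s ∈ Set.Icc (0 : ℝ) 1, ∀ t ∈ Set.Icc (0 : ℝ) 1,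
        (p.1 - s, p.2 - t) ∉ V}.encard := by
  set A₀ := {p : ℤ × ℤ | ((p.1 : ℝ), (p.2 : ℝ)) ∉ V} with hA₀
  set A₁ := {p : ℤ × ℤ | ∀ s ∈ Set.Icc (0 : ℝ) 1, (p.1 - s, (p.2 : ℝ)) ∉ V} with hA₁
  set B₁ := {p : ℤ × ℤ | ∀ t ∈ Set.Icc (0 : ℝ) 1, ((p.1 : ℝ), p.2 - t) ∉ V} with hB₁
  set A₂ := {p : ℤ × ℤ | ∀ s ∈ Set.Icc (0 : ℝ) 1, ∀ t ∈ Set.Icc (0 : ℝ) 1,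
        (p.1 - s, p.2 - t) ∉ V} with hA₂
  have z0 : (0 : ℝ) ∈ Set.Icc (0 : ℝ) 1 := by simp
  have z1 : (1 : ℝ) ∈ Set.Icc (0 : ℝ) 1 := by simp
  have f0 : A₀.Finite := finite_grid_of_isBounded hVb
  have f1 : A₁.Finite := f0.subset fun p hp => by have := hp 0 z0; simpa [hA₀] using this
  have g1 : B₁.Finite := f0.subset fun p hp => by have := hp 0 z0; simpa [hA₀] using this
  have f2 : A₂.Finite := f0.subset fun p hp => by have := hp 0 z0 0 z0; simpa [hA₀] using this
  rw [f0.encard_eq_coe_toFinset_card, f1.encard_eq_coe_toFinset_card,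
    g1.encard_eq_coe_toFinset_card, f2.encard_eq_coe_toFinset_card]
  have := grid_euler (X₀ := f0.toFinset) (X₁ := f1.toFinset) (Y₁ := g1.toFinset)
    (X₂ := f2.toFinset) ?_ ?_ ?_
  · exact_mod_cast this
  · obtain ⟨p, hp⟩ := hne
    exact ⟨p, f0.mem_toFinset.2 hp⟩
  · intro p hp
    simp only [Set.Finite.mem_toFinset, hA₀, Set.mem_ofPred_eq, not_not] at hp
    simp only [Set.Finite.mem_toFinset, hA₁, hB₁, Set.mem_ofPred_eq]
    refine ⟨fun h => h 0 z0 (by simpa using hp), fun h => h 1 z1 (by simpa using hp),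
      fun h => h 0 z0 (by simpa using hp), fun h => h 1 z1 (by simpa using hp)⟩
  · intro f hf h1 h2 h3
    simp only [Set.Finite.mem_toFinset] at h1 h2 h3
    ext ⟨a, b⟩
    by_cases hp : (a, b) ∈ A₂
    · exact h3 _ hp
    · simp only [hA₂, Set.mem_ofPred_eq, not_forall, not_not] at hp
      obtain ⟨s, hs, t, ht, hst⟩ := hp
      refine grid_function_eq_zero hV hf ?_ ?_ (a := a) (b := b) (by linarith [hs.2])
        (by linarith [hs.1]) (by linarith [ht.2]) (by linarith [ht.1]) hst
      · intro a b α h h' hv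
        refine h1 (a, b) fun hA => hA (a - α) ⟨by linarith, by linarith⟩ ?_
        simpa using hv
      · intro a b β h h' hv
        refine h2 (a, b) fun hA => hA (b - β) ⟨by linarith, by linarith⟩ ?_
        simpa using hv

/-- The segment from `0` to `e`. -/
def seg (e : Eu 2) : Set (Eu 2) := (fun s : ℝ => s • e) '' Set.Icc (0 : ℝ) 1

lemma notMem_add_seg {V : Set (Eu 2)} {e y : Eu 2} :
    y ∈ (V + seg e)ᶜ ↔ ∀ s ∈ Set.Icc (0 : ℝ) 1, y - s • e ∉ V := by
  constructor
  · intro h s hs hv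
    exact h ⟨_, hv, _, ⟨s, hs, rfl⟩, by simp⟩
  · rintro h ⟨v, hv, _, ⟨s, hs, rfl⟩, rfl⟩
    exact h s hs (by simpa using hv)

/-- The number of points of a set in a translate of the integer lattice. -/
def latticeCount (S : Set (Eu 2)) (x : Eu 2) : ENNReal :=
  ({p : ℤ × ℤ | x + !₂[(p.1 : ℝ), (p.2 : ℝ)] ∈ S}.encard : ENNReal)

lemma latticeCount_eq_tsum (S : Set (Eu 2)) (x : Eu 2) :
    latticeCount S x = ∑' p : ℤ × ℤ, S.indicator (fun _ => 1) (x + !₂[(p.1 : ℝ), (p.2 : ℝ)]) := by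
  rw [latticeCount, ← ENNReal.tsum_set_one, tsum_subtype (f := fun _ => (1 : ENNReal))]
  rfl

lemma measurable_latticeCount {S : Set (Eu 2)} (hS : MeasurableSet S) :
    Measurable (latticeCount S) := by
  rw [funext (latticeCount_eq_tsum S)]
  exact Measurable.tsum fun p => (measurable_const.indicator hS).comp
      (measurable_add_const _)

lemma volume_eq_tsum_lattice {S : Set (Eu 2)} (hS : MeasurableSet S) :
    volume S = ∫⁻ x in {x : Eu 2 | x 0 ∈ Set.Ico (0 : ℝ) 1 ∧ x 1 ∈ Set.Ico (0 : ℝ) 1},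
      latticeCount S x := by
  set I := {x : Eu 2 | x 0 ∈ Set.Ico (0 : ℝ) 1 ∧ x 1 ∈ Set.Ico (0 : ℝ) 1} with hI
  have hIm : MeasurableSet I := by
    apply MeasurableSet.inter
    · exact measurableSet_Ico.preimage (by fun_prop)
    · exact measurableSet_Ico.preimage (by fun_prop)
  simp_rw [latticeCount_eq_tsum]
  rw [lintegral_tsum]
  swap
  · exact fun p => ((measurable_const.indicator hS).comp (measurable_add_const _)).aemeasurable
  have h2 : S = ⋃ p : ℤ × ℤ, (S ∩ (fun x => x + -!₂[(p.1 : ℝ), (p.2 : ℝ)]) ⁻¹' I) := by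
    ext x
    simp only [Set.mem_iUnion, Set.mem_inter_iff]
    refine ⟨fun h => ⟨(⌊x 0⌋, ⌊x 1⌋), h, ?_⟩, fun ⟨_, h, _⟩ => h⟩
    simp [hI, Int.floor_le, Int.lt_floor_add_one, sub_lt_iff_lt_add', ← sub_eq_add_neg]
  conv_lhs => rw [h2]
  rw [measure_iUnion]
  · refine tsum_congr fun p => ?_
    rw [← lintegral_indicator hIm]
    rw [← lintegral_add_right_eq_self _ (-!₂[(p.1 : ℝ), (p.2 : ℝ)])]
    rw [← lintegral_indicator_one (hS.inter (hIm.preimage (measurable_add_const _)))]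
    refine lintegral_congr fun x => ?_
    by_cases hx : x ∈ S <;> by_cases hy : x + -!₂[(p.1 : ℝ), (p.2 : ℝ)] ∈ I <;>
      simp only [Set.indicator, Set.mem_inter_iff, Set.mem_preimage, Pi.one_apply, hx, hy,
        if_true, if_false, true_and, and_true, neg_add_cancel_right, false_and]
  · rintro ⟨a, b⟩ ⟨c, d⟩ hne
    refine Set.disjoint_left.2 fun x hx hy => hne ?_
    have hx := hx.2
    have hy := hy.2
    simp [hI, ← sub_eq_add_neg, sub_lt_iff_lt_add] at hx hy
    obtain ⟨⟨a1, a2⟩, a3, a4⟩ := hx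
    obtain ⟨⟨b1, b2⟩, b3, b4⟩ := hy
    have q1 : (a : ℝ) < c + 1 := by linarith
    have q2 : (c : ℝ) < a + 1 := by linarith
    have q3 : (b : ℝ) < d + 1 := by linarith
    have q4 : (d : ℝ) < b + 1 := by linarith
    norm_cast at q1 q2 q3 q4
    ext <;> simp only <;> omega
  · intro p
    exact hS.inter (hIm.preimage (measurable_add_const _))

lemma volume_unit_cell :
    volume {x : Eu 2 | x 0 ∈ Set.Ico (0 : ℝ) 1 ∧ x 1 ∈ Set.Ico (0 : ℝ) 1} = 1 := by
  have h := (PiLp.volume_preserving_ofLp (Fin 2)).measure_preimage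
    (s := Set.univ.pi fun _ => Set.Ico (0 : ℝ) 1)
    (MeasurableSet.univ_pi fun _ => measurableSet_Ico).nullMeasurableSet
  rw [Real.volume_pi_Ico] at h
  simp only [sub_zero, ENNReal.ofReal_one, Finset.prod_const_one] at h
  rw [← h]
  congr 1
  ext x
  simp [Fin.forall_fin_two]

namespace IsExteriorRegion

lemma preimage_homeomorph {V : Set (Eu 2)} (hV : IsExteriorRegion V) (T : Eu 2 ≃L[ℝ] Eu 2) :
    IsExteriorRegion (T ⁻¹' V) := by
  obtain ⟨h1, h2, h3⟩ := hV
  refine ⟨h1.preimage T.continuous, ?_, fun v hv => ?_⟩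
  · have : (T ⁻¹' V)ᶜ = T.symm '' Vᶜ := by
      rw [ContinuousLinearEquiv.image_symm_eq_preimage]; rfl
    rw [this]
    exact h2.image T.symm.toContinuousLinearMap
  · obtain ⟨S, hS, hc, hvS, hb⟩ := h3 _ hv
    refine ⟨T ⁻¹' S, Set.preimage_mono hS, ?_, hvS, fun hb' => hb ?_⟩
    · rw [← ContinuousLinearEquiv.image_symm_eq_preimage]
      exact hc.image _ T.symm.continuous.continuousOn
    · have := hb'.image T.toContinuousLinearMap
      rwa [show T.toContinuousLinearMap '' (T ⁻¹' S) = S from T.toEquiv.image_preimage S] at this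

lemma add_left {V : Set (Eu 2)} (hV : IsExteriorRegion V) {Z : Set (Eu 2)} (hZ : Z.Nonempty) :
    IsExteriorRegion (V + Z) := by
  obtain ⟨h1, h2, h3⟩ := hV
  refine ⟨h1.add_right, ?_, ?_⟩
  · obtain ⟨z, hz⟩ := hZ
    have : (V + Z)ᶜ ⊆ (fun x => x + z) '' Vᶜ := by
      intro y hy
      refine ⟨y - z, fun hv => hy ⟨_, hv, z, hz, by simp⟩, by simp⟩
    exact (h2.add (Bornology.isBounded_singleton (x := z))).subset
      (this.trans (by rw [Set.add_singleton]))
  · rintro _ ⟨v, hv, z, hz, rfl⟩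
    obtain ⟨S, hS, hc, hvS, hb⟩ := h3 _ hv
    refine ⟨S + {z}, Set.add_subset_add hS (by simpa using hz), ?_, ⟨v, hvS, z, rfl, rfl⟩,
      fun hb' => hb ?_⟩
    · rw [Set.add_singleton]
      exact hc.image _ (by fun_prop)
    · have := hb'.add (Bornology.isBounded_singleton (x := -z))
      rwa [add_assoc, Set.singleton_add_singleton, add_neg_cancel, Set.add_singleton,
        show (fun x : Eu 2 => x + 0) = id by ext1; simp, Set.image_id] at this

end IsExteriorRegion

lemma lattice_inequality {V : Set (Eu 2)} (hV : IsExteriorRegion V)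
    (hne : (V + seg !₂[(1 : ℝ), 0] + seg !₂[(0 : ℝ), 1])ᶜ.Nonempty) :
    volume (V + seg !₂[(1 : ℝ), 0])ᶜ + volume (V + seg !₂[(0 : ℝ), 1])ᶜ + 1 ≤
      volume Vᶜ + volume (V + seg !₂[(1 : ℝ), 0] + seg !₂[(0 : ℝ), 1])ᶜ := by
  have m0 : MeasurableSet Vᶜ := hV.1.measurableSet.compl
  have m1 : MeasurableSet (V + seg !₂[(1 : ℝ), 0])ᶜ := hV.1.add_right.measurableSet.compl
  have m2 : MeasurableSet (V + seg !₂[(0 : ℝ), 1])ᶜ := hV.1.add_right.measurableSet.compl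
  have m3 : MeasurableSet (V + seg !₂[(1 : ℝ), 0] + seg !₂[(0 : ℝ), 1])ᶜ :=
    hV.1.add_right.add_right.measurableSet.compl
  rw [volume_eq_tsum_lattice m0, volume_eq_tsum_lattice m1, volume_eq_tsum_lattice m2,
    volume_eq_tsum_lattice m3]
  conv_lhs => rw [← volume_unit_cell]
  rw [← setLIntegral_one, ← lintegral_add_left (measurable_latticeCount m1),
    ← lintegral_add_left, ← lintegral_add_left (measurable_latticeCount m0)]
  swap
  · exact (measurable_latticeCount m1).add (measurable_latticeCount m2)
  refine lintegral_mono fun x => ?_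
  have h0 : ∀ q : ℝ × ℝ, ‖(!₂[q.1, q.2] : Eu 2)‖ ≤ ‖q‖ + ‖q‖ := fun q => by
    have : (!₂[q.1, q.2] : Eu 2) = q.1 • EuclideanSpace.single 0 1 +
        q.2 • EuclideanSpace.single 1 1 := by ext i; fin_cases i <;> simp
    rw [this]
    refine (norm_add_le _ _).trans (add_le_add ?_ ?_)
    · simpa [norm_smul] using norm_fst_le q
    · simpa [norm_smul] using norm_snd_le q
  have cont : Continuous fun v : Eu 2 => ((v 0 - x 0, v 1 - x 1) : ℝ × ℝ) := by fun_prop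
  have inv : ∀ v : Eu 2, x + !₂[v 0 - x 0, v 1 - x 1] = v := fun v => by
    ext i; fin_cases i <;> simp
  have := grid_count (V := {q : ℝ × ℝ | x + !₂[q.1, q.2] ∈ V}) ?_ ?_ ?_
  · have e0 : ∀ p : ℤ × ℤ, ∀ s t : ℝ, x + !₂[(p.1 : ℝ) - s, (p.2 : ℝ) - t] =
        x + !₂[(p.1 : ℝ), (p.2 : ℝ)] - t • !₂[(0 : ℝ), 1] - s • !₂[(1 : ℝ), 0] := by
      intro p s t
      ext i; fin_cases i <;> simp <;> ring
    have e1 : ∀ p : ℤ × ℤ, ∀ s : ℝ, x + !₂[(p.1 : ℝ) - s, (p.2 : ℝ)] =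
        x + !₂[(p.1 : ℝ), (p.2 : ℝ)] - s • !₂[(1 : ℝ), 0] := by
      intro p s
      simpa using e0 p s 0
    have e2 : ∀ p : ℤ × ℤ, ∀ t : ℝ, x + !₂[(p.1 : ℝ), (p.2 : ℝ) - t] =
        x + !₂[(p.1 : ℝ), (p.2 : ℝ)] - t • !₂[(0 : ℝ), 1] := by
      intro p t
      simpa using e0 p 0 t
    simp only [latticeCount]
    have key := ENat.toENNReal_le.2 this
    simp only [ENat.toENNReal_add, ENat.toENNReal_one] at key
    convert key using 6 with p p p
    · simp only [notMem_add_seg, ← e1, Set.mem_ofPred_eq]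
    · simp only [notMem_add_seg, ← e2, Set.mem_ofPred_eq]
    · exact Iff.rfl
    · rw [notMem_add_seg]
      constructor
      · intro h s hs t ht
        have := notMem_add_seg.1 (h t ht) s hs
        rwa [Set.mem_ofPred_eq, e0]
      · intro h t ht
        refine notMem_add_seg.2 fun s hs => ?_
        rw [← e0]
        exact h s hs t ht
  · have hb := (hV.2.1.add (Bornology.isBounded_singleton (x := -x)))
    obtain ⟨M, hM⟩ := hV.2.1.exists_norm_le
    refine isBounded_iff_forall_norm_le.2 ⟨M + ‖x‖, fun q hq => ?_⟩
    have h1 := hM _ hq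
    have h2 : ∀ i, |(!₂[q.1, q.2] : Eu 2) i| ≤ M + ‖x‖ := fun i => by
      have := (PiLp.norm_apply_le (!₂[q.1, q.2] : Eu 2) i)
      have h3 : ‖(!₂[q.1, q.2] : Eu 2)‖ ≤ ‖x + !₂[q.1, q.2]‖ + ‖x‖ := by
        simpa using norm_sub_le (x + !₂[q.1, q.2]) x
      rw [Real.norm_eq_abs] at this
      linarith
    exact max_le (h2 0) (h2 1)
  · intro q hq
    obtain ⟨S, hS, hc, hvS, hb⟩ := hV.2.2 _ hq
    refine ⟨(fun v : Eu 2 => ((v 0 - x 0, v 1 - x 1) : ℝ × ℝ)) '' S, ?_,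
      hc.image _ cont.continuousOn, ⟨_, hvS, by simp⟩, fun hb' => hb ?_⟩
    · rintro _ ⟨v, hv, rfl⟩
      simp only [Set.mem_ofPred_eq, inv]
      exact hS hv
    · obtain ⟨M, hM⟩ := hb'.exists_norm_le
      refine isBounded_iff_forall_norm_le.2 ⟨‖x‖ + (M + M), fun v hv => ?_⟩
      have h1 := hM _ ⟨v, hv, rfl⟩
      have h2 := h0 (v 0 - x 0, v 1 - x 1)
      rw [← inv v]
      refine (norm_add_le _ _).trans ?_
      simp only at h2 h1
      linarith
  · obtain ⟨y, hy⟩ := hne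
    have hy' : ∀ t ∈ Set.Icc (0 : ℝ) 1, ∀ s ∈ Set.Icc (0 : ℝ) 1,
        y - t • !₂[(0 : ℝ), 1] - s • !₂[(1 : ℝ), 0] ∉ V := fun t ht s hs =>
      notMem_add_seg.1 (notMem_add_seg.1 hy t ht) s hs
    refine ⟨(⌊y 0 - x 0⌋, ⌊y 1 - x 1⌋), ?_⟩
    have := hy' (Int.fract (y 1 - x 1)) ⟨Int.fract_nonneg _, (Int.fract_lt_one _).le⟩
      (Int.fract (y 0 - x 0)) ⟨Int.fract_nonneg _, (Int.fract_lt_one _).le⟩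
    convert this using 1
    refine iff_of_eq (congrArg (· ∈ V) ?_)
    simp only [show ∀ r : ℝ, Int.fract r = r - ⌊r⌋ from fun _ => rfl]
    ext i
    fin_cases i <;> simp [-Int.self_sub_floor] <;> ring

/-- The determinant of two plane vectors. -/
def cross (e f : Eu 2) : ℝ := e 0 * f 1 - e 1 * f 0

/-- The segment from `-u` to `u`. -/
def cseg (u : Eu 2) : Set (Eu 2) := (fun s : ℝ => s • u) '' Set.Icc (-1 : ℝ) 1

lemma zero_mem_cseg (u : Eu 2) : (0 : Eu 2) ∈ cseg u := ⟨0, by norm_num, by simp⟩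

lemma cseg_eq (u : Eu 2) : cseg u = seg ((2 : ℝ) • u) + {-u} := by
  rw [Set.add_singleton]
  ext x
  constructor
  · rintro ⟨s, hs, rfl⟩
    refine ⟨_, ⟨(s + 1) / 2, ⟨by linarith [hs.1], by linarith [hs.2]⟩, rfl⟩, ?_⟩
    module
  · rintro ⟨_, ⟨s, hs, rfl⟩, rfl⟩
    refine ⟨2 * s - 1, ⟨by linarith [hs.1], by linarith [hs.2]⟩, ?_⟩
    module

lemma volume_compl_add_singleton (A : Set (Eu 2)) (c : Eu 2) :
    volume.real (A + {c})ᶜ = volume.real Aᶜ := by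
  have : (A + {c})ᶜ = (fun x => x + -c) ⁻¹' Aᶜ := by
    ext x
    rw [Set.add_singleton, Set.image_add_right]
    rfl
  rw [measureReal_def, this, measure_preimage_add_right, measureReal_def]

lemma IsExteriorRegion.volume_compl_ne_top {V : Set (Eu 2)} (hV : IsExteriorRegion V) :
    volume Vᶜ ≠ ⊤ := hV.2.1.measure_lt_top.ne

lemma seg_nonempty (e : Eu 2) : (seg e).Nonempty := ⟨_, 0, by simp, rfl⟩

lemma parallelogram_inequality_seg {V : Set (Eu 2)} (hV : IsExteriorRegion V) {e f : Eu 2}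
    (hef : cross e f ≠ 0) (hne : (V + seg e + seg f)ᶜ.Nonempty) :
    volume.real (V + seg e)ᶜ + volume.real (V + seg f)ᶜ + |cross e f| ≤
      volume.real Vᶜ + volume.real (V + seg e + seg f)ᶜ := by
  set T₀ : Eu 2 →ₗ[ℝ] Eu 2 := Matrix.toEuclideanLin !![e 0, f 0; e 1, f 1] with hT₀
  have hdet : LinearMap.det T₀ = cross e f := by
    rw [hT₀, Matrix.toEuclideanLin_eq_toLin_orthonormal, LinearMap.det_toLin,
      Matrix.det_fin_two_of, cross]
    ring
  have hd0 : LinearMap.det T₀ ≠ 0 := by rwa [hdet]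
  set T : Eu 2 ≃L[ℝ] Eu 2 := (T₀.equivOfDetNeZero hd0).toContinuousLinearEquiv
  have hT : ∀ x, T x = T₀ x := fun _ => rfl
  have T1 : T !₂[(1 : ℝ), 0] = e := by
    rw [hT]; ext i; fin_cases i <;> simp [hT₀]
  have T2 : T !₂[(0 : ℝ), 1] = f := by
    rw [hT]; ext i; fin_cases i <;> simp [hT₀]
  have pre : ∀ (A : Set (Eu 2)) (v : Eu 2), T ⁻¹' (A + seg (T v))ᶜ = (T ⁻¹' A + seg v)ᶜ := by
    intro A v
    ext y
    rw [Set.mem_preimage, notMem_add_seg, notMem_add_seg]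
    simp [map_sub, map_smul]
  have vol : ∀ A : Set (Eu 2), volume (T ⁻¹' A) = ENNReal.ofReal |(cross e f)⁻¹| * volume A := by
    intro A
    rw [← hdet]
    exact Measure.addHaar_preimage_linearMap volume hd0 A
  have key := lattice_inequality (hV.preimage_homeomorph T) ?_
  · have p1 := pre V !₂[(1 : ℝ), 0]
    have p2 := pre V !₂[(0 : ℝ), 1]
    have p3 := pre (V + seg e) !₂[(0 : ℝ), 1]
    have p4 : T ⁻¹' (V + seg e) = T ⁻¹' V + seg !₂[(1 : ℝ), 0] := by
      rw [T1] at p1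
      rw [← compl_inj_iff, ← p1]; rfl
    rw [T1] at p1
    rw [T2] at p2 p3
    rw [p4] at p3
    rw [← p1, ← p2, ← p3, ← Set.preimage_compl, vol, vol, vol, vol] at key
    have f1 := (hV.add_left (seg_nonempty e)).volume_compl_ne_top
    have f2 := (hV.add_left (seg_nonempty f)).volume_compl_ne_top
    have f3 := ((hV.add_left (seg_nonempty e)).add_left (seg_nonempty f)).volume_compl_ne_top
    have f0 := hV.volume_compl_ne_top
    have key' := ENNReal.toReal_mono (by finiteness) key
    rw [ENNReal.toReal_add (by finiteness) (by finiteness),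
      ENNReal.toReal_add (by finiteness) (by finiteness),
      ENNReal.toReal_add (by finiteness) (by finiteness)] at key'
    simp only [ENNReal.toReal_mul, ENNReal.toReal_one, abs_inv,
      ENNReal.toReal_ofReal (inv_nonneg.2 (abs_nonneg (cross e f)))] at key'
    have hpos : 0 < |cross e f| := abs_pos.2 hef
    simp only [measureReal_def]
    have := mul_le_mul_of_nonneg_left key' hpos.le
    field_simp at this
    linarith
  · obtain ⟨y, hy⟩ := hne
    refine ⟨T.symm y, ?_⟩
    rw [notMem_add_seg] at hy ⊢
    intro t ht
    have := hy t ht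
    rw [← T2, ← T1] at this
    have h2 := (notMem_add_seg (V := V)).1 this
    refine notMem_add_seg.2 fun s hs => ?_
    simpa [map_sub, map_smul] using h2 s hs

lemma cseg_nonempty (e : Eu 2) : (cseg e).Nonempty := ⟨0, zero_mem_cseg e⟩

lemma parallelogram_inequality {V : Set (Eu 2)} (hV : IsExteriorRegion V) {u w : Eu 2}
    (huw : cross u w ≠ 0) (hne : (V + cseg u + cseg w)ᶜ.Nonempty) :
    volume.real (V + cseg u)ᶜ + volume.real (V + cseg w)ᶜ + 4 * |cross u w| ≤
      volume.real Vᶜ + volume.real (V + cseg u + cseg w)ᶜ := by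
  have h4 : cross ((2 : ℝ) • u) ((2 : ℝ) • w) = 4 * cross u w := by simp [cross]; ring
  have e1 : V + cseg u + {-w} = V + {-u - w} + seg ((2 : ℝ) • u) := by
    rw [cseg_eq, sub_eq_add_neg, ← Set.singleton_add_singleton]; abel
  have e2 : V + cseg w + {-u} = V + {-u - w} + seg ((2 : ℝ) • w) := by
    rw [cseg_eq, sub_eq_add_neg, ← Set.singleton_add_singleton]; abel
  have e3 : V + cseg u + cseg w = V + {-u - w} + seg ((2 : ℝ) • u) + seg ((2 : ℝ) • w) := by
    rw [cseg_eq, cseg_eq, sub_eq_add_neg, ← Set.singleton_add_singleton]; abel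
  rw [← volume_compl_add_singleton (V + cseg u) (-w), e1,
    ← volume_compl_add_singleton (V + cseg w) (-u), e2, e3,
    ← volume_compl_add_singleton V (-u - w)]
  rw [e3] at hne
  have key := parallelogram_inequality_seg (hV.add_left (Set.singleton_nonempty (-u - w)))
    (by rw [h4]; simpa using huw) hne
  rwa [h4, abs_mul, abs_of_pos (by norm_num : (0 : ℝ) < 4)] at key

/-- A zonotope with generators `u i`, `i ∈ s`. -/
def zonotope {ι : Type*} (s : Finset ι) (u : ι → Eu 2) : Set (Eu 2) := ∑ i ∈ s, cseg (u i)

lemma zero_mem_zonotope {ι : Type*} (s : Finset ι) (u : ι → Eu 2) : (0 : Eu 2) ∈ zonotope s u := by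
  classical
  induction s using Finset.induction_on with
  | empty => simp [zonotope]
  | insert a s ha ih =>
    rw [zonotope, Finset.sum_insert ha]
    exact ⟨0, zero_mem_cseg _, 0, ih, by simp⟩

lemma subset_add_of_zero_mem {A Z : Set (Eu 2)} (hZ : (0 : Eu 2) ∈ Z) : A ⊆ A + Z :=
  fun x hx => ⟨x, hx, 0, hZ, by simp⟩

lemma zonotope_cseg_inequality {ι : Type*} {V : Set (Eu 2)} (hV : IsExteriorRegion V)
    (s : Finset ι) {u : ι → Eu 2} {w : Eu 2} (huw : ∀ i ∈ s, cross (u i) w ≠ 0)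
    (hne : (V + zonotope s u + cseg w)ᶜ.Nonempty) :
    volume.real (V + zonotope s u)ᶜ + volume.real (V + cseg w)ᶜ +
        ∑ i ∈ s, 4 * |cross (u i) w| ≤
      volume.real Vᶜ + volume.real (V + zonotope s u + cseg w)ᶜ := by
  classical
  induction s using Finset.induction_on generalizing V with
  | empty =>
    simp [zonotope]
  | insert a s ha ih =>
    have e1 : V + zonotope (insert a s) u = V + cseg (u a) + zonotope s u := by
      rw [zonotope, Finset.sum_insert ha, zonotope, add_assoc]
    rw [e1] at hne ⊢
    have h1 := ih (hV.add_left (cseg_nonempty (u a)))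
      (fun i hi => huw i (Finset.mem_insert_of_mem hi)) hne
    have h2 := parallelogram_inequality hV (huw a (Finset.mem_insert_self a s))
      (hne.mono (Set.compl_subset_compl.2 (Set.add_subset_add_right
        (subset_add_of_zero_mem (zero_mem_zonotope s u)))))
    rw [Finset.sum_insert ha]
    linarith

lemma zonotope_inequality {ι κ : Type*} {V : Set (Eu 2)} (hV : IsExteriorRegion V)
    (s : Finset ι) {u : ι → Eu 2} (t : Finset κ) {w : κ → Eu 2}
    (huw : ∀ i ∈ s, ∀ j ∈ t, cross (u i) (w j) ≠ 0)
    (hne : (V + zonotope s u + zonotope t w)ᶜ.Nonempty) :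
    volume.real (V + zonotope s u)ᶜ + volume.real (V + zonotope t w)ᶜ +
        ∑ j ∈ t, ∑ i ∈ s, 4 * |cross (u i) (w j)| ≤
      volume.real Vᶜ + volume.real (V + zonotope s u + zonotope t w)ᶜ := by
  classical
  induction t using Finset.induction_on generalizing V with
  | empty =>
    simp [zonotope, add_comm]
  | insert a t ha ih =>
    have e1 : ∀ A : Set (Eu 2), A + zonotope (insert a t) w = A + cseg (w a) + zonotope t w := by
      intro A
      rw [zonotope, Finset.sum_insert ha, zonotope, add_assoc]
    have e2 : V + zonotope s u + zonotope (insert a t) w =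
        V + cseg (w a) + zonotope s u + zonotope t w := by
      rw [e1]; abel
    rw [e2] at hne ⊢
    rw [e1]
    have h1 := ih (hV.add_left (cseg_nonempty (w a)))
      (fun i hi j hj => huw i hi j (Finset.mem_insert_of_mem hj)) hne
    have e3 : V + zonotope s u + cseg (w a) = V + cseg (w a) + zonotope s u := by abel
    have h2 := zonotope_cseg_inequality hV s (fun i hi => huw i hi a (Finset.mem_insert_self a t))
      (hne.mono (Set.compl_subset_compl.2 (by
        rw [e3]; exact subset_add_of_zero_mem (zero_mem_zonotope t w))))
    rw [e3] at h2
    rw [Finset.sum_insert ha]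
    linarith

/-- The unit vector with a given polar angle. -/
def dir (θ : ℝ) : Eu 2 := !₂[cos θ, sin θ]

lemma exists_eq_norm_smul_dir (c : Eu 2) : ∃ φ, c = ‖c‖ • dir φ := by
  set z : ℂ := ⟨c 0, c 1⟩ with hz
  have hn : ‖c‖ = ‖z‖ := by
    rw [EuclideanSpace.norm_eq, Complex.norm_eq_sqrt_sq_add_sq]
    simp [hz]
  refine ⟨z.arg, ?_⟩
  ext i
  fin_cases i
  · simp [dir, hn, Complex.norm_mul_cos_arg, hz]
  · simp [dir, hn, Complex.norm_mul_sin_arg, hz]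

lemma inner_dir (θ φ : ℝ) : ⟪dir θ, dir φ⟫ = cos (θ - φ) := by
  simp [dir, PiLp.inner_apply, Fin.sum_univ_two, cos_sub]
  ring

lemma cross_dir (θ φ : ℝ) : cross (dir θ) (dir φ) = sin (φ - θ) := by
  simp [dir, cross, sin_sub]
  ring

lemma integral_abs_cos_period (c : ℝ) : ∫ x in c..c + π, |cos x| = 2 := by
  have hp : Function.Periodic (fun x => |cos x|) π := fun x => by simp [cos_add_pi]
  rw [hp.intervalIntegral_add_eq c (-(π / 2)), show -(π / 2) + π = π / 2 by ring]
  rw [intervalIntegral.integral_congr (g := cos)]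
  · rw [integral_cos]; simp; norm_num
  · intro x hx
    rw [Set.uIcc_of_le (by linarith [pi_pos])] at hx
    exact abs_of_nonneg (cos_nonneg_of_mem_Icc hx)

lemma abs_riemann_sum_abs_cos_sub {N : ℕ} (hN : 0 < N) (c : ℝ) :
    |π / N * ∑ i ∈ Finset.range N, |cos (i * (π / N) + c)| - 2| ≤ π ^ 2 / N := by
  have hN' : (0 : ℝ) < N := by exact_mod_cast hN
  have hc : Continuous fun x => |cos x| := by fun_prop
  have h1 := intervalIntegral.sum_integral_adjacent_intervals (f := fun x => |cos x|)
    (μ := volume) (a := fun i : ℕ => i * (π / N) + c) (n := N)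
    fun k _ => hc.intervalIntegrable _ _
  have h2 : (∫ x in ((0 : ℕ) : ℝ) * (π / N) + c..(N : ℝ) * (π / N) + c, |cos x|) = 2 := by
    rw [← integral_abs_cos_period c]
    congr 1
    · simp
    · field_simp; ring
  rw [h2] at h1
  rw [← h1, Finset.mul_sum, ← Finset.sum_sub_distrib]
  refine (Finset.abs_sum_le_sum_abs _ _).trans ?_
  have h3 : ∀ i ∈ Finset.range N, |π / N * |cos (i * (π / N) + c)| -
      (∫ x in (i : ℝ) * (π / N) + c..((i + 1 : ℕ) : ℝ) * (π / N) + c, |cos x|)| ≤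
      π / N * (π / N) := by
    intro i _
    have hlen : ((i + 1 : ℕ) : ℝ) * (π / N) + c - ((i : ℝ) * (π / N) + c) = π / N := by
      push_cast; ring
    have hpos : 0 < π / N := by positivity
    have e : π / N * |cos (i * (π / N) + c)| =
        ∫ x in (i : ℝ) * (π / N) + c..((i + 1 : ℕ) : ℝ) * (π / N) + c,
          |cos (i * (π / N) + c)| := by
      rw [intervalIntegral.integral_const, hlen, smul_eq_mul]
    rw [e, ← intervalIntegral.integral_sub (by simp) (hc.intervalIntegrable _ _)]
    have := intervalIntegral.norm_integral_le_of_norm_le_const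
      (a := (i : ℝ) * (π / N) + c) (b := ((i + 1 : ℕ) : ℝ) * (π / N) + c)
      (f := fun x => |cos (i * (π / N) + c)| - |cos x|) (C := π / N) ?_
    · rw [hlen, abs_of_pos hpos] at this
      exact this
    · intro x hx
      rw [Set.uIoc_of_le (by linarith)] at hx
      rw [Real.norm_eq_abs]
      refine (abs_abs_sub_abs_le _ _).trans ?_
      have := Real.abs_cos_sub_cos_le (i * (π / N) + c) x
      refine this.trans ?_
      rw [abs_le]
      constructor <;> linarith [hx.1, hx.2]
  refine (Finset.sum_le_sum h3).trans ?_
  rw [Finset.sum_const, Finset.card_range, nsmul_eq_mul]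
  refine le_of_eq ?_
  field_simp

lemma inner_le_of_mem_zonotope {ι : Type*} (s : Finset ι) (u : ι → Eu 2) (c : Eu 2) {z : Eu 2}
    (hz : z ∈ zonotope s u) : ⟪c, z⟫ ≤ ∑ i ∈ s, |⟪c, u i⟫| := by
  classical
  induction s using Finset.induction_on generalizing z with
  | empty => simp_all [zonotope]
  | insert a s ha ih =>
    rw [zonotope, Finset.sum_insert ha] at hz
    obtain ⟨_, ⟨r, hr, rfl⟩, y, hy, rfl⟩ := hz
    rw [Finset.sum_insert ha]
    simp only [inner_add_right, inner_smul_right]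
    refine add_le_add ?_ (ih hy)
    calc r * ⟪c, u a⟫ ≤ |r| * |⟪c, u a⟫| := by rw [← abs_mul]; exact le_abs_self _
      _ ≤ 1 * |⟪c, u a⟫| := by gcongr; exact abs_le.2 hr
      _ = _ := one_mul _

lemma exists_mem_zonotope_inner_eq {ι : Type*} (s : Finset ι) (u : ι → Eu 2) (c : Eu 2) :
    ∃ z ∈ zonotope s u, ⟪c, z⟫ = ∑ i ∈ s, |⟪c, u i⟫| := by
  classical
  induction s using Finset.induction_on with
  | empty => exact ⟨0, by simp [zonotope], by simp⟩
  | insert a s ha ih =>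
    obtain ⟨y, hy, h⟩ := ih
    rw [Finset.sum_insert ha]
    have : ∃ r ∈ Set.Icc (-1 : ℝ) 1, r * ⟪c, u a⟫ = |⟪c, u a⟫| := by
      rcases abs_cases ⟪c, u a⟫ with h | h
      · exact ⟨1, by norm_num, by rw [h.1]; ring⟩
      · exact ⟨-1, by norm_num, by rw [h.1]; ring⟩
    obtain ⟨r, hr, h'⟩ := this
    refine ⟨r • u a + y, ?_, by rw [inner_add_right, inner_smul_right, h, h']⟩
    rw [zonotope, Finset.sum_insert ha]
    exact ⟨_, ⟨r, hr, rfl⟩, y, hy, rfl⟩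

lemma isCompact_zonotope {ι : Type*} (s : Finset ι) (u : ι → Eu 2) : IsCompact (zonotope s u) := by
  classical
  induction s using Finset.induction_on with
  | empty => simp [zonotope]
  | insert a s ha ih =>
    rw [zonotope, Finset.sum_insert ha]
    exact IsCompact.add (isCompact_Icc.image (continuous_id.smul continuous_const)) ih

lemma convex_zonotope {ι : Type*} (s : Finset ι) (u : ι → Eu 2) : Convex ℝ (zonotope s u) := by
  classical
  induction s using Finset.induction_on with
  | empty => exact convex_singleton (𝕜 := ℝ) (0 : Eu 2)
  | insert a s ha ih =>
    rw [zonotope, Finset.sum_insert ha]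
    exact Convex.add ((convex_Icc _ _).is_linear_image 
      ⟨fun x y => add_smul x y _, fun x y => smul_assoc x y _⟩) ih

lemma zonotope_subset_closedBall {ι : Type*} {s : Finset ι} {u : ι → Eu 2} {r : ℝ}
    (h : ∀ φ, ∑ i ∈ s, |⟪dir φ, u i⟫| ≤ r) : zonotope s u ⊆ closedBall 0 r := by
  intro z hz
  obtain ⟨φ, hφ⟩ := exists_eq_norm_smul_dir z
  rw [mem_closedBall_zero_iff]
  have h1 := (inner_le_of_mem_zonotope s u (dir φ) hz).trans (h φ)
  rw [hφ, inner_smul_right, inner_dir] at h1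
  simpa using h1

lemma closedBall_subset_zonotope {ι : Type*} {s : Finset ι} {u : ι → Eu 2} {r : ℝ}
    (h : ∀ φ, r ≤ ∑ i ∈ s, |⟪dir φ, u i⟫|) : closedBall 0 r ⊆ zonotope s u := by
  intro x hx
  by_contra hcon
  obtain ⟨f, a, hf, ha⟩ := geometric_hahn_banach_closed_point (convex_zonotope s u)
    (isCompact_zonotope s u).isClosed hcon
  set c := (InnerProductSpace.toDual ℝ (Eu 2)).symm f with hc
  have hfc : ∀ y, f y = ⟪c, y⟫ := fun y => by rw [hc, InnerProductSpace.toDual_symm_apply]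
  obtain ⟨z, hz, hz'⟩ := exists_mem_zonotope_inner_eq s u c
  obtain ⟨φ, hφ⟩ := exists_eq_norm_smul_dir c
  have h1 := (hf z hz).trans ha
  rw [hfc, hfc, hz'] at h1
  have h2 : ⟪c, x⟫ ≤ ‖c‖ * r := (real_inner_le_norm _ _).trans
    (by gcongr; simpa using hx)
  have h3 : ∑ i ∈ s, |⟪c, u i⟫| = ‖c‖ * ∑ i ∈ s, |⟪dir φ, u i⟫| := by
    rw [Finset.mul_sum]
    refine Finset.sum_congr rfl fun i _ => ?_
    conv_lhs => rw [hφ]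
    rw [inner_smul_left, abs_mul]
    simp
  rw [h3] at h1
  have := mul_le_mul_of_nonneg_left (h φ) (norm_nonneg c)
  linarith

/-- The `t`-neighbourhood of a set. -/
def par (V : Set (Eu 2)) (t : ℝ) : Set (Eu 2) := V + closedBall 0 t

lemma par_par (V : Set (Eu 2)) {s t : ℝ} (hs : 0 ≤ s) (ht : 0 ≤ t) :
    par (par V s) t = par V (s + t) := by
  rw [par, par, par, add_assoc, closedBall_add_closedBall hs ht, add_zero]

lemma par_mono (V : Set (Eu 2)) {s t : ℝ} (h : s ≤ t) : par V s ⊆ par V t :=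
  Set.add_subset_add_left (closedBall_subset_closedBall h)

lemma IsExteriorRegion.par {V : Set (Eu 2)} (hV : IsExteriorRegion V) {t : ℝ} (ht : 0 ≤ t) :
    IsExteriorRegion (par V t) := hV.add_left (nonempty_closedBall.2 ht)

lemma IsExteriorRegion.volumeReal_anti {V W : Set (Eu 2)} (hV : IsExteriorRegion V) (h : V ⊆ W) :
    volume.real Wᶜ ≤ volume.real Vᶜ :=
  measureReal_mono (Set.compl_subset_compl.2 h) hV.volume_compl_ne_top

lemma sin_half_odd_ne_zero {N : ℕ} (hN : 0 < N) (i j : ℕ) :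
    sin ((j + 1 / 2 : ℝ) * (π / N) - i * (π / N)) ≠ 0 := by
  have hN' : (0 : ℝ) < N := by exact_mod_cast hN
  rw [Ne, Real.sin_eq_zero_iff]
  rintro ⟨n, hn⟩
  have h1 : (n : ℝ) * N = j + 1 / 2 - i := by
    field_simp at hn ⊢
    have := pi_pos
    linarith
  have h2 : (2 * (n * N) : ℤ) = 2 * j + 1 - 2 * i := by
    have : ((2 * (n * N) : ℤ) : ℝ) = ((2 * j + 1 - 2 * i : ℤ) : ℝ) := by push_cast; linarith
    exact_mod_cast this
  omega

/-- Quantitative second-difference inequality for the area of the complement of parallel sets. -/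
lemma par_inequality_approx {V : Set (Eu 2)} (hV : IsExteriorRegion V) {h : ℝ} (hh : 0 < h)
    (hne : (par V (2 * h))ᶜ.Nonempty) {N : ℕ} (hN : π ^ 2 < N) :
    2 * volume.real (par V h)ᶜ + 4 * π * h ^ 2 * (2 - π ^ 2 / N) / (2 + π ^ 2 / N) ^ 2 ≤
      volume.real Vᶜ + volume.real (par V (2 * (h * (2 - π ^ 2 / N) / (2 + π ^ 2 / N))))ᶜ := by
  have hN' : (0 : ℝ) < N := (by positivity : (0 : ℝ) < π ^ 2).trans hN
  have hN0 : 0 < N := by exact_mod_cast hN'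
  set δ := π ^ 2 / N with hδ
  have hδ0 : 0 < δ := by positivity
  have hδ1 : δ < 1 := (div_lt_one hN').2 hN
  set l := h / (2 + δ) with hl
  have hl0 : 0 < l := by positivity
  have hlh : l * (2 + δ) = h := by rw [hl]; field_simp
  have hlh' : h * (2 - δ) / (2 + δ) = l * (2 - δ) := by rw [hl]; field_simp
  rw [hlh']
  set u : ℕ → Eu 2 := fun i => (l * (π / N)) • dir (i * (π / N)) with hu
  set w : ℕ → Eu 2 := fun j => (l * (π / N)) • dir ((j + 1 / 2) * (π / N)) with hw
  have hpos : 0 < l * (π / N) := by positivity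
  have sums : ∀ c : ℝ, l * (2 - δ) ≤ ∑ i ∈ Finset.range N, l * (π / N) * |cos (i * (π / N) + c)| ∧
      ∑ i ∈ Finset.range N, l * (π / N) * |cos (i * (π / N) + c)| ≤ l * (2 + δ) := by
    intro c
    have := abs_le.1 (abs_riemann_sum_abs_cos_sub hN0 c)
    rw [← Finset.mul_sum, mul_assoc]
    constructor <;> refine mul_le_mul_of_nonneg_left ?_ hl0.le <;> linarith
  have su : ∀ φ, ∑ i ∈ Finset.range N, |⟪dir φ, u i⟫| =
      ∑ i ∈ Finset.range N, l * (π / N) * |cos (i * (π / N) + -φ)| := fun φ => by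
    refine Finset.sum_congr rfl fun i _ => ?_
    rw [hu, inner_smul_right, inner_dir, abs_mul, abs_of_pos hpos, ← cos_neg]
    ring_nf
  have sw : ∀ φ, ∑ i ∈ Finset.range N, |⟪dir φ, w i⟫| =
      ∑ i ∈ Finset.range N, l * (π / N) * |cos (i * (π / N) + (1 / 2 * (π / N) - φ))| := fun φ => by
    refine Finset.sum_congr rfl fun i _ => ?_
    rw [hw, inner_smul_right, inner_dir, abs_mul, abs_of_pos hpos, ← cos_neg]
    ring_nf
  have Z1 : zonotope (Finset.range N) u ⊆ closedBall 0 h :=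
    zonotope_subset_closedBall fun φ => by rw [su, ← hlh]; exact (sums _).2
  have Z2 : zonotope (Finset.range N) w ⊆ closedBall 0 h :=
    zonotope_subset_closedBall fun φ => by rw [sw, ← hlh]; exact (sums _).2
  have Z3 : closedBall 0 (l * (2 - δ)) ⊆ zonotope (Finset.range N) u :=
    closedBall_subset_zonotope fun φ => by rw [su]; exact (sums _).1
  have Z4 : closedBall 0 (l * (2 - δ)) ⊆ zonotope (Finset.range N) w :=
    closedBall_subset_zonotope fun φ => by rw [sw]; exact (sums _).1
  have hcross : ∀ i j : ℕ, |cross (u i) (w j)| = (l * (π / N)) *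
      ((l * (π / N)) * |sin ((j + 1 / 2 : ℝ) * (π / N) - i * (π / N))|) := by
    intro i j
    have : cross (u i) (w j) = (l * (π / N)) * ((l * (π / N)) *
        cross (dir (i * (π / N))) (dir ((j + 1 / 2) * (π / N)))) := by
      simp [hu, hw, cross]; ring
    rw [this, abs_mul (l * (π / N)), abs_mul (l * (π / N)), abs_of_pos hpos, cross_dir]
  have key := zonotope_inequality hV (Finset.range N) (u := u) (Finset.range N) (w := w) ?_ ?_
  · have k1 := (hV.add_left ⟨_, zero_mem_zonotope (Finset.range N) u⟩).volumeReal_anti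
      (Set.add_subset_add_left (s := V) Z1)
    have k2 := (hV.add_left ⟨_, zero_mem_zonotope (Finset.range N) w⟩).volumeReal_anti
      (Set.add_subset_add_left (s := V) Z2)
    have hl2 : 0 ≤ l * (2 - δ) := mul_nonneg hl0.le (by linarith)
    have k3 := (hV.par (t := 2 * (l * (2 - δ))) (by linarith)).volumeReal_anti
      (W := V + zonotope (Finset.range N) u + zonotope (Finset.range N) w) (by
        rw [two_mul, ← par_par V hl2 hl2]
        exact Set.add_subset_add (Set.add_subset_add_left Z3) Z4)
    have k4 : 4 * π * h ^ 2 * (2 - δ) / (2 + δ) ^ 2 ≤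
        ∑ j ∈ Finset.range N, ∑ i ∈ Finset.range N, 4 * |cross (u i) (w j)| := by
      have : ∀ j ∈ Finset.range N, 4 * (l * (π / N)) * (l * (2 - δ)) ≤
          ∑ i ∈ Finset.range N, 4 * |cross (u i) (w j)| := by
        intro j _
        have h1 := (sums (π / 2 - (j + 1 / 2) * (π / N))).1
        calc _ ≤ 4 * (l * (π / N)) * _ := mul_le_mul_of_nonneg_left h1 (by positivity)
          _ = _ := by
            rw [Finset.mul_sum]
            refine Finset.sum_congr rfl fun i _ => ?_
            rw [hcross, ← cos_pi_div_two_sub]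
            rw [show π / 2 - ((j + 1 / 2 : ℝ) * (π / N) - i * (π / N)) =
              i * (π / N) + (π / 2 - (j + 1 / 2) * (π / N)) by ring]
            ring
      refine le_trans (le_of_eq ?_) (Finset.sum_le_sum this)
      rw [Finset.sum_const, Finset.card_range, nsmul_eq_mul, hl]
      field_simp
    simp only [par] at *
    linarith
  · intro i _ j _ h0
    have := hcross i j
    rw [h0, abs_zero] at this
    exact sin_half_odd_ne_zero hN0 i j
      (by simpa [hpos.ne', hl0.ne', hN'.ne', pi_ne_zero] using this.symm)
  · refine hne.mono (Set.compl_subset_compl.2 ?_)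
    rw [two_mul, ← par_par V hh.le hh.le]
    exact Set.add_subset_add (Set.add_subset_add_left Z1) Z2

lemma par_eq_thickening {V : Set (Eu 2)} (hV : IsOpen V) {t : ℝ} (ht : 0 < t) :
    par V t = thickening t V := by
  rw [par, ← closure_ball _ ht.ne', hV.add_closure, add_ball_zero]

lemma tendsto_par_left {V : Set (Eu 2)} (hV : IsExteriorRegion V) {t : ℝ} (ht : 0 < t)
    {r : ℕ → ℝ} (hr0 : ∀ n, 0 < r n) (hr : StrictMono r) (hrt : ∀ n, r n < t)
    (hlim : Tendsto r atTop (nhds t)) :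
    Tendsto (fun n => volume.real (par V (r n))ᶜ) atTop (nhds (volume.real (par V t)ᶜ)) := by
  have e : (par V t)ᶜ = ⋂ n, (par V (r n))ᶜ := by
    rw [← Set.compl_iUnion]
    congr 1
    apply Set.Subset.antisymm
    · rw [par_eq_thickening hV.1 ht]
      intro x hx
      obtain ⟨v, hv, hd⟩ := mem_thickening_iff.1 hx
      obtain ⟨n, hn⟩ := (hlim.eventually (lt_mem_nhds hd)).exists
      rw [Set.mem_iUnion]
      refine ⟨n, ?_⟩
      rw [par_eq_thickening hV.1 (hr0 n)]
      exact mem_thickening_iff.2 ⟨v, hv, hn⟩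
    · exact Set.iUnion_subset fun n => par_mono V (hrt n).le
  rw [e]
  simp only [measureReal_def]
  refine (ENNReal.tendsto_toReal ?_).comp (tendsto_measure_iInter_atTop ?_ ?_ ?_)
  · rw [← e]; exact (hV.par ht.le).volume_compl_ne_top
  · exact fun n => (hV.par (hr0 n).le).1.measurableSet.compl.nullMeasurableSet
  · exact fun m n hmn => Set.compl_subset_compl.2 (par_mono V (hr.monotone hmn))
  · exact ⟨0, (hV.par (hr0 0).le).volume_compl_ne_top⟩

/-- The area of the complement of the parallel sets of an exterior region has second differences
bounded below by those of `π t ^ 2`. -/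
lemma par_inequality {V : Set (Eu 2)} (hV : IsExteriorRegion V) {h : ℝ} (hh : 0 < h)
    (hne : (par V (2 * h))ᶜ.Nonempty) :
    2 * volume.real (par V h)ᶜ + 2 * π * h ^ 2 ≤
      volume.real Vᶜ + volume.real (par V (2 * h))ᶜ := by
  have hdelta : Tendsto (fun N : ℕ => π ^ 2 / (N : ℝ)) atTop (nhds 0) :=
    tendsto_const_div_atTop_nhds_zero_nat _
  have step : ∀ r, 0 < r → r < 2 * h → 2 * volume.real (par V h)ᶜ + 2 * π * h ^ 2 ≤
      volume.real Vᶜ + volume.real (par V r)ᶜ := by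
    intro r hr0 hr
    have l1 : Tendsto (fun N : ℕ => 2 * volume.real (par V h)ᶜ +
        4 * π * h ^ 2 * (2 - π ^ 2 / N) / (2 + π ^ 2 / N) ^ 2) atTop
        (nhds (2 * volume.real (par V h)ᶜ + 4 * π * h ^ 2 * (2 - 0) / (2 + 0) ^ 2)) :=
      tendsto_const_nhds.add (((tendsto_const_nhds.mul (tendsto_const_nhds.sub hdelta))).div
        ((tendsto_const_nhds.add hdelta).pow 2) (by norm_num))
    have l2 : Tendsto (fun N : ℕ => 2 * (h * (2 - π ^ 2 / (N : ℝ)) / (2 + π ^ 2 / N))) atTop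
        (nhds (2 * (h * (2 - 0) / (2 + 0)))) :=
      (((tendsto_const_nhds.mul (tendsto_const_nhds.sub hdelta))).div
        (tendsto_const_nhds.add hdelta) (by norm_num)).const_mul 2
    rw [show 2 * (h * (2 - 0) / (2 + 0)) = 2 * h by ring] at l2
    rw [show 4 * π * h ^ 2 * (2 - 0) / (2 + 0) ^ 2 = 2 * π * h ^ 2 by ring] at l1
    refine le_of_tendsto l1 ?_
    filter_upwards [l2.eventually (lt_mem_nhds hr),
      tendsto_natCast_atTop_atTop.eventually (eventually_gt_atTop (π ^ 2))] with N hN1 hN2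
    refine (par_inequality_approx hV hh hne hN2).trans ?_
    exact add_le_add le_rfl ((hV.par hr0.le).volumeReal_anti (par_mono V hN1.le))
  obtain ⟨r, hr, hr', hlim⟩ := exists_seq_strictMono_tendsto' (show 0 < 2 * h by linarith)
  exact ge_of_tendsto' (tendsto_const_nhds.add (tendsto_par_left hV (by linarith)
    (fun n => (hr' n).1) hr (fun n => (hr' n).2) hlim))
    fun n => step _ (hr' n).1 (hr' n).2

lemma par_step {V : Set (Eu 2)} (hV : IsExteriorRegion V) {h : ℝ} (hh : 0 < h)
    {n : ℕ} (hne : (par V (n * h))ᶜ.Nonempty) {k : ℕ} (hk : k < n) :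
    volume.real (par V (k * h))ᶜ - volume.real (par V ((k + 1 : ℕ) * h))ᶜ ≤
      volume.real (par V 0)ᶜ - volume.real (par V h)ᶜ - 2 * π * h ^ 2 * k := by
  induction k with
  | zero => simp
  | succ k ih =>
    have h1 := ih (by omega)
    have hk0 : (0 : ℝ) ≤ k * h := by positivity
    have h2 := par_inequality (hV.par hk0) hh
      (by
        rw [par_par V hk0 (by positivity)]
        refine hne.mono (Set.compl_subset_compl.2 (par_mono V ?_))
        rw [← add_mul]
        gcongr
        exact_mod_cast (by omega : k + 2 ≤ n))
    rw [par_par V hk0 hh.le, par_par V hk0 (by positivity)] at h2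
    rw [show (k : ℝ) * h + h = (k + 1 : ℕ) * h by push_cast; ring,
      show (k : ℝ) * h + 2 * h = (k + 1 + 1 : ℕ) * h by push_cast; ring] at h2
    push_cast at *
    linarith

lemma par_zero (V : Set (Eu 2)) : par V 0 = V := by simp [par]

/-- If the area swept by short parallel sets grows at most linearly with slope `L`, then the area
swept by long ones is controlled by the corresponding quadratic, and so are its increments. -/
lemma swept_area_le {V : Set (Eu 2)} (hV : IsExteriorRegion V) {t : ℝ}
    (ht : 0 < t) (hne : (par V t)ᶜ.Nonempty) {L C t₀ : ℝ} (ht₀ : 0 < t₀)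
    (hsmall : ∀ s, 0 < s → s < t₀ →
      volume.real Vᶜ - volume.real (par V s)ᶜ ≤ L * s + C * s ^ 2) :
    (∀ᶠ n : ℕ in atTop, volume.real (par V (t - t / n))ᶜ - volume.real (par V t)ᶜ ≤
      t / n * (L - 2 * π * t + (C + 2 * π) * (t / n))) ∧
    volume.real Vᶜ - volume.real (par V t)ᶜ ≤ L * t - π * t ^ 2 := by
  have hlim : Tendsto (fun n : ℕ => t / (n : ℝ)) atTop (nhds 0) :=
    tendsto_const_div_atTop_nhds_zero_nat _
  have ev : ∀ᶠ n : ℕ in atTop, t / (n : ℝ) < t₀ ∧ 0 < n :=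
    (hlim.eventually (gt_mem_nhds ht₀)).and (eventually_gt_atTop 0)
  have step : ∀ n : ℕ, t / (n : ℝ) < t₀ ∧ 0 < n → ∀ k < n,
      volume.real (par V (k * (t / n)))ᶜ - volume.real (par V ((k + 1 : ℕ) * (t / n)))ᶜ ≤
      L * (t / n) + C * (t / n) ^ 2 - 2 * π * (t / n) ^ 2 * k := by
    rintro n ⟨h1, hn⟩ k hk
    have hn' : (0 : ℝ) < n := by exact_mod_cast hn
    have hh : 0 < t / n := by positivity
    have h2 := par_step hV hh (n := n) (by rwa [mul_div_cancel₀ _ hn'.ne']) hk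
    have h3 := hsmall _ hh h1
    rw [par_zero] at h2
    linarith
  constructor
  · filter_upwards [ev] with n hn
    have hn' : (0 : ℝ) < n := by exact_mod_cast hn.2
    have h1 := step n hn (n - 1) (by have := hn.2; omega)
    rw [Nat.sub_add_cancel hn.2, mul_div_cancel₀ _ hn'.ne', Nat.cast_sub hn.2, Nat.cast_one,
      sub_mul, mul_div_cancel₀ _ hn'.ne', one_mul] at h1
    refine h1.trans (le_of_eq ?_)
    field_simp
    ring
  · have l1 : Tendsto (fun n : ℕ => L * t - π * t ^ 2 + (C * t + π * t) * (t / (n : ℝ))) atTop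
        (nhds (L * t - π * t ^ 2 + (C * t + π * t) * 0)) :=
      tendsto_const_nhds.add (hlim.const_mul _)
    rw [mul_zero, add_zero] at l1
    refine ge_of_tendsto l1 ?_
    filter_upwards [ev] with n hn
    have hn' : (0 : ℝ) < n := by exact_mod_cast hn.2
    have h1 := Finset.sum_le_sum fun k hk => step n hn k (Finset.mem_range.1 hk)
    rw [Finset.sum_range_sub' (fun k : ℕ => volume.real (par V (k * (t / n)))ᶜ),
      mul_div_cancel₀ _ hn'.ne', Finset.sum_sub_distrib, ← Finset.mul_sum, Finset.sum_const,
      Finset.card_range, nsmul_eq_mul, Nat.cast_zero, zero_mul, par_zero] at h1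
    have h2 : ∑ k ∈ Finset.range n, (k : ℝ) = n * (n - 1) / 2 := by
      clear * -
      induction n with
      | zero => simp
      | succ n ih => rw [Finset.sum_range_succ, ih]; push_cast; ring
    rw [h2] at h1
    refine h1.trans (le_of_eq ?_)
    field_simp
    ring

/-! ### Topology of the exterior region of a planar domain -/

lemma IsPreconnected.subset_of_disjoint_frontier {X : Type*} [TopologicalSpace X] {S V : Set X}
    (hS : IsPreconnected S) (hV : IsOpen V) (hd : Disjoint S (frontier V))
    (hne : (S ∩ V).Nonempty) : S ⊆ V := by
  refine hS.subset_left_of_subset_union hV (isClosed_closure (s := V)).isOpen_compl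
    (Set.disjoint_left.2 fun x hx hx' => hx' (subset_closure hx)) (fun x hx => ?_) hne
  by_cases h : x ∈ closure V
  · left
    by_contra h'
    exact Set.disjoint_left.1 hd hx (hV.frontier_eq ▸ ⟨h, h'⟩)
  · exact Or.inr h

lemma IsPreconnected.subset_compl_closure_of_disjoint_frontier {X : Type*} [TopologicalSpace X]
    {S V : Set X} (hS : IsPreconnected S) (hd : Disjoint S (frontier V))
    (hne : (S ∩ (closure V)ᶜ).Nonempty) : S ⊆ (closure V)ᶜ := by
  refine hS.subset_of_disjoint_frontier isClosed_closure.isOpen_compl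
    (hd.mono_right ?_) hne
  rw [frontier_compl]
  exact frontier_closure_subset

lemma connectedComponentIn_subset_unboundedPart {Ω : Set (Eu 2)} {x : Eu 2}
    (hx : x ∈ unboundedPart Ω) : connectedComponentIn (closure Ω)ᶜ x ⊆ unboundedPart Ω := by
  intro y hy
  refine ⟨connectedComponentIn_subset _ _ hy, ?_⟩
  rw [← connectedComponentIn_eq hy]
  exact hx.2

lemma isOpen_unboundedPart (Ω : Set (Eu 2)) : IsOpen (unboundedPart Ω) := by
  rw [isOpen_iff_mem_nhds]
  intro x hx
  exact mem_of_superset ((isClosed_closure.isOpen_compl.connectedComponentIn).mem_nhds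
    (mem_connectedComponentIn hx.1)) (connectedComponentIn_subset_unboundedPart hx)

lemma unboundedPart_subset (Ω : Set (Eu 2)) : unboundedPart Ω ⊆ (closure Ω)ᶜ := fun _ hx => hx.1

lemma isExteriorRegion_unboundedPart {Ω : Set (Eu 2)} (hb : Bornology.IsBounded Ω) :
    IsExteriorRegion (unboundedPart Ω) := by
  refine ⟨isOpen_unboundedPart Ω, ?_, fun v hv => ⟨_, connectedComponentIn_subset_unboundedPart hv,
    isPreconnected_connectedComponentIn, mem_connectedComponentIn hv.1, hv.2⟩⟩
  obtain ⟨R, hR0, hR⟩ := hb.closure.subset_closedBall_lt 0 0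
  suffices h : (closedBall (0 : Eu 2) R)ᶜ ⊆ unboundedPart Ω from
    isBounded_closedBall.subset (Set.compl_subset_comm.1 h)
  intro x hx
  have hx' : R < ‖x‖ := by simpa using hx
  have hsub : (fun c : ℝ => c • x) '' Set.Ici 1 ⊆ (closure Ω)ᶜ := by
    rintro _ ⟨c, hc, rfl⟩ h
    have h1 := hR h
    rw [mem_closedBall_zero_iff, norm_smul, norm_of_nonneg (zero_le_one.trans hc)] at h1
    have : 1 * ‖x‖ ≤ c * ‖x‖ := by gcongr; exact hc
    linarith
  have hxm : x ∈ (fun c : ℝ => c • x) '' Set.Ici 1 := ⟨1, Set.mem_Ici.2 le_rfl, one_smul _ _⟩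
  refine ⟨hsub hxm, fun hbd => ?_⟩
  have hcc := (isPreconnected_Ici.image (fun c : ℝ => c • x)
    (by fun_prop)).subset_connectedComponentIn hxm hsub
  obtain ⟨M, hM⟩ := (hbd.subset hcc).subset_closedBall 0
  have h2 := hM ⟨max 1 ((|M| + 1) / ‖x‖), Set.mem_Ici.2 (le_max_left _ _), rfl⟩
  have hxp : 0 < ‖x‖ := hR0.trans hx'
  rw [mem_closedBall_zero_iff, norm_smul, norm_of_nonneg (by positivity)] at h2
  have h3 : (|M| + 1) / ‖x‖ * ‖x‖ ≤ max 1 ((|M| + 1) / ‖x‖) * ‖x‖ := by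
    gcongr; exact le_max_right _ _
  rw [div_mul_cancel₀ _ hxp.ne'] at h3
  linarith [le_abs_self M]

lemma disjoint_closure_unboundedPart {Ω : Set (Eu 2)} (hΩ : IsOpen Ω) :
    Disjoint Ω (closure (unboundedPart Ω)) :=
  (Set.disjoint_left.2 fun _ hx h => unboundedPart_subset Ω h (subset_closure hx)).closure_right hΩ

lemma frontier_unboundedPart_subset {Ω : Set (Eu 2)} (hΩ : IsOpen Ω) :
    frontier (unboundedPart Ω) ⊆ frontier Ω := by
  intro x hx
  rw [(isOpen_unboundedPart Ω).frontier_eq] at hx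
  rw [hΩ.frontier_eq]
  refine ⟨?_, fun h => Set.disjoint_left.1 (disjoint_closure_unboundedPart hΩ) h hx.1⟩
  by_contra hxU
  have ho : connectedComponentIn (closure Ω)ᶜ x ∈ nhds x :=
    isClosed_closure.isOpen_compl.connectedComponentIn.mem_nhds (mem_connectedComponentIn hxU)
  obtain ⟨y, hy, hyV⟩ := mem_closure_iff_nhds.1 hx.1 _ ho
  refine hx.2 ⟨hxU, ?_⟩
  rw [connectedComponentIn_eq hy]
  exact hyV.2

lemma IsExteriorRegion.nonempty_frontier {V : Set (Eu 2)} (hV : IsExteriorRegion V)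
    (hne : Vᶜ.Nonempty) : (frontier V).Nonempty := by
  rw [nonempty_frontier_iff]
  refine ⟨?_, fun h => by simp [h] at hne⟩
  by_contra h
  have h1 := hV.2.1
  rw [Set.not_nonempty_iff_eq_empty.1 h, Set.compl_empty] at h1
  exact NormedSpace.unbounded_univ ℝ (Eu 2) h1

/-- Outside an open set, the distance to the set is the distance to its boundary. -/
lemma mem_thickening_iff_infDist_frontier {V : Set (Eu 2)} (hV : IsOpen V) {x : Eu 2}
    (hx : x ∉ V) (hne : (frontier V).Nonempty) {t : ℝ} (ht : 0 < t) :
    x ∈ thickening t V ↔ infDist x (frontier V) < t := by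
  constructor
  · intro h
    obtain ⟨v, hv, hxv⟩ := mem_thickening_iff.1 h
    by_contra! hlt
    have hd : Disjoint (ball x t) (frontier V) :=
      disjoint_ball_infDist.mono_left (ball_subset_ball hlt)
    exact hx ((convex_ball x t).isPreconnected.subset_of_disjoint_frontier hV hd
      ⟨v, by rwa [mem_ball, dist_comm], hv⟩ (mem_ball_self ht))
  · intro h
    obtain ⟨p, hp, hxp⟩ := (infDist_lt_iff hne).1 h
    rw [← thickening_closure]
    exact mem_thickening_iff.2 ⟨p, frontier_subset_closure hp, hxp⟩

lemma ball_infDist_frontier_subset {V : Set (Eu 2)} {x : Eu 2}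
    (hx : x ∉ closure V) : ball x (infDist x (frontier V)) ⊆ (closure V)ᶜ := by
  rcases (infDist_nonneg (x := x) (s := frontier V)).eq_or_lt with h | h
  · simp [← h]
  · exact (convex_ball x _).isPreconnected.subset_compl_closure_of_disjoint_frontier
      disjoint_ball_infDist ⟨x, mem_ball_self h, hx⟩

lemma IsExteriorRegion.infDist_frontier_pos {V : Set (Eu 2)} (hV : IsExteriorRegion V)
    {x : Eu 2} (hx : x ∉ closure V) : 0 < infDist x (frontier V) := by
  have hne := hV.nonempty_frontier ⟨x, fun h => hx (subset_closure h)⟩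
  exact (isClosed_frontier.notMem_iff_infDist_pos hne).1 fun h => hx (frontier_subset_closure h)

/-- The area swept between two parallel sets of the exterior, in terms of the distance to the
boundary. -/
lemma IsExteriorRegion.volume_band {V : Set (Eu 2)} (hV : IsExteriorRegion V)
    (hne : Vᶜ.Nonempty) (h0 : volume (frontier V) = 0) {s t : ℝ} (hs : 0 ≤ s) (hst : s ≤ t)
    (ht : 0 < t) :
    volume.real {x | x ∉ closure V ∧ s ≤ infDist x (frontier V) ∧ infDist x (frontier V) < t} =
      volume.real (_root_.par V s)ᶜ - volume.real (_root_.par V t)ᶜ := by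
  have hfne := hV.nonempty_frontier hne
  have hmem : ∀ x ∉ closure V, ∀ r : ℝ, 0 ≤ r →
      (x ∈ _root_.par V r ↔ infDist x (frontier V) < r) := by
    intro x hx r hr
    rcases hr.eq_or_lt with rfl | hr
    · rw [par_zero]
      exact ⟨fun h => (hx (subset_closure h)).elim, fun h => absurd infDist_nonneg (not_le.2 h)⟩
    · rw [par_eq_thickening hV.1 hr]
      exact mem_thickening_iff_infDist_frontier hV.1 (fun h => hx (subset_closure h)) hfne hr
  rw [← measureReal_sdiff (Set.compl_subset_compl.2 (par_mono V hst))
    (hV.par (hs.trans hst)).1.isClosed_compl.measurableSet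
    (hV.par hs).volume_compl_ne_top]
  refine measureReal_congr ?_
  have hae : ∀ᵐ x ∂(volume : Measure (Eu 2)), x ∉ frontier V := by
    rw [ae_iff]
    simpa using h0
  filter_upwards [hae] with x hx
  by_cases hxc : x ∈ closure V
  · have hxV : x ∈ V := by
      by_contra h
      exact hx (hV.1.frontier_eq ▸ ⟨hxc, h⟩)
    have : x ∈ _root_.par V s := by
      have := par_mono V hs
      rw [par_zero] at this
      exact this hxV
    exact propext ⟨fun h => absurd hxc h.1, fun h => absurd this h.1⟩
  · refine propext ?_
    have h1 := hmem x hxc s hs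
    have h2 := hmem x hxc t ht.le
    constructor
    · rintro ⟨_, ha, hb⟩
      exact ⟨fun h => not_le.2 (h1.1 h) ha, fun h => h (h2.2 hb)⟩
    · rintro ⟨ha, hb⟩
      exact ⟨hxc, not_lt.1 fun h => ha (h1.2 h), h2.1 (by_contra hb)⟩

lemma volume_eq_zero_of_hausdorffMeasure_one_ne_top {S : Set (Eu 2)} (h : μH[1] S ≠ ⊤) :
    volume S = 0 := by
  have h2 : (μH[((2 : ℕ) : ℝ)] : Measure (Eu 2)) S = 0 := by
    have := (Measure.hausdorffMeasure_zero_or_top (show (1 : ℝ) < ((2 : ℕ) : ℝ) by norm_num) S)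
    exact this.resolve_right h
  rw [← EuclideanSpace.euclideanHausdorffMeasure_eq_volume 2,
    Measure.euclideanHausdorffMeasure_def, Measure.smul_apply, h2, smul_zero]

/-! ### Length of images of curves -/

section HausdorffLength

variable {E : Type*} [NormedAddCommGroup E] [NormedSpace ℝ E]

lemma exists_uniform_partition {f f' : ℝ → E} (hf : ∀ x, HasDerivAt f (f' x) x)
    (hf' : Continuous f') {ε : ℝ} (hε : 0 < ε) :
    ∃ n : ℕ, 0 < n ∧ ∀ k < n, ∃ m : ℝ, 0 ≤ m ∧
      (∀ u ∈ Set.Ico ((k : ℝ) / n) ((k + 1 : ℕ) / n), |‖f' u‖ - m| ≤ ε) ∧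
      ∀ u ∈ Set.Ico ((k : ℝ) / n) ((k + 1 : ℕ) / n),
      ∀ v ∈ Set.Ico ((k : ℝ) / n) ((k + 1 : ℕ) / n),
        |‖f u - f v‖ - m * (|u - v|)| ≤ ε * |u - v| := by
  have hu := (isCompact_Icc (a := (0 : ℝ)) (b := 1)).uniformContinuousOn_of_continuous
    hf'.continuousOn
  obtain ⟨δ, hδ, hd⟩ := Metric.uniformContinuousOn_iff.1 hu ε hε
  obtain ⟨n, hn⟩ := exists_nat_gt (1 / δ)
  have hn0 : (0 : ℝ) < n := lt_trans (by positivity) hn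
  refine ⟨n, by exact_mod_cast hn0, fun k hk => ⟨‖f' (k / n)‖, norm_nonneg _, ?_⟩⟩
  have hkn : ((k + 1 : ℕ) : ℝ) ≤ n := by exact_mod_cast hk
  have key : ∀ u ∈ Set.Ico ((k : ℝ) / n) ((k + 1 : ℕ) / n), ‖f' u - f' (k / n)‖ ≤ ε := by
    intro u hu
    have h0 : (0 : ℝ) ≤ k / n := by positivity
    have h1 : ((k + 1 : ℕ) : ℝ) / n ≤ 1 := (div_le_one hn0).2 hkn
    have hw : ((k + 1 : ℕ) : ℝ) / n = k / n + 1 / n := by push_cast; ring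
    have h2 : 1 / (n : ℝ) < δ := by rwa [div_lt_comm₀ hn0 hδ]
    rw [← dist_eq_norm]
    refine (hd u ⟨h0.trans hu.1, hu.2.le.trans h1⟩ _ ⟨h0, (hu.1.trans hu.2.le).trans h1⟩ ?_).le
    rw [Real.dist_eq, abs_of_nonneg (by linarith [hu.1])]
    linarith [hu.2]
  refine ⟨fun u hu => (abs_norm_sub_norm_le _ _).trans (key u hu), fun u hu v hv => ?_⟩
  have h := (convex_Ico ((k : ℝ) / n) ((k + 1 : ℕ) / n)).norm_image_sub_le_of_norm_hasDerivWithin_le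
    (f := fun x => f x - x • f' (k / n)) (f' := fun x => f' x - (1 : ℝ) • f' (k / n))
    (fun x _ => ((hf x).sub ((hasDerivAt_id x).smul_const _)).hasDerivWithinAt)
    (fun x hx => by simpa using key x hx) hv hu
  rw [Real.norm_eq_abs] at h
  refine le_trans ?_ h
  have e : f u - f v = (f u - u • f' (k / n) - (f v - v • f' (k / n))) + (u - v) • f' (k / n) := by
    module
  have h3 : ‖(u - v) • f' ((k : ℝ) / n)‖ = ‖f' ((k : ℝ) / n)‖ * |u - v| := by
    rw [norm_smul, Real.norm_eq_abs, mul_comm]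
  rw [← h3]
  refine (abs_norm_sub_norm_le _ _).trans (le_of_eq ?_)
  congr 1
  module

lemma Ico_zero_one_eq_iUnion {n : ℕ} (hn : 0 < n) :
    Set.Ico (0 : ℝ) 1 = ⋃ k ∈ Finset.range n, Set.Ico ((k : ℝ) / n) ((k + 1 : ℕ) / n) := by
  have hn0 : (0 : ℝ) < n := by exact_mod_cast hn
  ext x
  simp only [Set.mem_iUnion, Finset.mem_range, Set.mem_Ico, exists_prop]
  constructor
  · rintro ⟨h0, h1⟩
    have hx : 0 ≤ x * n := by positivity
    refine ⟨⌊x * n⌋₊, ?_, ?_, ?_⟩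
    · rw [Nat.floor_lt hx]
      nlinarith
    · rw [div_le_iff₀ hn0]
      exact Nat.floor_le hx
    · rw [lt_div_iff₀ hn0]
      push_cast
      exact Nat.lt_floor_add_one _
  · rintro ⟨k, hk, h0, h1⟩
    refine ⟨le_trans (by positivity) h0, h1.trans_le ?_⟩
    rw [div_le_one hn0]
    exact_mod_cast hk

lemma pairwise_disjoint_Ico_div {n : ℕ} :
    Pairwise (Function.onFun Disjoint fun k : ℕ => Set.Ico ((k : ℝ) / n) ((k + 1 : ℕ) / n)) := by
  have hm : Monotone fun k : ℕ => (k : ℝ) / n := fun a b h => by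
    dsimp only
    gcongr
  exact hm.pairwise_disjoint_on_Ico_succ

variable [MeasurableSpace E] [BorelSpace E]

/-- The length of the image of a `C¹` curve is at most the integral of its speed. -/
lemma hausdorffMeasure_image_le_lintegral {f f' : ℝ → E} (hf : ∀ x, HasDerivAt f (f' x) x)
    (hf' : Continuous f') {B : Set ℝ} (hB : MeasurableSet B) (hB1 : B ⊆ Set.Ico 0 1) :
    μH[1] (f '' B) ≤ ∫⁻ s in B, ‖f' s‖ₑ := by
  have hvB : volume B ≤ 1 := (measure_mono hB1).trans (by simp)
  refine ENNReal.le_of_forall_pos_le_add fun ε hε _ => ?_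
  obtain ⟨n, hn, hp⟩ := exists_uniform_partition hf hf' (ε := ε / 2) (by positivity)
  set I : ℕ → Set ℝ := fun k => Set.Ico ((k : ℝ) / n) ((k + 1 : ℕ) / n) with hI
  have hBI : B = ⋃ k ∈ Finset.range n, B ∩ I k := by
    rw [← Set.inter_iUnion₂, ← Ico_zero_one_eq_iUnion hn, Set.inter_eq_left.2 hB1]
  have hpd : Set.PairwiseDisjoint (↑(Finset.range n)) fun k => B ∩ I k := fun i _ j _ hij =>
    (pairwise_disjoint_Ico_div hij).mono Set.inter_subset_right Set.inter_subset_right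
  calc μH[1] (f '' B) = μH[1] (⋃ k ∈ Finset.range n, f '' (B ∩ I k)) := by
        conv_lhs => rw [hBI]
        rw [Set.image_iUnion₂]
    _ ≤ ∑ k ∈ Finset.range n, μH[1] (f '' (B ∩ I k)) := measure_biUnion_finset_le _ _
    _ ≤ ∑ k ∈ Finset.range n, ∫⁻ s in B ∩ I k, (‖f' s‖ₑ + ε) := by
        refine Finset.sum_le_sum fun k hk => ?_
        obtain ⟨m, hm, h1, h2⟩ := hp k (Finset.mem_range.1 hk)
        have hL : LipschitzOnWith (m + ε / 2).toNNReal f (B ∩ I k) := by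
          refine LipschitzOnWith.of_dist_le_mul fun u hu v hv => ?_
          rw [Real.coe_toNNReal _ (by positivity), Real.dist_eq, dist_eq_norm, add_mul]
          linarith [(abs_le.1 (h2 u hu.2 v hv.2)).2]
        refine (hL.hausdorffMeasure_image_le zero_le_one).trans ?_
        rw [hausdorffMeasure_real, ENNReal.rpow_one, ← setLIntegral_const]
        refine setLIntegral_mono' (hB.inter measurableSet_Ico) fun u hu => ?_
        rw [← ofReal_norm, ← ENNReal.ofReal_coe_nnreal (p := ε),
          ← ENNReal.ofReal_add (norm_nonneg _) (by positivity)]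
        refine ENNReal.ofReal_le_ofReal ?_
        linarith [(abs_le.1 (h1 u hu.2)).1]
    _ = ∫⁻ s in B, (‖f' s‖ₑ + ε) := by
        conv_rhs => rw [hBI]
        rw [lintegral_biUnion_finset hpd (fun k _ => hB.inter measurableSet_Ico)]
    _ = (∫⁻ s in B, ‖f' s‖ₑ) + ε * volume B := by
        rw [lintegral_add_right _ measurable_const, setLIntegral_const]
    _ ≤ (∫⁻ s in B, ‖f' s‖ₑ) + ε := by
        gcongr
        exact mul_le_of_le_one_right' hvB

lemma mul_volume_le_hausdorffMeasure_image {F : Type*} [NormedAddCommGroup F] [MeasurableSpace F]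
    [BorelSpace F] {f : ℝ → F} {A : Set ℝ} {c : ℝ}
    (h : ∀ u ∈ A, ∀ v ∈ A, c * |u - v| ≤ ‖f u - f v‖) :
    ENNReal.ofReal c * volume A ≤ μH[1] (f '' A) := by
  rcases le_or_gt c 0 with hc | hc
  · simp [ENNReal.ofReal_of_nonpos hc]
  have hinj : Set.InjOn f A := by
    intro u hu v hv huv
    have := h u hu v hv
    rw [huv, sub_self, norm_zero] at this
    have h0 : |u - v| ≤ 0 := by
      by_contra! h'
      exact absurd this (not_le.2 (by positivity))
    exact sub_eq_zero.1 (abs_nonpos_iff.1 h0)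
  have hL : LipschitzOnWith (c⁻¹).toNNReal (Function.invFunOn f A) (f '' A) := by
    refine LipschitzOnWith.of_dist_le_mul ?_
    rintro _ ⟨u, hu, rfl⟩ _ ⟨v, hv, rfl⟩
    rw [hinj.leftInvOn_invFunOn hu, hinj.leftInvOn_invFunOn hv,
      Real.coe_toNNReal _ (by positivity), Real.dist_eq, dist_eq_norm, inv_mul_eq_div,
      le_div_iff₀ hc, mul_comm]
    exact h u hu v hv
  have h2 := hL.hausdorffMeasure_image_le zero_le_one
  rw [hinj.invFunOn_image subset_rfl, hausdorffMeasure_real, ENNReal.rpow_one] at h2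
  calc ENNReal.ofReal c * volume A
      ≤ ENNReal.ofReal c * (ENNReal.ofReal c⁻¹ * μH[1] (f '' A)) := by gcongr; exact h2
    _ = μH[1] (f '' A) := by
        rw [← mul_assoc, ← ENNReal.ofReal_mul hc.le, mul_inv_cancel₀ hc.ne', ENNReal.ofReal_one,
          one_mul]

/-- The length of the image of an injective `C¹` curve is at least the integral of its speed. -/
lemma lintegral_le_hausdorffMeasure_image {f f' : ℝ → E} (hf : ∀ x, HasDerivAt f (f' x) x)
    (hf' : Continuous f') {B : Set ℝ} (hB : MeasurableSet B) (hB1 : B ⊆ Set.Ico 0 1)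
    (hinj : Set.InjOn f B) (hmeas : ∀ A ⊆ B, MeasurableSet A → MeasurableSet (f '' A)) :
    ∫⁻ s in B, ‖f' s‖ₑ ≤ μH[1] (f '' B) := by
  have hvB : volume B ≤ 1 := (measure_mono hB1).trans (by simp)
  refine ENNReal.le_of_forall_pos_le_add fun ε hε _ => ?_
  obtain ⟨n, hn, hp⟩ := exists_uniform_partition hf hf' (ε := ε / 2) (by positivity)
  set I : ℕ → Set ℝ := fun k => Set.Ico ((k : ℝ) / n) ((k + 1 : ℕ) / n) with hI
  have hBI : B = ⋃ k ∈ Finset.range n, B ∩ I k := by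
    rw [← Set.inter_iUnion₂, ← Ico_zero_one_eq_iUnion hn, Set.inter_eq_left.2 hB1]
  have hpd : Set.PairwiseDisjoint (↑(Finset.range n)) fun k => B ∩ I k := fun i _ j _ hij =>
    (pairwise_disjoint_Ico_div hij).mono Set.inter_subset_right Set.inter_subset_right
  have hm : ∀ k, MeasurableSet (B ∩ I k) := fun k => hB.inter measurableSet_Ico
  calc ∫⁻ s in B, ‖f' s‖ₑ = ∑ k ∈ Finset.range n, ∫⁻ s in B ∩ I k, ‖f' s‖ₑ := by
        conv_lhs => rw [hBI]
        rw [lintegral_biUnion_finset hpd (fun k _ => hm k)]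
    _ ≤ ∑ k ∈ Finset.range n, (μH[1] (f '' (B ∩ I k)) + ε * volume (B ∩ I k)) := by
        refine Finset.sum_le_sum fun k hk => ?_
        obtain ⟨m, hm', h1, h2⟩ := hp k (Finset.mem_range.1 hk)
        have h3 : ENNReal.ofReal (m - ε / 2) * volume (B ∩ I k) ≤ μH[1] (f '' (B ∩ I k)) := by
          refine mul_volume_le_hausdorffMeasure_image fun u hu v hv => ?_
          rw [sub_mul]
          linarith [(abs_le.1 (h2 u hu.2 v hv.2)).1]
        calc ∫⁻ s in B ∩ I k, ‖f' s‖ₑ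
            ≤ ∫⁻ s in B ∩ I k, (ENNReal.ofReal (m - ε / 2) + ε) := by
              refine setLIntegral_mono' (hm k) fun u hu => ?_
              rw [← ofReal_norm, ← ENNReal.ofReal_coe_nnreal (p := ε)]
              refine le_trans (ENNReal.ofReal_le_ofReal ?_) ENNReal.ofReal_add_le
              linarith [(abs_le.1 (h1 u hu.2)).2]
          _ = ENNReal.ofReal (m - ε / 2) * volume (B ∩ I k) + ε * volume (B ∩ I k) := by
              rw [setLIntegral_const, add_mul]
          _ ≤ _ := by gcongr
    _ = μH[1] (f '' B) + ε * volume B := by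
        rw [Finset.sum_add_distrib, ← Finset.mul_sum,
          ← measure_biUnion_finset hpd (fun k _ => hm k), ← hBI,
          ← measure_biUnion_finset (μ := (μH[1] : Measure E)) (f := fun k => f '' (B ∩ I k)) ?_
            (fun k _ => hmeas _ Set.inter_subset_left (hm k)), ← Set.image_iUnion₂, ← hBI]
        intro i hi j hj hij
        refine Set.disjoint_left.2 ?_
        rintro _ ⟨u, hu, rfl⟩ ⟨v, hv, hvu⟩
        rw [hinj hv.1 hu.1 hvu] at hv
        exact Set.disjoint_left.1 (hpd hi hj hij) hu hv
    _ ≤ μH[1] (f '' B) + ε := by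
        gcongr
        exact mul_le_of_le_one_right' hvB

end HausdorffLength

/-! ### Local structure of a domain near its boundary curves -/

/-- The rotation of the plane by a right angle. -/
def rot : Eu 2 →L[ℝ] Eu 2 :=
  LinearMap.toContinuousLinearMap
    { toFun := fun v => !₂[-v 1, v 0]
      map_add' := fun v w => by ext i; fin_cases i <;> simp [add_comm]
      map_smul' := fun c v => by ext i; fin_cases i <;> simp }

lemma rot_apply (v : Eu 2) : rot v = !₂[-v 1, v 0] := rfl

lemma inner_rot_right (v : Eu 2) : ⟪v, rot v⟫ = 0 := by
  simp [rot_apply, PiLp.inner_apply, Fin.sum_univ_two]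
  ring

lemma norm_rot (v : Eu 2) : ‖rot v‖ = ‖v‖ := by
  simp [rot_apply, EuclideanSpace.norm_eq, Fin.sum_univ_two, add_comm]

lemma norm_sq_add_rot (a b : ℝ) (T : Eu 2) :
    ‖a • T + b • rot T‖ ^ 2 = (a ^ 2 + b ^ 2) * ‖T‖ ^ 2 := by
  rw [norm_add_sq_real, inner_smul_left, inner_smul_right, inner_rot_right, norm_smul, norm_smul,
    norm_rot, mul_pow, mul_pow, Real.norm_eq_abs, Real.norm_eq_abs, sq_abs, sq_abs]
  simp
  ring

lemma abs_mul_norm_le_norm_add_rot (a b : ℝ) (T : Eu 2) :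
    |a| * ‖T‖ ≤ ‖a • T + b • rot T‖ ∧ |b| * ‖T‖ ≤ ‖a • T + b • rot T‖ := by
  have h := norm_sq_add_rot a b T
  constructor <;> refine abs_le_of_sq_le_sq' ?_ (norm_nonneg _) |>.2 <;>
    rw [h, mul_pow, sq_abs] <;> gcongr <;> nlinarith [sq_nonneg a, sq_nonneg b]

lemma norm_add_rot_le (a b : ℝ) (T : Eu 2) : ‖a • T + b • rot T‖ ≤ (|a| + |b|) * ‖T‖ := by
  refine (norm_add_le _ _).trans (le_of_eq ?_)
  rw [norm_smul, norm_smul, norm_rot, Real.norm_eq_abs, Real.norm_eq_abs, add_mul]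

lemma exists_eq_add_rot {T : Eu 2} (hT : T ≠ 0) (x : Eu 2) : ∃ a b : ℝ, x = a • T + b • rot T := by
  have h : T 0 ^ 2 + T 1 ^ 2 ≠ 0 := by
    have := EuclideanSpace.norm_sq_eq T
    rw [Fin.sum_univ_two, Real.norm_eq_abs, Real.norm_eq_abs, sq_abs, sq_abs] at this
    rw [← this]
    positivity
  refine ⟨(x 0 * T 0 + x 1 * T 1) / (T 0 ^ 2 + T 1 ^ 2),
    (x 1 * T 0 - x 0 * T 1) / (T 0 ^ 2 + T 1 ^ 2), ?_⟩
  ext i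
  fin_cases i
  · simp [rot_apply]
    field_simp
    ring
  · simp [rot_apply]
    field_simp
    ring

/-- Near a regular point of a curve, a set locally contained in the curve is a thin graph over the
tangent line. -/
lemma exists_local_graph {γ : ℝ → Eu 2} {s : ℝ} {T : Eu 2} (hT : T ≠ 0)
    (hγ : HasStrictDerivAt γ T s) {F : Set (Eu 2)}
    (hF : ∀ δ > 0, ∃ r > 0, ∀ x ∈ F ∩ ball (γ s) r, ∃ u, |u - s| < δ ∧ γ u = x) :
    ∃ η > 0, (∀ a b : ℝ, |a| ≤ η → |b| ≤ η → γ s + (a • T + b • rot T) ∈ F → |b| ≤ |a|) ∧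
      (∀ a b b' : ℝ, |a| ≤ η → |b| ≤ η → |b'| ≤ η → γ s + (a • T + b • rot T) ∈ F →
        γ s + (a • T + b' • rot T) ∈ F → b = b') := by
  have hTp : 0 < ‖T‖ := norm_pos_iff.2 hT
  have h1 := hγ.hasStrictFDerivAt.isLittleO.def (c := ‖T‖ / 4) (by positivity)
  obtain ⟨δ, hδ, h3⟩ := Metric.eventually_nhds_iff.1 h1
  obtain ⟨r, hr, h4⟩ := hF δ hδ
  have key : ∀ a b : ℝ, |a| ≤ r / (4 * ‖T‖) → |b| ≤ r / (4 * ‖T‖) → γ s + (a • T + b • rot T) ∈ F →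
      ∃ u, |u - s| < δ ∧ γ u = γ s + (a • T + b • rot T) := by
    intro a b ha hb hab
    refine h4 _ ⟨hab, ?_⟩
    rw [mem_ball, dist_eq_norm, add_sub_cancel_left]
    refine (norm_add_rot_le a b T).trans_lt ?_
    have : (|a| + |b|) * ‖T‖ ≤ (r / (4 * ‖T‖) + r / (4 * ‖T‖)) * ‖T‖ := by gcongr
    refine this.trans_lt ?_
    field_simp
    norm_num
  have est : ∀ u v a b a' b' : ℝ, |u - s| < δ → |v - s| < δ → γ u = γ s + (a • T + b • rot T) →
      γ v = γ s + (a' • T + b' • rot T) →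
      |a - a' - (u - v)| ≤ |u - v| / 4 ∧ |b - b'| ≤ |u - v| / 4 := by
    intro u v a b a' b' hu hv hu' hv'
    have h5 := @h3 (u, v) (max_lt hu hv)
    have e : γ u - γ v - (ContinuousLinearMap.toSpanSingleton ℝ T) (u - v) =
        (a - a' - (u - v)) • T + (b - b') • rot T := by
      rw [hu', hv', ContinuousLinearMap.toSpanSingleton_apply]
      module
    simp only [e, Real.norm_eq_abs] at h5
    have h6 := abs_mul_norm_le_norm_add_rot (a - a' - (u - v)) (b - b') T
    constructor
    · refine le_of_mul_le_mul_right ?_ hTp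
      linarith [h6.1]
    · refine le_of_mul_le_mul_right ?_ hTp
      linarith [h6.2]
  refine ⟨r / (4 * ‖T‖), by positivity, fun a b ha hb hab => ?_,
    fun a b b' ha hb hb' hab hab' => ?_⟩
  · obtain ⟨u, hu, hu'⟩ := key a b ha hb hab
    have := est u s a b 0 0 hu (by simpa using hδ) hu' (by simp)
    rw [sub_zero, sub_zero] at this
    have h7 : |u - s| ≤ |a - (u - s)| + |a| := by
      rw [← abs_neg (a - (u - s))]
      refine le_trans (le_of_eq ?_) (abs_add_le _ _)
      congr 1
      ring
    have h8 := abs_nonneg a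
    linarith [this.1, this.2]
  · obtain ⟨u, hu, hu'⟩ := key a b ha hb hab
    obtain ⟨v, hv, hv'⟩ := key a b' ha hb' hab'
    have := est u v a b a b' hu hv hu' hv'
    rw [sub_self, zero_sub, abs_neg] at this
    have h0 : |b - b'| ≤ 0 := by linarith [this.1, this.2, abs_nonneg (u - v)]
    exact sub_eq_zero.1 (abs_nonpos_iff.1 h0)

lemma forall_mem_of_uIcc_notMem {V F : Set (Eu 2)} (hV : IsOpen V) (hVF : frontier V ⊆ F)
    {g : ℝ → Eu 2} (hg : Continuous g) {b b' : ℝ} (hb : g b ∈ V)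
    (hF : ∀ c ∈ Set.uIcc b b', g c ∉ F) : ∀ c ∈ Set.uIcc b b', g c ∈ V := by
  intro c hc
  refine (Set.ordConnected_uIcc.isPreconnected.image g
    hg.continuousOn).subset_of_disjoint_frontier hV ?_
    ⟨g b, Set.mem_image_of_mem _ Set.left_mem_uIcc, hb⟩ (Set.mem_image_of_mem _ hc)
  rw [Set.disjoint_left]
  rintro _ ⟨d, hd, rfl⟩ h
  exact hF d hd (hVF h)

/-- The two consequences of the local graph property at a boundary point `p` of a region `V`: on
at least one side the normal segment stays in `V`, and the boundary set near `p` is contained in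
the boundary of `V`. -/
lemma exists_box {V F : Set (Eu 2)} (hV : IsOpen V) (hVF : frontier V ⊆ F) (hd : Disjoint V F)
    {p T : Eu 2} (hT : T ≠ 0) (hp : p ∈ frontier V) {η₀ : ℝ} (hη₀ : 0 < η₀)
    (h1 : ∀ a b : ℝ, |a| ≤ η₀ → |b| ≤ η₀ → p + (a • T + b • rot T) ∈ F → |b| ≤ |a|)
    (h2 : ∀ a b b' : ℝ, |a| ≤ η₀ → |b| ≤ η₀ → |b'| ≤ η₀ → p + (a • T + b • rot T) ∈ F →
        p + (a • T + b' • rot T) ∈ F → b = b') :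
    (∀ η : ℝ, 0 < η → η ≤ η₀ → p + η • rot T ∈ V ∨ p + (-η) • rot T ∈ V) ∧
    ∀ᶠ x in nhds p, x ∈ F → x ∈ frontier V := by
  have hTp : 0 < ‖T‖ := norm_pos_iff.2 hT
  have cv : ∀ a : ℝ, Continuous fun c : ℝ => p + (a • T + c • rot T) := fun a => by fun_prop
  have ch : ∀ b : ℝ, Continuous fun c : ℝ => p + (c • T + b • rot T) := fun b => by fun_prop
  -- horizontal segments at height `±η`
  have hor : ∀ η, 0 < η → η ≤ η₀ → ∀ b : ℝ, |b| = η → ∀ a a' : ℝ, |a| < η → |a'| < η →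
      p + (a • T + b • rot T) ∈ V → p + (a' • T + b • rot T) ∈ V := by
    intro η hη hη' b hb a a' ha ha' hm
    refine forall_mem_of_uIcc_notMem hV hVF (ch b) hm (fun c hc hcF => ?_) a' Set.right_mem_uIcc
    have hc' : |c| < η := by
      rw [abs_lt] at ha ha' ⊢
      rcases Set.mem_uIcc.1 hc with h | h <;> constructor <;> linarith [h.1, h.2, ha.1, ha.2]
    have := h1 c b (hc'.le.trans hη') (hb.le.trans hη') hcF
    linarith
  have side : ∀ η, 0 < η → η ≤ η₀ → ∃ b : ℝ, |b| = η ∧ p + ((0 : ℝ) • T + b • rot T) ∈ V := by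
    intro η hη hη'
    obtain ⟨v, hv, hpv⟩ := Metric.mem_closure_iff.1 (frontier_subset_closure hp) (η * ‖T‖)
      (by positivity)
    obtain ⟨a, b, hab⟩ := exists_eq_add_rot hT (v - p)
    have hv' : v = p + (a • T + b • rot T) := by rw [← hab]; abel
    have hsmall : |a| < η ∧ |b| < η := by
      have h := abs_mul_norm_le_norm_add_rot a b T
      rw [← hab, ← dist_eq_norm, dist_comm] at h
      exact ⟨lt_of_mul_lt_mul_right (h.1.trans_lt hpv) hTp.le,
        lt_of_mul_lt_mul_right (h.2.trans_lt hpv) hTp.le⟩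
    obtain ⟨hbl, hbr⟩ := abs_lt.1 hsmall.2
    rw [hv'] at hv
    by_cases hup : ∀ c ∈ Set.uIcc b η, p + (a • T + c • rot T) ∉ F
    · refine ⟨η, abs_of_pos hη, ?_⟩
      refine hor η hη hη' η (abs_of_pos hη) a 0 hsmall.1 (by simpa using hη) ?_
      exact forall_mem_of_uIcc_notMem hV hVF (cv a) hv hup η Set.right_mem_uIcc
    by_cases hdn : ∀ c ∈ Set.uIcc b (-η), p + (a • T + c • rot T) ∉ F
    · refine ⟨-η, by rw [abs_neg, abs_of_pos hη], ?_⟩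
      refine hor η hη hη' (-η) (by rw [abs_neg, abs_of_pos hη]) a 0 hsmall.1 (by simpa using hη) ?_
      exact forall_mem_of_uIcc_notMem hV hVF (cv a) hv hdn (-η) Set.right_mem_uIcc
    push Not at hup hdn
    obtain ⟨c, hc, hcF⟩ := hup
    obtain ⟨d, hd', hdF⟩ := hdn
    rw [Set.uIcc_of_le hbr.le] at hc
    rw [Set.uIcc_of_ge hbl.le] at hd'
    have := h2 a c d (hsmall.1.le.trans hη')
      (abs_le.2 ⟨by linarith [hc.1], by linarith [hc.2]⟩)
      (abs_le.2 ⟨by linarith [hd'.1], by linarith [hd'.2]⟩) hcF hdF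
    have hcb : c = b := by linarith [hc.1, hd'.2]
    rw [hcb] at hcF
    exact (Set.disjoint_left.1 hd hv hcF).elim
  refine ⟨fun η hη hη' => ?_, ?_⟩
  · obtain ⟨b, hb, hbV⟩ := side η hη hη'
    rw [zero_smul, zero_add] at hbV
    rcases (abs_eq hη.le).1 hb with rfl | rfl
    · exact Or.inl hbV
    · exact Or.inr hbV
  · obtain ⟨b₀, hb₀, hb₀V⟩ := side η₀ hη₀ le_rfl
    filter_upwards [ball_mem_nhds p (show 0 < η₀ * ‖T‖ by positivity)] with x hx hxF
    obtain ⟨a, b, hab⟩ := exists_eq_add_rot hT (x - p)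
    have hx' : x = p + (a • T + b • rot T) := by rw [← hab]; abel
    have hsmall : |a| < η₀ ∧ |b| < η₀ := by
      have h := abs_mul_norm_le_norm_add_rot a b T
      rw [← hab, ← dist_eq_norm] at h
      exact ⟨lt_of_mul_lt_mul_right (h.1.trans_lt hx) hTp.le,
        lt_of_mul_lt_mul_right (h.2.trans_lt hx) hTp.le⟩
    have htop := hor η₀ hη₀ le_rfl b₀ hb₀ 0 a (by simpa using hη₀) hsmall.1 hb₀V
    rw [hV.frontier_eq]
    refine ⟨?_, fun h => Set.disjoint_left.1 hd h hxF⟩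
    have hlim : Tendsto (fun l : ℝ => p + (a • T + (b + l * (b₀ - b)) • rot T))
        (nhdsWithin 0 (Set.Ioo 0 1)) (nhds x) := by
      have : Continuous fun l : ℝ => p + (a • T + (b + l * (b₀ - b)) • rot T) := by fun_prop
      have h := this.tendsto 0
      rw [zero_mul, add_zero, ← hx'] at h
      exact h.mono_left nhdsWithin_le_nhds
    have hnb : (nhdsWithin (0 : ℝ) (Set.Ioo 0 1)).NeBot := by
      rw [← mem_closure_iff_nhdsWithin_neBot, closure_Ioo zero_ne_one]
      exact ⟨le_rfl, zero_le_one⟩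
    refine mem_closure_of_tendsto hlim (eventually_nhdsWithin_of_forall fun l hl => ?_)
    have hne : b₀ ≠ b := by
      rintro rfl
      exact absurd hb₀ hsmall.2.ne
    refine forall_mem_of_uIcc_notMem hV hVF (cv a) htop (fun c hc hcF => ?_) _ Set.right_mem_uIcc
    rw [hx'] at hxF
    have hcI : |c| ≤ η₀ ∧ c ≠ b := by
      have hb₀' := abs_le.1 hb₀.le
      have hb' := abs_lt.1 hsmall.2
      obtain ⟨hl0, hl1⟩ := hl
      rw [abs_le]
      rcases lt_or_gt_of_ne hne with h | h
      · have e : b₀ ≤ b + l * (b₀ - b) := by nlinarith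
        have e' : b + l * (b₀ - b) < b := by nlinarith
        rw [Set.uIcc_of_le e] at hc
        exact ⟨⟨by linarith [hc.1], by linarith [hc.2]⟩, by linarith [hc.2] |> ne_of_lt⟩
      · have e : b + l * (b₀ - b) ≤ b₀ := by nlinarith
        have e' : b < b + l * (b₀ - b) := by nlinarith
        rw [Set.uIcc_of_ge e] at hc
        exact ⟨⟨by linarith [hc.1], by linarith [hc.2]⟩, by linarith [hc.1] |> ne_of_gt⟩
    exact hcI.2 (h2 a c b hsmall.1.le hcI.1 hsmall.2.le hcF hxF)

/-! ### Boundary curves, normals and foot points -/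

lemma IsC2JordanCurve.hasDerivAt {γ : ℝ → Eu 2} (h : IsC2JordanCurve γ) (s : ℝ) :
    HasDerivAt γ (deriv γ s) s :=
  ((h.1.differentiable (by norm_num)) s).hasDerivAt

lemma IsC2JordanCurve.contDiff_deriv {γ : ℝ → Eu 2} (h : IsC2JordanCurve γ) :
    ContDiff ℝ 1 (deriv γ) :=
  (contDiff_succ_iff_deriv (n := 1).1 (by simpa [one_add_one_eq_two] using h.1)).2.2

lemma IsC2JordanCurve.hasStrictDerivAt {γ : ℝ → Eu 2} (h : IsC2JordanCurve γ) (s : ℝ) :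
    HasStrictDerivAt γ (deriv γ s) s :=
  (h.1.contDiffAt (x := s)).hasStrictDerivAt (by norm_num)

lemma IsC2JordanCurve.exists_eq_add_int {γ : ℝ → Eu 2} (h : IsC2JordanCurve γ) {u v : ℝ}
    (huv : γ u = γ v) : ∃ k : ℤ, u = v + k := by
  have hf : ∀ u : ℝ, γ (Int.fract u) = γ u := fun u => by
    rw [← Int.self_sub_floor, ← mul_one (⌊u⌋ : ℝ)]
    exact h.2.1.sub_int_mul_eq ⌊u⌋
  have := h.2.2.1 _ ⟨Int.fract_nonneg u, Int.fract_lt_one u⟩ _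
    ⟨Int.fract_nonneg v, Int.fract_lt_one v⟩ (by rw [hf, hf, huv])
  obtain ⟨k, hk⟩ := Int.fract_eq_fract.1 this
  exact ⟨k, by linarith⟩

lemma IsC2JordanCurve.isCompact_range {γ : ℝ → Eu 2} (h : IsC2JordanCurve γ) :
    IsCompact (Set.range γ) :=
  h.2.1.compact_of_continuous one_ne_zero h.1.continuous

lemma IsC2JordanCurve.exists_mem_Ico {γ : ℝ → Eu 2} (h : IsC2JordanCurve γ) {x : Eu 2}
    (hx : x ∈ Set.range γ) : ∃ s ∈ Set.Ico (0 : ℝ) 1, γ s = x := by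
  obtain ⟨u, rfl⟩ := hx
  refine ⟨Int.fract u, ⟨Int.fract_nonneg u, Int.fract_lt_one u⟩, ?_⟩
  rw [← Int.self_sub_floor, ← mul_one (⌊u⌋ : ℝ)]
  exact h.2.1.sub_int_mul_eq ⌊u⌋

/-- Near a point of one of finitely many disjoint Jordan curves, the union of the curves consists
of a short arc of that curve. -/
lemma exists_local_param {N : ℕ} {γ : Fin N → ℝ → Eu 2} (hγ : ∀ i, IsC2JordanCurve (γ i))
    (hd : ∀ i j, i ≠ j → Disjoint (Set.range (γ i)) (Set.range (γ j))) (i : Fin N) (s : ℝ)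
    {δ : ℝ} (hδ : 0 < δ) :
    ∃ r > 0, ∀ x ∈ (⋃ j, Set.range (γ j)) ∩ ball (γ i s) r, ∃ u, |u - s| < δ ∧ γ i u = x := by
  set K : Set (Eu 2) := (⋃ j ∈ {j | j ≠ i}, Set.range (γ j)) ∪
    γ i '' (Set.Icc (s - 1 / 2) (s + 1 / 2) \ ball s δ) with hK
  have hKc : IsClosed K := by
    refine IsClosed.union ?_ ?_
    · exact (Set.toFinite _).isClosed_biUnion fun j _ => (hγ j).isCompact_range.isClosed
    · exact ((isCompact_Icc.diff isOpen_ball).image (hγ i).1.continuous).isClosed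
  have hp : γ i s ∉ K := by
    rintro (h | ⟨u, ⟨hu, hu'⟩, hus⟩)
    · simp only [Set.mem_iUnion] at h
      obtain ⟨j, hj, hj'⟩ := h
      exact Set.disjoint_left.1 (hd j i hj) hj' ⟨s, rfl⟩
    · obtain ⟨k, hk⟩ := (hγ i).exists_eq_add_int hus
      have hk0 : k = 0 := by
        have h1 : (k : ℝ) < 1 := by linarith [hu.2]
        have h2 : (-1 : ℝ) < k := by linarith [hu.1]
        have h1' : k < 1 := by exact_mod_cast h1
        have h2' : -1 < k := by exact_mod_cast h2
        omega
      rw [hk0, Int.cast_zero, add_zero] at hk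
      exact hu' (hk ▸ mem_ball_self hδ)
  obtain ⟨r, hr, hrK⟩ := Metric.isOpen_iff.1 hKc.isOpen_compl _ hp
  refine ⟨r, hr, ?_⟩
  rintro x ⟨hx, hxr⟩
  have hxK := hrK hxr
  obtain ⟨j, u, rfl⟩ := Set.mem_iUnion.1 hx
  have hji : j = i := by
    by_contra h
    exact hxK (Or.inl (Set.mem_biUnion (show j ∈ {j | j ≠ i} from h) ⟨u, rfl⟩))
  subst hji
  have hper : γ j (u - round (u - s)) = γ j u := by
    simpa using (hγ j).2.1.sub_int_mul_eq (x := u) (round (u - s))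
  refine ⟨u - round (u - s), ?_, hper⟩
  by_contra! hlt
  refine hxK (Or.inr ⟨u - round (u - s), ⟨?_, ?_⟩, hper⟩)
  · have := abs_le.1 (abs_sub_round (u - s))
    exact ⟨by linarith [this.1], by linarith [this.2]⟩
  · rw [mem_ball, Real.dist_eq]
    exact not_lt.2 hlt

/-- An exterior region whose boundary is contained in a disjoint union of `C²` Jordan curves. -/
structure IsBoundedByCurves (V : Set (Eu 2)) {N : ℕ} (γ : Fin N → ℝ → Eu 2) : Prop where
  exterior : IsExteriorRegion V
  nonempty_compl : Vᶜ.Nonempty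
  curve : ∀ i, IsC2JordanCurve (γ i)
  disjoint_curves : ∀ i j, i ≠ j → Disjoint (Set.range (γ i)) (Set.range (γ j))
  frontier_subset : frontier V ⊆ ⋃ i, Set.range (γ i)
  disjoint : Disjoint V (⋃ i, Set.range (γ i))

namespace IsBoundedByCurves

variable {V : Set (Eu 2)} {N : ℕ} {γ : Fin N → ℝ → Eu 2}

lemma nonempty_frontier (h : IsBoundedByCurves V γ) : (frontier V).Nonempty :=
  h.exterior.nonempty_frontier h.nonempty_compl

lemma local_structure (h : IsBoundedByCurves V γ) {i : Fin N} {s : ℝ} (hs : γ i s ∈ frontier V) :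
    (∃ η₀ > 0, ∀ η : ℝ, 0 < η → η ≤ η₀ → γ i s + η • rot (deriv (γ i) s) ∈ V ∨
      γ i s + (-η) • rot (deriv (γ i) s) ∈ V) ∧ ∀ᶠ u in nhds s, γ i u ∈ frontier V := by
  have hT := (h.curve i).2.2.2 s
  obtain ⟨η₀, hη₀, h1, h2⟩ := exists_local_graph hT ((h.curve i).hasStrictDerivAt s)
    (F := ⋃ j, Set.range (γ j)) fun δ hδ => exists_local_param h.curve h.disjoint_curves i s hδ
  obtain ⟨h3, h4⟩ := exists_box h.exterior.1 h.frontier_subset h.disjoint hT hs hη₀ h1 h2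
  refine ⟨⟨η₀, hη₀, h3⟩, ?_⟩
  filter_upwards [(h.curve i).1.continuous.continuousAt.eventually h4] with u hu
  exact hu (Set.mem_iUnion_of_mem i ⟨u, rfl⟩)

/-- The segment to a nearest boundary point is orthogonal to the boundary. -/
lemma inner_deriv_eq_zero (h : IsBoundedByCurves V γ) {i : Fin N} {s : ℝ} {x : Eu 2}
    (hs : γ i s ∈ frontier V) (hx : dist x (γ i s) = infDist x (frontier V)) :
    ⟪x - γ i s, deriv (γ i) s⟫ = 0 := by
  have hmin : IsLocalMin (fun u => ‖x - γ i u‖ ^ 2) s := by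
    filter_upwards [(h.local_structure hs).2] with u hu
    rw [← dist_eq_norm, ← dist_eq_norm, hx]
    have := infDist_le_dist_of_mem (x := x) hu
    gcongr
    exact infDist_nonneg
  have hd := (((h.curve i).hasDerivAt s).const_sub x).norm_sq
  have := hmin.hasDerivAt_eq_zero hd
  rw [inner_neg_right] at this
  linarith

end IsBoundedByCurves

/-- The unit normal of a plane curve. -/
def unitNormal (γ : ℝ → Eu 2) (s : ℝ) : Eu 2 := ‖deriv γ s‖⁻¹ • rot (deriv γ s)

lemma IsC2JordanCurve.norm_unitNormal {γ : ℝ → Eu 2} (h : IsC2JordanCurve γ) (s : ℝ) :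
    ‖unitNormal γ s‖ = 1 := by
  have := norm_ne_zero_iff.2 (h.2.2.2 s)
  rw [unitNormal, norm_smul, norm_rot, norm_inv, norm_norm, inv_mul_cancel₀ this]

lemma inner_deriv_unitNormal (γ : ℝ → Eu 2) (s : ℝ) : ⟪deriv γ s, unitNormal γ s⟫ = 0 := by
  rw [unitNormal, inner_smul_right, inner_rot_right, mul_zero]

lemma IsC2JordanCurve.contDiff_unitNormal {γ : ℝ → Eu 2} (h : IsC2JordanCurve γ) :
    ContDiff ℝ 1 (unitNormal γ) := by
  have h1 := h.contDiff_deriv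
  exact ((h1.norm ℝ h.2.2.2).inv fun s => norm_ne_zero_iff.2 (h.2.2.2 s)).smul
    (rot.contDiff.comp h1)

/-- The sign associated with a side of a curve. -/
def sideSign (b : Bool) : ℝ := if b then 1 else -1

lemma abs_sideSign (b : Bool) : |sideSign b| = 1 := by
  cases b <;> simp [sideSign]

/-- The map sending `(s, τ)` to the point at distance `τ` from `γ s` along the normal on the side
`b`. -/
def normalMap (γ : ℝ → Eu 2) (b : Bool) (q : ℝ × ℝ) : Eu 2 :=
  γ q.1 + q.2 • (sideSign b • unitNormal γ q.1)

/-- The parameters of the points outside `closure V` in terms of their feet on the boundary. -/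
def footSet (V : Set (Eu 2)) (γ : ℝ → Eu 2) (b : Bool) : Set (ℝ × ℝ) :=
  {q | q.1 ∈ Set.Ico (0 : ℝ) 1 ∧ 0 < q.2 ∧ γ q.1 ∈ frontier V ∧ normalMap γ b q ∉ closure V ∧
    infDist (normalMap γ b q) (frontier V) = q.2}

lemma IsC2JordanCurve.continuous_normalMap {γ : ℝ → Eu 2} (h : IsC2JordanCurve γ) (b : Bool) :
    Continuous (normalMap γ b) := by
  have h1 := h.1.continuous
  have h2 := h.contDiff_unitNormal.continuous
  unfold normalMap
  fun_prop

lemma IsC2JordanCurve.measurableSet_footSet {γ : ℝ → Eu 2} (h : IsC2JordanCurve γ)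
    (V : Set (Eu 2)) (b : Bool) : MeasurableSet (footSet V γ b) := by
  have hm := (h.continuous_normalMap b).measurable
  refine (measurable_fst measurableSet_Ico).inter ((measurableSet_lt measurable_const
    measurable_snd).inter (((h.1.continuous.measurable.comp measurable_fst)
      isClosed_frontier.measurableSet).inter ((hm isClosed_closure.measurableSet).compl.inter ?_)))
  exact measurableSet_eq_fun ((continuous_infDist_pt _).measurable.comp hm) measurable_snd

lemma IsC2JordanCurve.dist_normalMap {γ : ℝ → Eu 2} (h : IsC2JordanCurve γ) (b : Bool)
    (s τ τ' : ℝ) :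
    dist (normalMap γ b (s, τ)) (normalMap γ b (s, τ')) = |τ - τ'| := by
  rw [dist_eq_norm, normalMap, normalMap, add_sub_add_left_eq_sub, ← sub_smul, norm_smul,
    norm_smul, h.norm_unitNormal, Real.norm_eq_abs, Real.norm_eq_abs, abs_sideSign, mul_one,
    mul_one]

lemma normalMap_zero (γ : ℝ → Eu 2) (b : Bool) (s : ℝ) : normalMap γ b (s, 0) = γ s := by
  simp [normalMap]

namespace IsBoundedByCurves

variable {V : Set (Eu 2)} {N : ℕ} {γ : Fin N → ℝ → Eu 2}

lemma exists_footSet (h : IsBoundedByCurves V γ) {x : Eu 2} (hx : x ∉ closure V) :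
    ∃ i b, ∃ q ∈ footSet V (γ i) b, q.2 = infDist x (frontier V) ∧ normalMap (γ i) b q = x := by
  obtain ⟨p, hp, hxp⟩ := isClosed_frontier.exists_infDist_eq_dist h.nonempty_frontier x
  obtain ⟨i, hi⟩ := Set.mem_iUnion.1 (h.frontier_subset hp)
  obtain ⟨s, hs, rfl⟩ := (h.curve i).exists_mem_Ico hi
  have hpos := h.exterior.infDist_frontier_pos hx
  have hin := h.inner_deriv_eq_zero hp hxp.symm
  have hT := (h.curve i).2.2.2 s
  obtain ⟨a, c, hac⟩ := exists_eq_add_rot hT (x - γ i s)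
  have ha : a = 0 := by
    rw [hac, inner_add_left, inner_smul_left, inner_smul_left, real_inner_comm _ (rot _),
      inner_rot_right, mul_zero, add_zero, real_inner_self_eq_norm_sq] at hin
    simpa [hT] using hin
  have hn0 := norm_ne_zero_iff.2 hT
  have hxs : x - γ i s = (c * ‖deriv (γ i) s‖) • unitNormal (γ i) s := by
    rw [hac, ha, zero_smul, zero_add, unitNormal, smul_smul, mul_assoc, mul_inv_cancel₀ hn0,
      mul_one]
  set d := c * ‖deriv (γ i) s‖
  have hd : |d| = infDist x (frontier V) := by
    rw [hxp, dist_eq_norm, hxs, norm_smul, (h.curve i).norm_unitNormal, mul_one, Real.norm_eq_abs]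
  have key : ∀ b, d = |d| * sideSign b → normalMap (γ i) b (s, |d|) = x := by
    intro b hb
    simp only [normalMap]
    rw [smul_smul, ← hb, ← hxs]
    abel
  have fin : ∀ b, d = |d| * sideSign b →
      ∃ i b, ∃ q ∈ footSet V (γ i) b, q.2 = infDist x (frontier V) ∧ normalMap (γ i) b q = x := by
    intro b hb
    refine ⟨i, b, (s, |d|), ⟨hs, by simpa [hd] using hpos, hp, ?_, ?_⟩, hd, key b hb⟩
    · rwa [key b hb]
    · rw [key b hb, hd]
  rcases le_total 0 d with h0 | h0
  · exact fin true (by simp [sideSign, abs_of_nonneg h0])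
  · exact fin false (by simp [sideSign, abs_of_nonpos h0])

lemma footSet_star (h : IsBoundedByCurves V γ) {i : Fin N} {b : Bool} {s τ τ' : ℝ}
    (hq : (s, τ) ∈ footSet V (γ i) b) (h0 : 0 < τ') (hτ : τ' ≤ τ) :
    (s, τ') ∈ footSet V (γ i) b := by
  obtain ⟨h1, h2, h3, h4, h5⟩ := hq
  dsimp only at h1 h2 h3 h5
  have hdist := (h.curve i).dist_normalMap b s τ τ'
  rw [abs_of_nonneg (sub_nonneg.2 hτ)] at hdist
  refine ⟨h1, h0, h3, ?_, le_antisymm ?_ ?_⟩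
  · refine ball_infDist_frontier_subset h4 ?_
    rw [mem_ball, dist_comm, hdist, h5]
    linarith
  · refine (infDist_le_dist_of_mem h3).trans (le_of_eq ?_)
    have := (h.curve i).dist_normalMap b s τ' 0
    rwa [normalMap_zero, sub_zero, abs_of_pos h0] at this
  · have := infDist_le_infDist_add_dist (x := normalMap (γ i) b (s, τ))
      (y := normalMap (γ i) b (s, τ')) (s := frontier V)
    rw [h5, hdist] at this
    linarith

/-- The domain lies locally on one side of its boundary. -/
lemma disjoint_footSet (h : IsBoundedByCurves V γ) (i : Fin N) :
    Disjoint (footSet V (γ i) true) (footSet V (γ i) false) := by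
  rw [Set.disjoint_left]
  rintro ⟨s, τ⟩ ha hb
  obtain ⟨⟨η₀, hη₀, hη⟩, -⟩ := h.local_structure ha.2.2.1
  have hn := norm_pos_iff.2 ((h.curve i).2.2.2 s)
  have hτ : 0 < τ := ha.2.1
  set η := min η₀ (τ / ‖deriv (γ i) s‖)
  have hη0 : 0 < η := lt_min hη₀ (by positivity)
  have hη1 : η * ‖deriv (γ i) s‖ ≤ τ := by
    rw [← le_div_iff₀ hn]
    exact min_le_right _ _
  have key : ∀ b, (s, τ) ∈ footSet V (γ i) b →
      γ i s + (sideSign b * η) • rot (deriv (γ i) s) ∉ V := by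
    intro b hb hV
    have h1 := (h.footSet_star hb (mul_pos hη0 hn) hη1).2.2.2.1
    refine h1 (subset_closure ?_)
    convert hV using 1
    simp only [normalMap]
    rw [unitNormal, smul_smul, smul_smul]
    congr 2
    field_simp
  rcases hη η hη0 (min_le_left _ _) with h1 | h1
  · exact key true ha (by simpa [sideSign] using h1)
  · exact key false hb (by simpa [sideSign] using h1)

/-- A point of the normal segment strictly before its end has a unique foot. -/
lemma eq_foot (h : IsBoundedByCurves V γ) {i : Fin N} {b : Bool} {s τ τ' : ℝ}
    (hq : (s, τ) ∈ footSet V (γ i) b) (h0 : 0 < τ') (hτ : τ' < τ) {p : Eu 2}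
    (hp : p ∈ frontier V) (hpd : dist (normalMap (γ i) b (s, τ')) p = τ') : p = γ i s := by
  have hle : τ ≤ dist (normalMap (γ i) b (s, τ)) p := by
    have := infDist_le_dist_of_mem (x := normalMap (γ i) b (s, τ)) hp
    rwa [hq.2.2.2.2] at this
  set n := sideSign b • unitNormal (γ i) s with hn
  have hn1 : ‖n‖ = 1 := by
    rw [hn, norm_smul, (h.curve i).norm_unitNormal, Real.norm_eq_abs, abs_sideSign, mul_one]
  set y := normalMap (γ i) b (s, τ') with hy
  have hy' : y = γ i s + τ' • n := rfl
  have hx : normalMap (γ i) b (s, τ) - p = (τ - τ') • n + (y - p) := by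
    rw [hy', show normalMap (γ i) b (s, τ) = γ i s + τ • n from rfl]
    module
  rw [dist_eq_norm] at hle hpd
  have h1 : τ ^ 2 ≤ (τ - τ') ^ 2 + 2 * ((τ - τ') * ⟪n, y - p⟫) + τ' ^ 2 := by
    have h2 : τ ^ 2 ≤ ‖normalMap (γ i) b (s, τ) - p‖ ^ 2 := by
      have := h0.trans hτ
      gcongr
    rw [hx, norm_add_sq_real, norm_smul, hn1, hpd, inner_smul_left, mul_one, Real.norm_eq_abs,
      sq_abs] at h2
    simpa using h2
  have h3 : τ' ≤ ⟪n, y - p⟫ := by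
    have h4 : 0 < τ - τ' := sub_pos.2 hτ
    by_contra! hlt
    nlinarith
  have h5 : ⟪n, y - p⟫ ≤ ‖n‖ * ‖y - p‖ := real_inner_le_norm _ _
  rw [hn1, hpd, one_mul] at h5
  have h6 : ⟪n, y - p⟫ = ‖n‖ * ‖y - p‖ := by rw [hn1, hpd, one_mul]; linarith
  have h7 := inner_eq_norm_mul_iff_real.1 h6
  rw [hn1, hpd, one_smul, hy'] at h7
  have : γ i s - p = (γ i s + τ' • n - p) - τ' • n := by abel
  rw [← h7, sub_self, sub_eq_zero] at this
  exact this.symm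

/-- The normal parametrizations are jointly injective away from the ends of the normal segments. -/
lemma normalMap_inj (h : IsBoundedByCurves V γ) {i j : Fin N} {b c : Bool} {s τ τ' u ρ ρ' : ℝ}
    (hq : (s, τ) ∈ footSet V (γ i) b) (hτ0 : 0 < τ') (hτ : τ' < τ)
    (hr : (u, ρ) ∈ footSet V (γ j) c) (hρ0 : 0 < ρ') (hρ : ρ' < ρ)
    (heq : normalMap (γ i) b (s, τ') = normalMap (γ j) c (u, ρ')) :
    (i, b) = (j, c) ∧ (s, τ') = (u, ρ') := by
  have hq' := h.footSet_star hq hτ0 hτ.le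
  have hr' := h.footSet_star hr hρ0 hρ.le
  have e1 : τ' = ρ' := by
    have h1 := hq'.2.2.2.2
    have h2 := hr'.2.2.2.2
    rw [heq] at h1
    exact h1.symm.trans h2
  subst e1
  have e2 : γ j u = γ i s := by
    refine h.eq_foot hq hτ0 hτ hr.2.2.1 ?_
    have := (h.curve j).dist_normalMap c u τ' 0
    rwa [normalMap_zero, sub_zero, abs_of_pos hτ0, ← heq] at this
  have hij : i = j := by
    by_contra hne
    exact Set.disjoint_left.1 (h.disjoint_curves i j hne) ⟨s, rfl⟩ ⟨u, e2⟩
  subst hij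
  have hus : s = u := (h.curve i).2.2.1 _ hq.1 _ hr.1 e2.symm
  subst hus
  refine ⟨?_, rfl⟩
  have hd := h.disjoint_footSet i
  have hbc : b = c := by
    cases b <;> cases c <;> first | rfl | skip
    · exact (Set.disjoint_left.1 hd hr' hq').elim
    · exact (Set.disjoint_left.1 hd hq' hr').elim
  rw [hbc]

end IsBoundedByCurves

/-- The derivative of `normalMap γ b` in its first argument. -/
def normalDeriv (γ : ℝ → Eu 2) (b : Bool) (q : ℝ × ℝ) : Eu 2 :=
  deriv γ q.1 + q.2 • (sideSign b • deriv (unitNormal γ) q.1)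

namespace IsC2JordanCurve

variable {γ : ℝ → Eu 2}

lemma hasDerivAt_unitNormal (h : IsC2JordanCurve γ) (s : ℝ) :
    HasDerivAt (unitNormal γ) (deriv (unitNormal γ) s) s :=
  (h.contDiff_unitNormal.differentiable (by norm_num) s).hasDerivAt

lemma hasDerivAt_normalMap (h : IsC2JordanCurve γ) (b : Bool) (s t : ℝ) :
    HasDerivAt (fun u => normalMap γ b (u, t)) (normalDeriv γ b (s, t)) s :=
  (h.hasDerivAt s).add (((h.hasDerivAt_unitNormal s).const_smul (sideSign b)).const_smul t)

lemma continuous_normalDeriv (h : IsC2JordanCurve γ) (b : Bool) :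
    Continuous (normalDeriv γ b) := by
  have h1 := h.contDiff_deriv.continuous
  have h2 := h.contDiff_unitNormal.continuous_deriv (by norm_num)
  unfold normalDeriv
  fun_prop

lemma inner_normalDeriv (h : IsC2JordanCurve γ) (b : Bool) (q : ℝ × ℝ) :
    ⟪normalDeriv γ b q, unitNormal γ q.1⟫ = 0 := by
  have h1 : ⟪deriv (unitNormal γ) q.1, unitNormal γ q.1⟫ = 0 := by
    have hd := (h.hasDerivAt_unitNormal q.1).norm_sq
    have hc : (fun s => ‖unitNormal γ s‖ ^ 2) = fun _ => (1 : ℝ) := by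
      ext s; rw [h.norm_unitNormal, one_pow]
    rw [hc] at hd
    have := hd.unique (hasDerivAt_const q.1 (1 : ℝ))
    rw [real_inner_comm] at this
    linarith
  rw [normalDeriv, inner_add_left, inner_deriv_unitNormal, inner_smul_left, inner_smul_left, h1]
  simp

end IsC2JordanCurve

/-- The identification of the Euclidean plane with `ℝ × ℝ`. -/
def planeEquiv : Eu 2 ≃ᵐ ℝ × ℝ :=
  (MeasurableEquiv.toLp 2 (Fin 2 → ℝ)).symm.trans (MeasurableEquiv.finTwoArrow)

lemma volume_preserving_planeEquiv : MeasurePreserving planeEquiv :=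
  (EuclideanSpace.volume_preserving_symm_measurableEquiv_toLp (Fin 2)).trans
    (volume_preserving_finTwoArrow ℝ)

lemma volume_planeEquiv_image (S : Set (Eu 2)) : volume (planeEquiv '' S) = volume S := by
  rw [MeasurableEquiv.image_eq_preimage_symm]
  exact volume_preserving_planeEquiv.symm.measure_preimage_equiv S

lemma abs_det_of_inner_eq_zero {w n : Eu 2} (hn : ‖n‖ = 1) (hw : ⟪w, n⟫ = 0) :
    |w 0 * n 1 - n 0 * w 1| = ‖w‖ := by
  rw [← abs_norm w, ← sq_eq_sq_iff_abs_eq_abs]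
  have h1 := EuclideanSpace.real_norm_sq_eq w
  have h2 := EuclideanSpace.real_norm_sq_eq n
  simp only [Fin.sum_univ_two] at h1 h2
  rw [hn] at h2
  have h3 : w 0 * n 0 + w 1 * n 1 = 0 := by
    have : ⟪w, n⟫ = ∑ i, n i * w i := rfl
    rw [this, Fin.sum_univ_two] at hw
    linarith
  rw [h1]
  linear_combination (-(w 0)^2 - (w 1)^2) * h2 - (w 0 * n 0 + w 1 * n 1) * h3

/-- The derivative of `normalMap` in coordinates. -/
def normalMapFDeriv (γ : ℝ → Eu 2) (b : Bool) (q : ℝ × ℝ) : ℝ × ℝ →L[ℝ] ℝ × ℝ :=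
  (Matrix.toLin (.finTwoProd ℝ) (.finTwoProd ℝ)
    !![normalDeriv γ b q 0, (sideSign b • unitNormal γ q.1) 0;
      normalDeriv γ b q 1, (sideSign b • unitNormal γ q.1) 1]).toContinuousLinearMap

namespace IsC2JordanCurve

variable {γ : ℝ → Eu 2}

lemma hasFDerivAt_normalMap (h : IsC2JordanCurve γ) (b : Bool) (q : ℝ × ℝ) :
    HasFDerivAt (fun q => planeEquiv (normalMap γ b q)) (normalMapFDeriv γ b q) q := by
  have h1 : HasFDerivAt (normalMap γ b)
      (((ContinuousLinearMap.fst ℝ ℝ ℝ).smulRight (normalDeriv γ b q)) +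
        (ContinuousLinearMap.snd ℝ ℝ ℝ).smulRight (sideSign b • unitNormal γ q.1)) q := by
    have e1 : HasFDerivAt (fun q : ℝ × ℝ => γ q.1) _ q :=
      (h.hasDerivAt q.1).hasFDerivAt.comp q hasFDerivAt_fst
    have e2 : HasFDerivAt (fun q : ℝ × ℝ => sideSign b • unitNormal γ q.1) _ q :=
      ((h.hasDerivAt_unitNormal q.1).const_smul (sideSign b)).hasFDerivAt.comp q hasFDerivAt_fst
    have e3 := e1.add ((hasFDerivAt_snd (p := q)).smul e2)
    refine e3.congr_fderiv ?_
    ext <;> simp [normalDeriv]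
  have hp : ∀ i, HasFDerivAt (fun q => normalMap γ b q i) _ q := fun i =>
    ((EuclideanSpace.proj i : Eu 2 →L[ℝ] ℝ).hasFDerivAt).comp q h1
  refine ((hp 0).prodMk (hp 1)).congr_fderiv ?_
  rw [normalMapFDeriv, Matrix.toLin_finTwoProd_toContinuousLinearMap]
  ext <;> simp

lemma abs_det_normalMapFDeriv (h : IsC2JordanCurve γ) (b : Bool) (q : ℝ × ℝ) :
    ENNReal.ofReal |(normalMapFDeriv γ b q).det| = ‖normalDeriv γ b q‖ₑ := by
  have hn : ‖sideSign b • unitNormal γ q.1‖ = 1 := by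
    rw [norm_smul, h.norm_unitNormal, Real.norm_eq_abs, abs_sideSign, one_mul]
  have hw : ⟪normalDeriv γ b q, sideSign b • unitNormal γ q.1⟫ = 0 := by
    rw [inner_smul_right, h.inner_normalDeriv, mul_zero]
  rw [← ofReal_norm, ← abs_det_of_inner_eq_zero hn hw, normalMapFDeriv]
  simp only [LinearMap.det_toContinuousLinearMap, LinearMap.det_toLin, Matrix.det_fin_two_of]

lemma volume_normalMap_image_le (h : IsC2JordanCurve γ) (b : Bool) {S : Set (ℝ × ℝ)}
    (hS : MeasurableSet S) : volume (normalMap γ b '' S) ≤ ∫⁻ q in S, ‖normalDeriv γ b q‖ₑ := by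
  rw [← volume_planeEquiv_image, Set.image_image]
  refine (addHaar_image_le_lintegral_abs_det_fderiv volume hS fun q _ =>
    (h.hasFDerivAt_normalMap b q).hasFDerivWithinAt).trans_eq ?_
  simp only [h.abs_det_normalMapFDeriv]

lemma volume_normalMap_image (h : IsC2JordanCurve γ) (b : Bool) {S : Set (ℝ × ℝ)}
    (hS : MeasurableSet S) (hinj : Set.InjOn (normalMap γ b) S) :
    volume (normalMap γ b '' S) = ∫⁻ q in S, ‖normalDeriv γ b q‖ₑ := by
  rw [← volume_planeEquiv_image, Set.image_image]
  rw [← lintegral_abs_det_fderiv_eq_addHaar_image volume hS (fun q _ =>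
    (h.hasFDerivAt_normalMap b q).hasFDerivWithinAt)
      (planeEquiv.injective.comp_injOn hinj)]
  simp only [h.abs_det_normalMapFDeriv]

end IsC2JordanCurve

lemma setLIntegral_prod_fst {f : ℝ → ENNReal} (hf : Measurable f) {A B : Set ℝ} :
    ∫⁻ q in A ×ˢ B, f q.1 = (∫⁻ s in A, f s) * volume B := by
  rw [Measure.volume_eq_prod, ← Measure.prod_restrict, lintegral_prod _ (by fun_prop)]
  simp only [lintegral_const, Measure.restrict_apply_univ]
  rw [lintegral_mul_const _ hf]

/-- The parameters of the points of a curve that lie on the boundary of `V`. -/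
def boundaryParam (V : Set (Eu 2)) (γ : ℝ → Eu 2) : Set ℝ :=
  {s | s ∈ Set.Ico (0 : ℝ) 1 ∧ γ s ∈ frontier V}

lemma IsC2JordanCurve.measurableSet_boundaryParam {γ : ℝ → Eu 2} (h : IsC2JordanCurve γ)
    (V : Set (Eu 2)) : MeasurableSet (boundaryParam V γ) :=
  measurableSet_Ico.inter (h.1.continuous.measurable isClosed_frontier.measurableSet)

lemma boundaryParam_subset (V : Set (Eu 2)) (γ : ℝ → Eu 2) :
    boundaryParam V γ ⊆ Set.Ico 0 1 := fun _ h => h.1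

lemma volume_le_one_of_subset_Ico {B : Set ℝ} (hB : B ⊆ Set.Ico 0 1) : volume B ≤ 1 :=
  (measure_mono hB).trans (by simp)

namespace IsBoundedByCurves

variable {V : Set (Eu 2)} {N : ℕ} {γ : Fin N → ℝ → Eu 2}

lemma hausdorffMeasure_frontier (h : IsBoundedByCurves V γ) :
    μH[1] (frontier V) = ∑ i, ∫⁻ s in boundaryParam V (γ i), ‖deriv (γ i) s‖ₑ := by
  have hinj : ∀ i, Set.InjOn (γ i) (boundaryParam V (γ i)) := fun i s hs t ht hst =>
    (h.curve i).2.2.1 s hs.1 t ht.1 hst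
  have hmeas : ∀ i, ∀ A ⊆ boundaryParam V (γ i), MeasurableSet A → MeasurableSet (γ i '' A) :=
    fun i A hA hAm => hAm.image_of_continuousOn_injOn (h.curve i).1.continuous.continuousOn
      ((hinj i).mono hA)
  have hfr : frontier V = ⋃ i, γ i '' boundaryParam V (γ i) := by
    refine Set.Subset.antisymm (fun x hx => ?_) (Set.iUnion_subset fun i => ?_)
    · obtain ⟨i, hi⟩ := Set.mem_iUnion.1 (h.frontier_subset hx)
      obtain ⟨s, hs, rfl⟩ := (h.curve i).exists_mem_Ico hi
      exact Set.mem_iUnion_of_mem i ⟨s, ⟨hs, hx⟩, rfl⟩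
    · rintro _ ⟨s, hs, rfl⟩
      exact hs.2
  have hm := fun i => (h.curve i).measurableSet_boundaryParam V
  rw [hfr, measure_iUnion _ fun i => hmeas i _ subset_rfl (hm i), tsum_fintype]
  · refine Finset.sum_congr rfl fun i _ => le_antisymm ?_ ?_
    · exact hausdorffMeasure_image_le_lintegral (h.curve i).hasDerivAt
        (h.curve i).contDiff_deriv.continuous (hm i) (boundaryParam_subset _ _)
    · exact lintegral_le_hausdorffMeasure_image (h.curve i).hasDerivAt
        (h.curve i).contDiff_deriv.continuous (hm i) (boundaryParam_subset _ _) (hinj i) (hmeas i)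
  · intro i j hij
    exact (h.disjoint_curves i j hij).mono (Set.image_subset_range _ _)
      (Set.image_subset_range _ _)

lemma hausdorffMeasure_frontier_ne_top (h : IsBoundedByCurves V γ) : μH[1] (frontier V) ≠ ⊤ := by
  rw [h.hausdorffMeasure_frontier]
  refine ENNReal.sum_ne_top.2 fun i _ => ?_
  have := ((h.curve i).contDiff_deriv.continuous.integrableOn_Icc (a := 0) (b := 1)
    (μ := volume)).2
  exact ((lintegral_mono_set ((boundaryParam_subset _ _).trans Set.Ico_subset_Icc_self)).trans_lt
    this).ne

lemma exists_normalDeriv_bound (h : IsBoundedByCurves V γ) :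
    ∃ C : NNReal, ∀ i b, ∀ s ∈ Set.Ico (0 : ℝ) 1, ∀ τ τ' : ℝ,
      ‖normalDeriv (γ i) b (s, τ)‖ₑ ≤
        ‖normalDeriv (γ i) b (s, τ')‖ₑ + C * ENNReal.ofReal |τ - τ'| := by
  have hc : ∀ i, ∃ C : NNReal, ∀ s ∈ Set.Icc (0 : ℝ) 1, ‖deriv (unitNormal (γ i)) s‖ ≤ C := by
    intro i
    obtain ⟨C, hC⟩ := isCompact_Icc.exists_bound_of_continuousOn (s := Set.Icc (0 : ℝ) 1)
      ((h.curve i).contDiff_unitNormal.continuous_deriv (by norm_num)).continuousOn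
    exact ⟨C.toNNReal, fun s hs => (hC s hs).trans (Real.le_coe_toNNReal C)⟩
  choose C hC using hc
  refine ⟨∑ i, C i, fun i b s hs τ τ' => ?_⟩
  have e : normalDeriv (γ i) b (s, τ) = normalDeriv (γ i) b (s, τ') +
      (τ - τ') • (sideSign b • deriv (unitNormal (γ i)) s) := by
    simp only [normalDeriv]
    module
  rw [e]
  refine (enorm_add_le _ _).trans (add_le_add_right ?_ _)
  have h1 : ‖(τ - τ') • (sideSign b • deriv (unitNormal (γ i)) s)‖ ≤
      ((∑ i, C i : NNReal) : ℝ) * |τ - τ'| := by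
    rw [norm_smul, norm_smul, Real.norm_eq_abs, Real.norm_eq_abs, abs_sideSign, one_mul, mul_comm]
    gcongr
    refine (hC i s (Set.Ico_subset_Icc_self hs)).trans ?_
    exact_mod_cast Finset.single_le_sum (fun _ _ => zero_le) (Finset.mem_univ i)
  rw [← ofReal_norm]
  refine (ENNReal.ofReal_le_ofReal h1).trans_eq ?_
  rw [ENNReal.ofReal_mul (NNReal.coe_nonneg _), ENNReal.ofReal_coe_nnreal]

lemma volume_tube_le (h : IsBoundedByCurves V γ) :
    ∃ C : NNReal, ∀ t > 0, volume {x | x ∉ closure V ∧ infDist x (frontier V) < t} ≤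
      ENNReal.ofReal t * μH[1] (frontier V) + C * ENNReal.ofReal t ^ 2 := by
  obtain ⟨C, hC⟩ := h.exists_normalDeriv_bound
  refine ⟨N * C, fun t ht => ?_⟩
  set F : Fin N → Bool → Set (ℝ × ℝ) := fun i b => footSet V (γ i) b ∩ {q | q.2 < t} with hF
  have hFm : ∀ i b, MeasurableSet (F i b) := fun i b =>
    ((h.curve i).measurableSet_footSet V b).inter (measurableSet_lt measurable_snd measurable_const)
  have hcov : {x | x ∉ closure V ∧ infDist x (frontier V) < t} ⊆
      ⋃ i, ⋃ b, normalMap (γ i) b '' F i b := by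
    rintro x ⟨hx, hxt⟩
    obtain ⟨i, b, q, hq, hq2, rfl⟩ := h.exists_footSet hx
    exact Set.mem_iUnion_of_mem i (Set.mem_iUnion_of_mem b ⟨q, ⟨hq, by
      rw [Set.mem_ofPred_eq, hq2]; exact hxt⟩, rfl⟩)
  have hone : ∀ i, volume (⋃ b, normalMap (γ i) b '' F i b) ≤
      ENNReal.ofReal t * (∫⁻ s in boundaryParam V (γ i), ‖deriv (γ i) s‖ₑ) +
        C * ENNReal.ofReal t ^ 2 := by
    intro i
    set f : ℝ → ENNReal := fun s => ‖deriv (γ i) s‖ₑ + C * ENNReal.ofReal t with hf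
    have hfm : Measurable f := by
      have := (h.curve i).contDiff_deriv.continuous
      fun_prop
    have hb : ∀ b, volume (normalMap (γ i) b '' F i b) ≤ ∫⁻ q in F i b, f q.1 := by
      intro b
      refine ((h.curve i).volume_normalMap_image_le b (hFm i b)).trans
        (setLIntegral_mono (hfm.comp measurable_fst) fun q hq => ?_)
      refine (hC i b q.1 hq.1.1 q.2 0).trans ?_
      have h1 : normalDeriv (γ i) b (q.1, 0) = deriv (γ i) q.1 := by simp [normalDeriv]
      rw [h1, sub_zero, abs_of_pos hq.1.2.1]
      have : q.2 < t := hq.2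
      simp only [hf]
      gcongr
    calc volume (⋃ b, normalMap (γ i) b '' F i b)
        ≤ ∑ b, volume (normalMap (γ i) b '' F i b) := by
          refine (measure_iUnion_le _).trans_eq (tsum_fintype _)
      _ ≤ (∫⁻ q in F i true, f q.1) + ∫⁻ q in F i false, f q.1 := by
          rw [Fintype.sum_bool]
          exact add_le_add (hb true) (hb false)
      _ = ∫⁻ q in F i true ∪ F i false, f q.1 :=
          (lintegral_union (hFm i false)
            ((h.disjoint_footSet i).mono Set.inter_subset_left Set.inter_subset_left)).symm
      _ ≤ ∫⁻ q in boundaryParam V (γ i) ×ˢ Set.Ioo 0 t, f q.1 := by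
          refine lintegral_mono_set ?_
          rintro q (hq | hq) <;> exact ⟨⟨hq.1.1, hq.1.2.2.1⟩, hq.1.2.1, hq.2⟩
      _ = (∫⁻ s in boundaryParam V (γ i), f s) * ENNReal.ofReal t := by
          rw [setLIntegral_prod_fst hfm, Real.volume_Ioo, sub_zero]
      _ ≤ ((∫⁻ s in boundaryParam V (γ i), ‖deriv (γ i) s‖ₑ) + C * ENNReal.ofReal t) *
            ENNReal.ofReal t := by
          gcongr
          rw [hf, lintegral_add_right _ measurable_const, setLIntegral_const]
          exact add_le_add le_rfl (mul_le_of_le_one_right'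
            (volume_le_one_of_subset_Ico (boundaryParam_subset _ _)))
      _ = _ := by ring
  calc volume {x | x ∉ closure V ∧ infDist x (frontier V) < t}
      ≤ ∑ i, volume (⋃ b, normalMap (γ i) b '' F i b) :=
        ((measure_mono hcov).trans (measure_iUnion_le _)).trans_eq (tsum_fintype _)
    _ ≤ ∑ i, (ENNReal.ofReal t * (∫⁻ s in boundaryParam V (γ i), ‖deriv (γ i) s‖ₑ) +
        C * ENNReal.ofReal t ^ 2) := Finset.sum_le_sum fun i _ => hone i
    _ = _ := by
        rw [Finset.sum_add_distrib, ← Finset.mul_sum, ← h.hausdorffMeasure_frontier]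
        simp [mul_assoc]

lemma hausdorffMeasure_level_le (h : IsBoundedByCurves V γ) :
    ∃ C : NNReal, ∀ t δ : ℝ, 0 < δ → δ < t →
      ENNReal.ofReal δ * μH[1] {x | x ∉ closure V ∧ infDist x (frontier V) = t} ≤
        volume {x | x ∉ closure V ∧ t - δ ≤ infDist x (frontier V) ∧ infDist x (frontier V) < t} +
          C * ENNReal.ofReal δ ^ 2 := by
  obtain ⟨C, hC⟩ := h.exists_normalDeriv_bound
  refine ⟨N * 2 * C, fun t δ hδ hδt => ?_⟩
  set D : Fin N × Bool → Set ℝ := fun k => {s | (s, t) ∈ footSet V (γ k.1) k.2} with hD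
  have hDm : ∀ k, MeasurableSet (D k) := fun k =>
    measurable_prodMk_right ((h.curve k.1).measurableSet_footSet V k.2)
  have hDs : ∀ k, D k ⊆ Set.Ico 0 1 := fun k s hs => hs.1
  set G : Fin N × Bool → Set (ℝ × ℝ) := fun k => D k ×ˢ Set.Ioo (t - δ) t with hG
  have hGm : ∀ k, MeasurableSet (G k) := fun k => (hDm k).prod measurableSet_Ioo
  have hpos : ∀ τ ∈ Set.Ioo (t - δ) t, 0 < τ := fun τ hτ => by linarith [hτ.1]
  have hinj : ∀ k, Set.InjOn (normalMap (γ k.1) k.2) (G k) := fun k q hq r hr hqr =>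
    (h.normalMap_inj hq.1 (hpos _ hq.2) hq.2.2 hr.1 (hpos _ hr.2) hr.2.2 hqr).2
  have himg : ∀ k, MeasurableSet (normalMap (γ k.1) k.2 '' G k) := fun k =>
    (hGm k).image_of_continuousOn_injOn ((h.curve k.1).continuous_normalMap k.2).continuousOn
      (hinj k)
  have hdisj : Pairwise (Function.onFun Disjoint fun k => normalMap (γ k.1) k.2 '' G k) := by
    intro k l hkl
    refine Set.disjoint_left.2 ?_
    rintro _ ⟨q, hq, rfl⟩ ⟨r, hr, hqr⟩
    exact hkl (h.normalMap_inj hq.1 (hpos _ hq.2) hq.2.2 hr.1 (hpos _ hr.2) hr.2.2 hqr.symm).1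
  have hcov : {x | x ∉ closure V ∧ infDist x (frontier V) = t} ⊆
      ⋃ k, (fun s => normalMap (γ k.1) k.2 (s, t)) '' D k := by
    rintro x ⟨hx, hxt⟩
    obtain ⟨i, b, ⟨s, τ⟩, hq, hq2, rfl⟩ := h.exists_footSet hx
    have : τ = t := hq2.trans hxt
    subst this
    exact Set.mem_iUnion_of_mem (i, b) ⟨s, hq, rfl⟩
  have hsub : (⋃ k, normalMap (γ k.1) k.2 '' G k) ⊆
      {x | x ∉ closure V ∧ t - δ ≤ infDist x (frontier V) ∧ infDist x (frontier V) < t} := by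
    refine Set.iUnion_subset fun k => ?_
    rintro _ ⟨⟨s, τ⟩, hq, rfl⟩
    obtain ⟨-, -, -, h4, h5⟩ := h.footSet_star hq.1 (hpos _ hq.2) hq.2.2.le
    refine ⟨h4, ?_⟩
    dsimp only at h5
    rw [h5]
    exact ⟨hq.2.1.le, hq.2.2⟩
  have hone : ∀ k, ENNReal.ofReal δ * μH[1] ((fun s => normalMap (γ k.1) k.2 (s, t)) '' D k) ≤
      volume (normalMap (γ k.1) k.2 '' G k) + C * ENNReal.ofReal δ ^ 2 := by
    intro k
    have hcont := (h.curve k.1).continuous_normalDeriv k.2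
    have hcont' : Continuous fun s => normalDeriv (γ k.1) k.2 (s, t) := by fun_prop
    have hvol : volume (Set.Ioo (t - δ) t) = ENNReal.ofReal δ := by
      rw [Real.volume_Ioo, sub_sub_cancel]
    calc ENNReal.ofReal δ * μH[1] ((fun s => normalMap (γ k.1) k.2 (s, t)) '' D k)
        ≤ ENNReal.ofReal δ * ∫⁻ s in D k, ‖normalDeriv (γ k.1) k.2 (s, t)‖ₑ := by
          gcongr
          exact hausdorffMeasure_image_le_lintegral
            (fun s => (h.curve k.1).hasDerivAt_normalMap k.2 s t) hcont' (hDm k) (hDs k)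
      _ = ∫⁻ q in G k, ‖normalDeriv (γ k.1) k.2 (q.1, t)‖ₑ := by
          rw [hG, setLIntegral_prod_fst (f := fun s => ‖normalDeriv (γ k.1) k.2 (s, t)‖ₑ)
            hcont'.enorm.measurable, hvol, mul_comm]
      _ ≤ ∫⁻ q in G k, (‖normalDeriv (γ k.1) k.2 q‖ₑ + C * ENNReal.ofReal δ) := by
          refine setLIntegral_mono (by fun_prop) fun q hq => ?_
          refine (hC k.1 k.2 q.1 (hDs k hq.1) t q.2).trans ?_
          gcongr
          rw [abs_of_pos (by linarith [hq.2.2])]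
          linarith [hq.2.1]
      _ = volume (normalMap (γ k.1) k.2 '' G k) + C * ENNReal.ofReal δ * volume (G k) := by
          rw [lintegral_add_right _ measurable_const, setLIntegral_const,
            (h.curve k.1).volume_normalMap_image k.2 (hGm k) (hinj k)]
      _ ≤ volume (normalMap (γ k.1) k.2 '' G k) + C * ENNReal.ofReal δ * ENNReal.ofReal δ := by
          gcongr
          rw [hG, Measure.volume_eq_prod, Measure.prod_prod, hvol]
          exact mul_le_of_le_one_left' (volume_le_one_of_subset_Ico (hDs k))
      _ = _ := by ring
  calc ENNReal.ofReal δ * μH[1] {x | x ∉ closure V ∧ infDist x (frontier V) = t}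
      ≤ ENNReal.ofReal δ * ∑ k, μH[1] ((fun s => normalMap (γ k.1) k.2 (s, t)) '' D k) := by
        gcongr
        exact ((measure_mono hcov).trans (measure_iUnion_le _)).trans_eq (tsum_fintype _)
    _ ≤ ∑ k, (volume (normalMap (γ k.1) k.2 '' G k) + C * ENNReal.ofReal δ ^ 2) := by
        rw [Finset.mul_sum]
        exact Finset.sum_le_sum fun k _ => hone k
    _ = volume (⋃ k, normalMap (γ k.1) k.2 '' G k) +
          (N * 2 * C : NNReal) * ENNReal.ofReal δ ^ 2 := by
        rw [Finset.sum_add_distrib, measure_iUnion hdisj himg, tsum_fintype]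
        simp [mul_assoc]
    _ ≤ _ := by gcongr

end IsBoundedByCurves

lemma tendsto_const_div_nat_zero (t : ℝ) : Tendsto (fun n : ℕ => t / n) atTop (nhds 0) :=
  tendsto_const_nhds.div_atTop tendsto_natCast_atTop_atTop

namespace IsBoundedByCurves

variable {V : Set (Eu 2)} {N : ℕ} {γ : Fin N → ℝ → Eu 2}

lemma volume_frontier (h : IsBoundedByCurves V γ) : volume (frontier V) = 0 :=
  volume_eq_zero_of_hausdorffMeasure_one_ne_top h.hausdorffMeasure_frontier_ne_top

lemma exists_small_swept_area_le (h : IsBoundedByCurves V γ) :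
    ∃ C : ℝ, ∀ t > 0, volume.real Vᶜ - volume.real (_root_.par V t)ᶜ ≤
      (μH[1] (frontier V)).toReal * t + C * t ^ 2 := by
  obtain ⟨C, hC⟩ := h.volume_tube_le
  refine ⟨C, fun t ht => ?_⟩
  have hb := h.exterior.volume_band h.nonempty_compl h.volume_frontier le_rfl ht.le ht
  rw [par_zero] at hb
  rw [← hb]
  refine ENNReal.toReal_le_of_le_ofReal (by positivity) ?_
  have hsub : {x | x ∉ closure V ∧ 0 ≤ infDist x (frontier V) ∧ infDist x (frontier V) < t} ⊆
      {x | x ∉ closure V ∧ infDist x (frontier V) < t} := fun x hx => ⟨hx.1, hx.2.2⟩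
  refine (measure_mono hsub).trans ((hC t ht).trans_eq ?_)
  rw [ENNReal.ofReal_add (by positivity) (by positivity), ENNReal.ofReal_mul (by positivity),
    ENNReal.ofReal_toReal h.hausdorffMeasure_frontier_ne_top, ENNReal.ofReal_mul (by positivity),
    ENNReal.ofReal_coe_nnreal, ENNReal.ofReal_pow ht.le, mul_comm (μH[1] _)]

lemma swept_area_le (h : IsBoundedByCurves V γ) {t : ℝ} (ht : 0 < t)
    (hne : (_root_.par V t)ᶜ.Nonempty) :
    volume.real Vᶜ - volume.real (_root_.par V t)ᶜ ≤
      (μH[1] (frontier V)).toReal * t - π * t ^ 2 ∧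
    ∃ K : ℝ, ∀ᶠ n : ℕ in atTop,
      volume.real (_root_.par V (t - t / n))ᶜ - volume.real (_root_.par V t)ᶜ ≤
        t / n * ((μH[1] (frontier V)).toReal - 2 * π * t + K * (t / n)) := by
  obtain ⟨C, hC⟩ := h.exists_small_swept_area_le
  obtain ⟨h1, h2⟩ := _root_.swept_area_le h.exterior ht hne one_pos fun s hs _ => hC s hs
  exact ⟨h2, _, h1⟩

/-- The parallel curves of the outer boundary shrink at rate at least `2 * π`. -/
lemma hausdorffMeasure_level_le_sub (h : IsBoundedByCurves V γ) {t : ℝ} (ht : 0 < t)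
    (hne : (_root_.par V t)ᶜ.Nonempty) :
    0 ≤ (μH[1] (frontier V)).toReal - 2 * π * t ∧
    μH[1] {x | x ∉ closure V ∧ infDist x (frontier V) = t} ≤
      ENNReal.ofReal ((μH[1] (frontier V)).toReal - 2 * π * t) := by
  obtain ⟨-, K, hK⟩ := h.swept_area_le ht hne
  obtain ⟨C, hC⟩ := h.hausdorffMeasure_level_le
  set y := (μH[1] (frontier V)).toReal - 2 * π * t
  have h0 := tendsto_const_div_nat_zero t
  have hlim : ∀ M : ℝ, Tendsto (fun n : ℕ => y + M * (t / n)) atTop (nhds y) := fun M => by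
    simpa using (h0.const_mul M).const_add y
  have hev : ∀ᶠ n : ℕ in atTop, 0 < t / n ∧ t / n < t := by
    filter_upwards [eventually_gt_atTop 1] with n hn
    have hn' : (1 : ℝ) < n := by exact_mod_cast hn
    exact ⟨by positivity, div_lt_self ht hn'⟩
  constructor
  · refine ge_of_tendsto (hlim K) ?_
    filter_upwards [hK, hev] with n hn ⟨hp, hlt⟩
    have hanti := (h.exterior.par (t := t - t / n) (by linarith)).volumeReal_anti
      (par_mono V (by linarith : t - t / n ≤ t))
    nlinarith
  · refine ge_of_tendsto ((ENNReal.continuous_ofReal.tendsto _).comp (hlim (K + C))) ?_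
    filter_upwards [hK, hev] with n hn ⟨hp, hlt⟩
    have hb := h.exterior.volume_band h.nonempty_compl h.volume_frontier
      (s := t - t / n) (t := t) (by linarith) (by linarith) ht
    rw [← hb] at hn
    have hfin : volume {x | x ∉ closure V ∧ t - t / n ≤ infDist x (frontier V) ∧
        infDist x (frontier V) < t} ≠ ⊤ :=
      measure_ne_top_of_subset (fun x hx hxV => hx.1 (subset_closure hxV))
        h.exterior.volume_compl_ne_top
    have h1 := hC t (t / n) hp hlt
    have hp0 : ENNReal.ofReal (t / n) ≠ 0 := by simpa using hp
    rw [← ENNReal.mul_le_mul_iff_right hp0 ENNReal.ofReal_ne_top]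
    refine h1.trans ?_
    rw [← ENNReal.ofReal_toReal hfin, ← ENNReal.ofReal_coe_nnreal (p := C),
      ← ENNReal.ofReal_pow hp.le, ← ENNReal.ofReal_mul (by positivity),
      ← ENNReal.ofReal_add ENNReal.toReal_nonneg (by positivity), Function.comp_apply,
      ← ENNReal.ofReal_mul hp.le]
    refine ENNReal.ofReal_le_ofReal ?_
    have : (volume {x | x ∉ closure V ∧ t - t / n ≤ infDist x (frontier V) ∧
        infDist x (frontier V) < t}).toReal ≤ t / n * (y + K * (t / n)) := hn
    linarith

end IsBoundedByCurves

lemma IsC2Domain.exists_isBoundedByCurves {Ω : Set (Eu 2)} (hΩ : IsC2Domain Ω) :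
    ∃ (N : ℕ) (γ : Fin N → ℝ → Eu 2), IsBoundedByCurves (unboundedPart Ω) γ := by
  obtain ⟨ho, hc, hb, N, γ, hγ, hd, hf⟩ := hΩ
  refine ⟨N, γ, isExteriorRegion_unboundedPart hb, ?_, hγ, hd, ?_, ?_⟩
  · obtain ⟨x, hx⟩ := hc.nonempty
    exact ⟨x, fun hxV => unboundedPart_subset Ω hxV (subset_closure hx)⟩
  · rw [← hf]
    exact frontier_unboundedPart_subset ho
  · rw [← hf]
    exact Set.disjoint_left.2 fun x hx hx' => unboundedPart_subset Ω hx
      (frontier_subset_closure hx')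

lemma IsC2Domain.subset_innerRegion {Ω : Set (Eu 2)} (hΩ : IsC2Domain Ω) : Ω ⊆ innerRegion Ω :=
  fun _ hx hxV => Set.disjoint_left.1 (disjoint_closure_unboundedPart hΩ.1) hx hxV

lemma IsC2Domain.nonempty_compl_par {Ω : Set (Eu 2)} (hΩ : IsC2Domain Ω) {t : ℝ} (ht : 0 < t)
    (htR : t < innerRadius Ω) : (par (unboundedPart Ω) t)ᶜ.Nonempty := by
  obtain ⟨N, γ, h⟩ := hΩ.exists_isBoundedByCurves
  obtain ⟨_, ⟨x, hx, rfl⟩, htx⟩ :=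
    exists_lt_of_lt_csSup ((hΩ.2.1.nonempty.mono hΩ.subset_innerRegion).image _) htR
  refine ⟨x, fun hxt => ?_⟩
  have hxV : x ∉ unboundedPart Ω := fun hxV => hx (subset_closure hxV)
  rw [par_eq_thickening (isOpen_unboundedPart Ω) ht,
    mem_thickening_iff_infDist_frontier (isOpen_unboundedPart Ω) hxV h.nonempty_frontier ht] at hxt
  exact lt_asymm htx hxt

lemma IsC2Domain.monotone_areaFn {Ω : Set (Eu 2)} (hΩ : IsC2Domain Ω) : Monotone (areaFn Ω) :=
  fun _ _ hst => measureReal_mono (fun _ hx => ⟨hx.1, hx.2.trans_le hst⟩)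
    (measure_ne_top_of_subset (fun _ hx => hx.1) hΩ.2.2.1.measure_lt_top.ne)

lemma IsC2Domain.areaFn_le {Ω : Set (Eu 2)} (hΩ : IsC2Domain Ω) {s t : ℝ} (hs : 0 ≤ s)
    (hst : s ≤ t) (ht : 0 < t) :
    areaFn Ω t ≤ areaFn Ω s + (volume.real (par (unboundedPart Ω) s)ᶜ -
      volume.real (par (unboundedPart Ω) t)ᶜ) := by
  obtain ⟨N, γ, h⟩ := hΩ.exists_isBoundedByCurves
  rw [← h.exterior.volume_band h.nonempty_compl h.volume_frontier hs hst ht]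
  have hfin : volume {x | x ∉ closure (unboundedPart Ω) ∧
      s ≤ infDist x (frontier (unboundedPart Ω)) ∧
      infDist x (frontier (unboundedPart Ω)) < t} ≠ ⊤ :=
    measure_ne_top_of_subset (fun x hx hxV => hx.1 (subset_closure hxV))
      h.exterior.volume_compl_ne_top
  have hfin' : volume {x ∈ Ω | infDist x (outerBoundary Ω) < s} ≠ ⊤ :=
    measure_ne_top_of_subset (fun _ hx => hx.1) hΩ.2.2.1.measure_lt_top.ne
  refine le_trans (measureReal_mono ?_ (measure_union_ne_top hfin' hfin)) (measureReal_union_le _ _)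
  intro x hx
  rcases lt_or_ge (infDist x (outerBoundary Ω)) s with hxs | hxs
  · exact Or.inl ⟨hx.1, hxs⟩
  · exact Or.inr ⟨hΩ.subset_innerRegion hx.1, hxs, hx.2⟩

lemma areaFn_zero (Ω : Set (Eu 2)) : areaFn Ω 0 = 0 := by
  have : {x ∈ Ω | infDist x (outerBoundary Ω) < 0} = ∅ :=
    Set.eq_empty_of_forall_notMem fun x hx => not_lt.2 infDist_nonneg hx.2
  rw [areaFn, this, measure_empty, ENNReal.toReal_zero]

lemma IsC2Domain.areaFn_le_sub {Ω : Set (Eu 2)} (hΩ : IsC2Domain Ω) {t : ℝ} (ht : 0 < t)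
    (htR : t < innerRadius Ω) : areaFn Ω t ≤ outerPerim Ω * t - π * t ^ 2 := by
  obtain ⟨N, γ, h⟩ := hΩ.exists_isBoundedByCurves
  have h1 := hΩ.areaFn_le le_rfl ht.le ht
  rw [areaFn_zero, par_zero, zero_add] at h1
  exact h1.trans (h.swept_area_le ht (hΩ.nonempty_compl_par ht htR)).1

lemma IsC2Domain.lenFn_le {Ω : Set (Eu 2)} (hΩ : IsC2Domain Ω) {t : ℝ} (ht : 0 < t)
    (htR : t < innerRadius Ω) :
    0 ≤ outerPerim Ω - 2 * π * t ∧ lenFn Ω t ≤ outerPerim Ω - 2 * π * t := by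
  obtain ⟨N, γ, h⟩ := hΩ.exists_isBoundedByCurves
  obtain ⟨h1, h2⟩ := h.hausdorffMeasure_level_le_sub ht (hΩ.nonempty_compl_par ht htR)
  refine ⟨h1, ENNReal.toReal_le_of_le_ofReal h1 (le_trans (measure_mono ?_) h2)⟩
  exact fun x hx => ⟨hΩ.subset_innerRegion hx.1, hx.2⟩

lemma IsC2Domain.hasDerivAt_areaFn_le {Ω : Set (Eu 2)} (hΩ : IsC2Domain Ω) {t a : ℝ} (ht : 0 < t)
    (htR : t < innerRadius Ω) (ha : HasDerivAt (areaFn Ω) a t) :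
    a ≤ outerPerim Ω - 2 * π * t := by
  obtain ⟨N, γ, h⟩ := hΩ.exists_isBoundedByCurves
  obtain ⟨-, K, hK⟩ := h.swept_area_le ht (hΩ.nonempty_compl_par ht htR)
  have h0 := tendsto_const_div_nat_zero t
  have hev : ∀ᶠ n : ℕ in atTop, 0 < t / n ∧ t / n < t := by
    filter_upwards [eventually_gt_atTop 1] with n hn
    have hn' : (1 : ℝ) < n := by exact_mod_cast hn
    exact ⟨by positivity, div_lt_self ht hn'⟩
  have hlim : Tendsto (fun n : ℕ => outerPerim Ω - 2 * π * t + K * (t / n)) atTop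
      (nhds (outerPerim Ω - 2 * π * t)) := by
    simpa using (h0.const_mul K).const_add (outerPerim Ω - 2 * π * t)
  have hpt : Tendsto (fun n : ℕ => t - t / n) atTop (nhdsWithin t {t}ᶜ) := by
    refine tendsto_nhdsWithin_iff.2 ⟨by simpa using h0.const_sub t, ?_⟩
    filter_upwards [hev] with n hn
    exact (sub_lt_self t hn.1).ne
  refine le_of_tendsto_of_tendsto ((hasDerivAt_iff_tendsto_slope.1 ha).comp hpt) hlim ?_
  filter_upwards [hK, hev] with n hn ⟨hp, hlt⟩
  have h1 := hΩ.areaFn_le (s := t - t / n) (t := t) (by linarith) (by linarith) ht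
  rw [Function.comp_apply, slope_comm, slope_def_field, sub_sub_cancel, div_le_iff₀ hp, mul_comm]
  exact (sub_le_iff_le_add'.2 h1).trans hn

lemma abs_deriv_sqrt_le_one {A : ℝ → ℝ} {L y a t : ℝ} (hA : HasDerivAt A a t) (ha : |a| ≤ y)
    (hy : y ^ 2 ≤ L ^ 2 - 4 * π * A t) :
    |deriv (fun s => √(L ^ 2 - 4 * π * A s) / (2 * π)) t| ≤ 1 := by
  have hy0 : 0 ≤ y := (abs_nonneg a).trans ha
  rcases (sq_nonneg y).trans hy |>.eq_or_lt with h0 | hpos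
  · have hmin : IsLocalMin (fun s => √(L ^ 2 - 4 * π * A s) / (2 * π)) t := by
      refine Eventually.of_forall fun s => ?_
      simp only [← h0, Real.sqrt_zero, zero_div]
      positivity
    rw [hmin.deriv_eq_zero, abs_zero]
    exact zero_le_one
  · have hd := ((((hA.const_mul (4 * π)).const_sub (L ^ 2)).sqrt hpos.ne').div_const (2 * π))
    have hs : 0 < √(L ^ 2 - 4 * π * A t) := Real.sqrt_pos.2 hpos
    have e : -(4 * π * a) / (2 * √(L ^ 2 - 4 * π * A t)) / (2 * π) =
        -a / √(L ^ 2 - 4 * π * A t) := by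
      field_simp
      ring
    rw [hd.deriv, e, abs_div, abs_neg, abs_of_pos hs, div_le_one hs]
    exact ha.trans (Real.le_sqrt_of_sq_le hy)

end

theorem isoperimetric_type_estimate
    (Ω : Set (Eu 2)) (hΩ : IsC2Domain Ω) :
    ∀ᵐ t ∂(volume : Measure ℝ), t ∈ Set.Icc 0 (innerRadius Ω) →
      (lenFn Ω t) ^ 2 ≤ (outerPerim Ω) ^ 2 - 4 * π * areaFn Ω t ∧
      |deriv (fun s => Real.sqrt ((outerPerim Ω) ^ 2 - 4 * π * areaFn Ω s) / (2 * π)) t| ≤ 1 := by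
  have hne : ∀ c : ℝ, ∀ᵐ t ∂(volume : Measure ℝ), t ≠ c := fun c => by
    simp [ae_iff]
  filter_upwards [hΩ.monotone_areaFn.ae_differentiableAt, hne 0, hne (innerRadius Ω)]
    with t hdiff ht0 htR ht
  have h0 : 0 < t := lt_of_le_of_ne ht.1 ht0.symm
  have hR : t < innerRadius Ω := lt_of_le_of_ne ht.2 htR
  obtain ⟨hy, hlen⟩ := hΩ.lenFn_le h0 hR
  have harea := hΩ.areaFn_le_sub h0 hR
  have hsq : (outerPerim Ω - 2 * π * t) ^ 2 ≤ outerPerim Ω ^ 2 - 4 * π * areaFn Ω t := by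
    nlinarith [mul_le_mul_of_nonneg_left harea Real.pi_pos.le]
  refine ⟨(pow_le_pow_left₀ ENNReal.toReal_nonneg hlen 2).trans hsq, ?_⟩
  refine abs_deriv_sqrt_le_one hdiff.hasDerivAt ?_ hsq
  rw [abs_of_nonneg hΩ.monotone_areaFn.deriv_nonneg]
  exact hΩ.hasDerivAt_areaFn_le h0 hR hdiff.hasDerivAt

end
end

section
/- Let 0 < r₁ < r₂. The first Neumann–Robin eigenvalue of the planar annulus A_{r₁,r₂} (Robin parameter α on the outer circle of radius r₂, Neumann on the inner circle) satisfies the asymptotics μ₁^α(A_{r₁,r₂}) = −α² + α/r₂ + o(α) as α → −∞. -/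
open MeasureTheory Metric Filter Asymptotics Real RealInnerProductSpace

noncomputable section

/-- The first eigenvalue `μ₁^α(A_{r₁,r₂})` of the Laplacian on the planar annulus
`A_{r₁,r₂}` with Robin boundary condition (parameter `α`) on the outer circle and
Neumann condition on the inner circle, defined variationally. -/
def nrEig (α r₁ r₂ : ℝ) : ℝ :=
  sInf { lam : ℝ | ∃ ψ : ℝ → ℝ, ContDiff ℝ (⊤ : ℕ∞) ψ ∧
    (∫ r in r₁..r₂, (ψ r) ^ 2 * r) ≠ 0 ∧
    lam = ((∫ r in r₁..r₂, (deriv ψ r) ^ 2 * r) + α * r₂ * (ψ r₂) ^ 2)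
          / (∫ r in r₁..r₂, (ψ r) ^ 2 * r) }

/-- A constant bounding the error in the Riccati inequality, uniformly in the parameter. -/
def riccatiError (r₁ r₂ : ℝ) : ℝ :=
  (2 / (r₂ - r₁) ^ 2 + 1 / (r₁ * r₂)) ^ 2 * (r₂ - r₁) ^ 2 / 4

/-- The vector field `w(r) = β (1 - (r₂ - r)² / (r₂ - r₁)²)` satisfies
`w² + w' + w / r ≤ β² + β / r₂ + O(1)`. -/
lemma riccati_le {r₁ r₂ β r : ℝ} (hr₁ : 0 < r₁) (hr₁₂ : r₁ < r₂) (hβ : 0 ≤ β)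
    (hr : r ∈ Set.Icc r₁ r₂) :
    (β * (1 - (r₂ - r) ^ 2 / (r₂ - r₁) ^ 2)) ^ 2 * r
      + (β * (2 * (r₂ - r) / (r₂ - r₁) ^ 2) * r + β * (1 - (r₂ - r) ^ 2 / (r₂ - r₁) ^ 2))
      ≤ (β ^ 2 + β / r₂ + riccatiError r₁ r₂) * r := by
  obtain ⟨h1, h2⟩ := hr
  have hL : 0 < r₂ - r₁ := sub_pos.2 hr₁₂
  have hr₂ : 0 < r₂ := hr₁.trans hr₁₂
  have hr0 : 0 < r := hr₁.trans_le h1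
  set C : ℝ := 2 / (r₂ - r₁) ^ 2 + 1 / (r₁ * r₂) with hC
  set t : ℝ := (r₂ - r) ^ 2 / (r₂ - r₁) ^ 2 with ht
  have ht0 : 0 ≤ t := by positivity
  have ht1 : t ≤ 1 := by
    rw [ht, div_le_one (by positivity)]
    exact pow_le_pow_left₀ (by linarith) (by linarith) 2
  have hsq : (β * (1 - t)) ^ 2 ≤ β ^ 2 * (1 - t) := by
    nlinarith [mul_nonneg (sq_nonneg β) (mul_nonneg ht0 (sub_nonneg.2 ht1))]
  have hw : β * (1 - t) ≤ (β / r₂ + β * (r₂ - r) / (r₁ * r₂)) * r := by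
    have hle : β * (r₂ - r) / r₂ ≤ β * (r₂ - r) / (r₁ * r₂) * r := by
      rw [div_mul_eq_mul_div, div_le_div_iff₀ hr₂ (by positivity)]
      have : 0 ≤ β * (r₂ - r) * r₂ := by
        have := sub_nonneg.2 h2
        positivity
      nlinarith
    have heq : β = β / r₂ * r + β * (r₂ - r) / r₂ := by field_simp; ring
    nlinarith [mul_nonneg hβ ht0]
  have hK : β * (r₂ - r) * C ≤ β ^ 2 * t + riccatiError r₁ r₂ := by
    have hid : β ^ 2 * t + riccatiError r₁ r₂ - β * (r₂ - r) * C
        = (β * (r₂ - r) / (r₂ - r₁) - C * (r₂ - r₁) / 2) ^ 2 := by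
      rw [riccatiError, ← hC, ht]
      field_simp
      ring
    nlinarith [sq_nonneg (β * (r₂ - r) / (r₂ - r₁) - C * (r₂ - r₁) / 2)]
  have hCs : β * (r₂ - r) * C
      = β * (2 * (r₂ - r) / (r₂ - r₁) ^ 2) + β * (r₂ - r) / (r₁ * r₂) := by
    rw [hC]; ring
  nlinarith [mul_le_mul_of_nonneg_right hsq hr0.le, mul_le_mul_of_nonneg_right hK hr0.le]

/-- Lower bound for the Robin energy, from integrating `(ψ' - w ψ)² ≥ 0`. -/
lemma neg_mul_integral_le_energy {r₁ r₂ β : ℝ} (hr₁ : 0 < r₁) (hr₁₂ : r₁ < r₂) (hβ : 0 ≤ β)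
    {ψ : ℝ → ℝ} (hψ : ContDiff ℝ (⊤ : ℕ∞) ψ) :
    -(β ^ 2 + β / r₂ + riccatiError r₁ r₂) * (∫ r in r₁..r₂, (ψ r) ^ 2 * r)
      ≤ (∫ r in r₁..r₂, (deriv ψ r) ^ 2 * r) + -β * r₂ * (ψ r₂) ^ 2 := by
  have hc : Continuous ψ := hψ.continuous
  have hc' : Continuous (deriv ψ) := hψ.continuous_deriv (by simp)
  have hd : ∀ r, HasDerivAt ψ (deriv ψ r) r := fun r =>
    ((hψ.differentiable (by simp)) r).hasDerivAt
  set w : ℝ → ℝ := fun r => β * (1 - (r₂ - r) ^ 2 / (r₂ - r₁) ^ 2) with hw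
  set w' : ℝ → ℝ := fun r => β * (2 * (r₂ - r) / (r₂ - r₁) ^ 2) with hw'
  have hwd : ∀ r, HasDerivAt w (w' r) r := fun r => by
    have := (((((hasDerivAt_id r).const_sub r₂).pow 2).div_const
      ((r₂ - r₁) ^ 2)).const_sub 1).const_mul β
    refine this.congr_deriv ?_
    simp [hw']
    ring
  set c := β ^ 2 + β / r₂ + riccatiError r₁ r₂
  have hF : ∀ r, HasDerivAt (fun r => w r * r * ψ r ^ 2)
      ((w' r * r + w r) * ψ r ^ 2 + w r * r * (2 * ψ r * deriv ψ r)) r := fun r => by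
    refine (((hwd r).mul (hasDerivAt_id r)).mul ((hd r).pow 2)).congr_deriv ?_
    simp
  have hwc : Continuous w := by fun_prop
  have hwc' : Continuous w' := by fun_prop
  have hint := intervalIntegral.integral_eq_sub_of_hasDerivAt (a := r₁) (b := r₂)
    (fun r _ => hF r) (Continuous.intervalIntegrable (by fun_prop) _ _)
  have hw₁ : w r₁ = 0 := by
    have : r₂ - r₁ ≠ 0 := (sub_pos.2 hr₁₂).ne'
    simp [hw, this]
  have hw₂ : w r₂ = β := by simp [hw]
  rw [hw₁, hw₂] at hint
  have hmono : (∫ r in r₁..r₂,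
      ((w' r * r + w r) * ψ r ^ 2 + w r * r * (2 * ψ r * deriv ψ r)))
      ≤ ∫ r in r₁..r₂, ((deriv ψ r) ^ 2 * r + c * (ψ r ^ 2 * r)) := by
    refine intervalIntegral.integral_mono_on hr₁₂.le
      (Continuous.intervalIntegrable (by fun_prop) _ _)
      (Continuous.intervalIntegrable (by fun_prop) _ _) fun r hr => ?_
    have hric : w r ^ 2 * r + (w' r * r + w r) ≤ c * r := riccati_le hr₁ hr₁₂ hβ hr
    have hr0 : 0 ≤ r := hr₁.le.trans hr.1
    nlinarith [mul_le_mul_of_nonneg_right hric (sq_nonneg (ψ r)),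
      mul_nonneg (sq_nonneg (deriv ψ r - w r * ψ r)) hr0]
  rw [hint, intervalIntegral.integral_add (Continuous.intervalIntegrable (by fun_prop) _ _)
    (Continuous.intervalIntegrable (by fun_prop) _ _),
    intervalIntegral.integral_const_mul] at hmono
  linarith

lemma integral_sq_mul_nonneg {r₁ r₂ : ℝ} (hr₁ : 0 < r₁) (hr₁₂ : r₁ < r₂) (ψ : ℝ → ℝ) :
    0 ≤ ∫ r in r₁..r₂, (ψ r) ^ 2 * r :=
  intervalIntegral.integral_nonneg hr₁₂.le fun _ hr =>
    mul_nonneg (sq_nonneg _) (hr₁.le.trans hr.1)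

/-- The trial function `exp (β r)` realizes the two-term asymptotics as an upper bound. -/
lemma energy_exp_le {r₁ r₂ β : ℝ} (hr₁ : 0 < r₁) (hr₁₂ : r₁ < r₂) (hβ : 0 ≤ β) :
    (∫ r in r₁..r₂, (deriv (fun r => exp (β * r)) r) ^ 2 * r) + -β * r₂ * (exp (β * r₂)) ^ 2
      ≤ -(β ^ 2 + β / r₂) * ∫ r in r₁..r₂, (exp (β * r)) ^ 2 * r := by
  have hd : ∀ r, HasDerivAt (fun r => exp (β * r)) (β * exp (β * r)) r := fun r => by
    simpa [mul_comm] using ((hasDerivAt_id r).const_mul β).exp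
  have hderiv : deriv (fun r => exp (β * r)) = fun r => β * exp (β * r) :=
    funext fun r => (hd r).deriv
  have hF : ∀ r, HasDerivAt (fun r => β * r * exp (β * r) ^ 2)
      (β * exp (β * r) ^ 2 + β * r * (2 * exp (β * r) * (β * exp (β * r)))) r := fun r => by
    refine (((hasDerivAt_id r).const_mul β).mul ((hd r).pow 2)).congr_deriv ?_
    simp
  have hint := intervalIntegral.integral_eq_sub_of_hasDerivAt (a := r₁) (b := r₂)
    (fun r _ => hF r) (Continuous.intervalIntegrable (by fun_prop) _ _)
  have hr₂ : 0 < r₂ := hr₁.trans hr₁₂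
  have hmono : (∫ r in r₁..r₂,
      ((β * exp (β * r)) ^ 2 * r + (β ^ 2 + β / r₂) * (exp (β * r) ^ 2 * r)))
      ≤ ∫ r in r₁..r₂,
        (β * exp (β * r) ^ 2 + β * r * (2 * exp (β * r) * (β * exp (β * r)))) := by
    refine intervalIntegral.integral_mono_on hr₁₂.le
      (Continuous.intervalIntegrable (by fun_prop) _ _)
      (Continuous.intervalIntegrable (by fun_prop) _ _) fun r hr => ?_
    have hle : β / r₂ * r ≤ β := by
      rw [div_mul_eq_mul_div, div_le_iff₀ hr₂]
      exact mul_le_mul_of_nonneg_left hr.2 hβ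
    nlinarith [mul_le_mul_of_nonneg_right hle (sq_nonneg (exp (β * r)))]
  rw [intervalIntegral.integral_add (Continuous.intervalIntegrable (by fun_prop) _ _)
    (Continuous.intervalIntegrable (by fun_prop) _ _),
    intervalIntegral.integral_const_mul] at hmono
  have hpos : 0 ≤ β * r₁ * exp (β * r₁) ^ 2 := by positivity
  rw [hderiv]
  linarith

lemma integral_exp_sq_mul_pos {r₁ r₂ : ℝ} (hr₁ : 0 < r₁) (hr₁₂ : r₁ < r₂) (β : ℝ) :
    0 < ∫ r in r₁..r₂, (exp (β * r)) ^ 2 * r := by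
  refine intervalIntegral.intervalIntegral_pos_of_pos_on
    (Continuous.intervalIntegrable (by fun_prop) _ _) (fun r hr => ?_) hr₁₂
  have : 0 < r := hr₁.trans hr.1
  positivity

/-- Two-sided bound with a remainder that is uniform in `α ≤ 0`. -/
lemma nrEig_mem_Icc {r₁ r₂ α : ℝ} (hr₁ : 0 < r₁) (hr₁₂ : r₁ < r₂) (hα : α ≤ 0) :
    nrEig α r₁ r₂ ∈
      Set.Icc (-α ^ 2 + α / r₂ - riccatiError r₁ r₂) (-α ^ 2 + α / r₂) := by
  have hβ : 0 ≤ -α := neg_nonneg.2 hα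
  have hlower : -α ^ 2 + α / r₂ - riccatiError r₁ r₂ ∈ lowerBounds
      { lam : ℝ | ∃ ψ : ℝ → ℝ, ContDiff ℝ (⊤ : ℕ∞) ψ ∧
        (∫ r in r₁..r₂, (ψ r) ^ 2 * r) ≠ 0 ∧
        lam = ((∫ r in r₁..r₂, (deriv ψ r) ^ 2 * r) + α * r₂ * (ψ r₂) ^ 2)
              / (∫ r in r₁..r₂, (ψ r) ^ 2 * r) } := by
    rintro _ ⟨ψ, hψ, hne, rfl⟩
    rw [le_div_iff₀ ((integral_sq_mul_nonneg hr₁ hr₁₂ ψ).lt_of_ne' hne)]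
    have h := neg_mul_integral_le_energy hr₁ hr₁₂ hβ hψ
    rw [neg_neg] at h
    refine (le_of_eq ?_).trans h
    ring
  have hpos := integral_exp_sq_mul_pos hr₁ hr₁₂ (-α)
  have hmem : ((∫ r in r₁..r₂, (deriv (fun r => exp (-α * r)) r) ^ 2 * r)
      + α * r₂ * (exp (-α * r₂)) ^ 2) / (∫ r in r₁..r₂, (exp (-α * r)) ^ 2 * r) ∈
      { lam : ℝ | ∃ ψ : ℝ → ℝ, ContDiff ℝ (⊤ : ℕ∞) ψ ∧
        (∫ r in r₁..r₂, (ψ r) ^ 2 * r) ≠ 0 ∧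
        lam = ((∫ r in r₁..r₂, (deriv ψ r) ^ 2 * r) + α * r₂ * (ψ r₂) ^ 2)
              / (∫ r in r₁..r₂, (ψ r) ^ 2 * r) } :=
    ⟨fun r => exp (-α * r), by fun_prop, hpos.ne', rfl⟩
  refine ⟨le_csInf ⟨_, hmem⟩ hlower, (csInf_le ⟨_, hlower⟩ hmem).trans ?_⟩
  rw [div_le_iff₀ hpos]
  have h := energy_exp_le hr₁ hr₁₂ hβ
  rw [neg_neg] at h
  refine h.trans (le_of_eq ?_)
  ring

theorem neumann_robin_annulus_asymptotics
    (r₁ r₂ : ℝ) (hr₁ : 0 < r₁) (hr₁₂ : r₁ < r₂) :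
    (fun α : ℝ => nrEig α r₁ r₂ - (-α ^ 2 + α / r₂))
      =o[atBot] (fun α : ℝ => α) := by
  have hbdd : (fun α : ℝ => nrEig α r₁ r₂ - (-α ^ 2 + α / r₂))
      =O[atBot] (fun _ => (1 : ℝ)) := by
    refine IsBigO.of_bound (riccatiError r₁ r₂) ?_
    filter_upwards [eventually_le_atBot (0 : ℝ)] with α hα
    obtain ⟨h1, h2⟩ := nrEig_mem_Icc hr₁ hr₁₂ hα
    rw [norm_one, mul_one, Real.norm_eq_abs, abs_of_nonpos (by linarith)]
    linarith
  refine hbdd.trans_isLittleO ((isLittleO_const_left (c := (1 : ℝ))).2 (Or.inr ?_))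
  exact tendsto_abs_atBot_atTop

end
end

section
/- Let 0 < r₁ < r₂ and r₃ := √(r₂² − r₁²). The first Neumann–Robin eigenvalue of the planar annulus A_{r₁,r₂} satisfies μ₁^α(A_{r₁,r₂}) = 2α·r₂/r₃² + O(α²) as α → 0. -/
open MeasureTheory Metric Filter Asymptotics Real RealInnerProductSpace

noncomputable section

/-- Completing the square against the weight `g r = -c (r² - r₁²) / 2`, `c = 2αr₂ / (r₂² - r₁²)`,
bounds the Robin energy from below. -/
lemma robin_energy_lower_bound {r₁ r₂ : ℝ} (hr₁ : 0 < r₁) (hr₁₂ : r₁ < r₂) (α : ℝ)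
    {ψ : ℝ → ℝ} (hψ : ContDiff ℝ 1 ψ) :
    (2 * α * r₂ / (r₂ ^ 2 - r₁ ^ 2) - (r₂ / r₁) ^ 2 * α ^ 2) * (∫ r in r₁..r₂, (ψ r) ^ 2 * r) ≤
      (∫ r in r₁..r₂, (deriv ψ r) ^ 2 * r) + α * r₂ * (ψ r₂) ^ 2 := by
  have hM : 0 < r₂ ^ 2 - r₁ ^ 2 := by nlinarith
  set c := 2 * α * r₂ / (r₂ ^ 2 - r₁ ^ 2) with hc
  set K := (r₂ / r₁) ^ 2 * α ^ 2 with hK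
  have hcM : c * (r₂ ^ 2 - r₁ ^ 2) = 2 * α * r₂ := by rw [hc]; field_simp
  have hKr : K * r₁ ^ 2 = (α * r₂) ^ 2 := by rw [hK]; field_simp
  have hd : Continuous (deriv ψ) := hψ.continuous_deriv le_rfl
  have hψc : Continuous ψ := hψ.continuous
  have hder : ∀ r : ℝ, HasDerivAt (fun r => c * (r ^ 2 - r₁ ^ 2) / 2 * ψ r ^ 2)
      (c * r * ψ r ^ 2 + c * (r ^ 2 - r₁ ^ 2) * (ψ r * deriv ψ r)) r := by
    intro r
    have h1 : HasDerivAt ψ (deriv ψ r) r :=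
      (hψ.differentiable one_ne_zero r).hasDerivAt
    have h2 : HasDerivAt (fun r : ℝ => c * (r ^ 2 - r₁ ^ 2) / 2) (c * (2 * r) / 2) r := by
      simpa using ((((hasDerivAt_id r).pow 2).sub_const (r₁ ^ 2)).const_mul c).div_const 2
    refine (h2.mul (h1.pow 2)).congr_deriv ?_
    simp
    ring
  have hftc : ∫ r in r₁..r₂, (c * r * ψ r ^ 2 + c * (r ^ 2 - r₁ ^ 2) * (ψ r * deriv ψ r))
      = α * r₂ * ψ r₂ ^ 2 := by
    rw [intervalIntegral.integral_eq_sub_of_hasDerivAt (fun r _ => hder r)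
      ((by fun_prop : Continuous _).intervalIntegrable _ _), hcM]
    ring
  rw [← hftc, ← intervalIntegral.integral_add ((by fun_prop : Continuous _).intervalIntegrable _ _)
    ((by fun_prop : Continuous _).intervalIntegrable _ _), ← intervalIntegral.integral_const_mul]
  refine intervalIntegral.integral_mono_on hr₁₂.le
    ((by fun_prop : Continuous _).intervalIntegrable _ _)
    ((by fun_prop : Continuous _).intervalIntegrable _ _) ?_
  rintro r ⟨h1, h2⟩
  have hr : 0 < r := hr₁.trans_le h1
  set g := c * (r ^ 2 - r₁ ^ 2) / 2 with hg
  have hg2 : g ^ 2 ≤ K * r ^ 2 := by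
    have h3 : (r ^ 2 - r₁ ^ 2) ^ 2 ≤ (r₂ ^ 2 - r₁ ^ 2) ^ 2 :=
      pow_le_pow_left₀ (by nlinarith) (by nlinarith) 2
    calc g ^ 2 = (c / 2) ^ 2 * (r ^ 2 - r₁ ^ 2) ^ 2 := by rw [hg]; ring
      _ ≤ (c / 2) ^ 2 * (r₂ ^ 2 - r₁ ^ 2) ^ 2 := by gcongr
      _ = (c * (r₂ ^ 2 - r₁ ^ 2)) ^ 2 / 4 := by ring
      _ = K * r₁ ^ 2 := by rw [hcM, hKr]; ring
      _ ≤ K * r ^ 2 := by gcongr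
  have hgr : g ^ 2 / r ≤ K * r := by
    rw [div_le_iff₀ hr]; linarith
  have hsq : 0 ≤ (deriv ψ r * r + g * ψ r) ^ 2 / r := by positivity
  have hexp : (deriv ψ r * r + g * ψ r) ^ 2 / r
      = deriv ψ r ^ 2 * r + 2 * g * (ψ r * deriv ψ r) + g ^ 2 / r * ψ r ^ 2 := by
    field_simp
    ring
  have hcg : c * (r ^ 2 - r₁ ^ 2) = 2 * g := by rw [hg]; ring
  rw [hcg]
  nlinarith [mul_le_mul_of_nonneg_right hgr (sq_nonneg (ψ r))]

theorem neumann_robin_annulus_small_alpha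
    (r₁ r₂ : ℝ) (hr₁ : 0 < r₁) (hr₁₂ : r₁ < r₂) :
    (fun α : ℝ => nrEig α r₁ r₂ - 2 * α * r₂ / Real.sqrt (r₂ ^ 2 - r₁ ^ 2) ^ 2)
      =O[nhds (0 : ℝ)] (fun α : ℝ => α ^ 2) := by
  have hM : 0 < r₂ ^ 2 - r₁ ^ 2 := by nlinarith
  refine IsBigO.of_bound ((r₂ / r₁) ^ 2) (Eventually.of_forall fun α => ?_)
  rw [Real.sq_sqrt hM.le, Real.norm_eq_abs, Real.norm_eq_abs, abs_of_nonneg (sq_nonneg α)]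
  have hone : ∫ r in r₁..r₂, ((1 : ℝ)) ^ 2 * r = (r₂ ^ 2 - r₁ ^ 2) / 2 := by simp
  have hmem : 2 * α * r₂ / (r₂ ^ 2 - r₁ ^ 2) ∈ { lam : ℝ | ∃ ψ : ℝ → ℝ, ContDiff ℝ (⊤ : ℕ∞) ψ ∧
      (∫ r in r₁..r₂, (ψ r) ^ 2 * r) ≠ 0 ∧
      lam = ((∫ r in r₁..r₂, (deriv ψ r) ^ 2 * r) + α * r₂ * (ψ r₂) ^ 2)
          / (∫ r in r₁..r₂, (ψ r) ^ 2 * r) } := by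
    refine ⟨fun _ => 1, contDiff_const, ?_, ?_⟩
    · rw [hone]; positivity
    · rw [hone]
      simp
      field_simp
  have hlow : 2 * α * r₂ / (r₂ ^ 2 - r₁ ^ 2) - (r₂ / r₁) ^ 2 * α ^ 2 ∈
      lowerBounds { lam : ℝ | ∃ ψ : ℝ → ℝ, ContDiff ℝ (⊤ : ℕ∞) ψ ∧
      (∫ r in r₁..r₂, (ψ r) ^ 2 * r) ≠ 0 ∧
      lam = ((∫ r in r₁..r₂, (deriv ψ r) ^ 2 * r) + α * r₂ * (ψ r₂) ^ 2)
          / (∫ r in r₁..r₂, (ψ r) ^ 2 * r) } := by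
    rintro _ ⟨ψ, hψ, hne, rfl⟩
    have hpos : 0 < ∫ r in r₁..r₂, (ψ r) ^ 2 * r :=
      lt_of_le_of_ne (intervalIntegral.integral_nonneg hr₁₂.le fun r hr =>
        mul_nonneg (sq_nonneg _) (hr₁.le.trans hr.1)) hne.symm
    rw [le_div_iff₀ hpos]
    exact robin_energy_lower_bound hr₁ hr₁₂ α (hψ.of_le (by exact_mod_cast le_top))
  have hupper : nrEig α r₁ r₂ ≤ _ := csInf_le ⟨_, hlow⟩ hmem
  have hlower : _ ≤ nrEig α r₁ r₂ := le_csInf ⟨_, hmem⟩ hlow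
  rw [abs_le]
  constructor <;> nlinarith [mul_nonneg (sq_nonneg (r₂ / r₁)) (sq_nonneg α)]

end
end
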